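/- Let F be a 3-uniform hypergraph. If the codegree Turán density of F is zero, then the uniform Turán density of F is zero; that is, π_co(F) = 0 implies π_⋅(F) = 0. -/

import Mathlib

open Filter

/-- A 3-uniform hypergraph on vertex type `V`: a set of edges, each of size 3. -/
structure H3 (V : Type) [DecidableEq V] where
  edges : Finset (Finset V)
  card3 : ∀ e ∈ edges, e.card = 3

namespace H3

variable {V W : Type} [DecidableEq V] [DecidableEq W]

/-- `H` contains a copy of `F`: an injection of vertices mapping edges to edges. -/
def contains (H : H3 V) (F : H3 W) : Prop :=
  ∃ f : W → V, Function.Injective f ∧ ∀ e ∈ F.edges, e.image f ∈ H.edges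

/-- `H` is `F`-free. -/
def free (H : H3 V) (F : H3 W) : Prop := ¬ H.contains F

/-- The codegree of a pair of vertices: the number of edges containing both. -/
def codeg (H : H3 V) (u v : V) : ℕ :=
  (H.edges.filter fun e => u ∈ e ∧ v ∈ e).card

/-- The minimum codegree: the minimum of `codeg` over pairs of distinct vertices. -/
noncomputable def minCodeg [Fintype V] (H : H3 V) : ℕ :=
  sInf {d | ∃ u v : V, u ≠ v ∧ H.codeg u v = d}

/-- `H` is uniformly `(d, η)`-dense: every vertex subset `U` spans at least
`d * C(|U|,3) - η * n^3` edges. -/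
def uniformlyDense [Fintype V] (H : H3 V) (d η : ℝ) : Prop :=
  ∀ U : Finset V,
    d * (U.card.choose 3 : ℝ) - η * (Fintype.card V : ℝ) ^ 3
      ≤ ((H.edges.filter fun e => e ⊆ U).card : ℝ)

end H3

/-- The uniform Turán density `π_⋅(F)`. -/
noncomputable def uniformTuranDensity {W : Type} [DecidableEq W] (F : H3 W) : ℝ :=
  sSup {d : ℝ | 0 ≤ d ∧ d ≤ 1 ∧
    ∀ η : ℝ, 0 < η → ∀ n₀ : ℕ, ∃ n, n₀ ≤ n ∧
      ∃ H : H3 (Fin n), H.free F ∧ H.uniformlyDense d η}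

/-- The codegree Turán number `ex_co(n, F)`: the maximum minimum codegree of an
`n`-vertex `F`-free 3-graph. -/
noncomputable def exCodeg {W : Type} [DecidableEq W] (n : ℕ) (F : H3 W) : ℕ :=
  sSup {d | ∃ H : H3 (Fin n), H.free F ∧ H.minCodeg = d}

/-- The codegree Turán density `π_co(F) = lim_n ex_co(n,F)/n` (the limit exists,
so it coincides with the limsup). -/
noncomputable def codegTuranDensity {W : Type} [DecidableEq W] (F : H3 W) : ℝ :=
  Filter.limsup (fun n : ℕ => (exCodeg n F : ℝ) / n) Filter.atTop

namespace CodegreeDensity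

open scoped BigOperators

/-- Finite Ramsey theorem for two-colourings of `k`-subsets. -/
theorem exists_ramsey (k N : ℕ) : ∃ M, ∀ (α : Type) (A : Finset α), M ≤ A.card →
    ∀ χ : Finset α → Prop, ∃ B ⊆ A, B.card = N ∧
      ((∀ T ⊆ B, T.card = k → χ T) ∨ (∀ T ⊆ B, T.card = k → ¬ χ T)) := by
  classical
  induction k generalizing N with
  | zero =>
    refine ⟨N, fun α A hA χ => ?_⟩
    obtain ⟨B, hB, hc⟩ := Finset.exists_subset_card_eq hA
    refine ⟨B, hB, hc, ?_⟩
    by_cases h : χ ∅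
    · left; intro T _ hT; rw [Finset.card_eq_zero] at hT; rwa [hT]
    · right; intro T _ hT; rw [Finset.card_eq_zero] at hT; rwa [hT]
  | succ k ih =>
    have key : ∀ L : ℕ, ∃ M, ∀ (α : Type) (A : Finset α), M ≤ A.card → ∀ χ : Finset α → Prop,
        ∃ S ⊆ A, S.card = L ∧ ∃ g : α → Prop, ∀ T ⊆ S, T.card = k + 1 →
          ∃ m ∈ T, (χ T ↔ g m) := by
      intro L
      induction L with
      | zero =>
        refine ⟨0, fun α A _ χ => ⟨∅, by simp, rfl, fun _ => True, fun T hT hc => ?_⟩⟩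
        rw [Finset.subset_empty.1 hT] at hc
        simp at hc
      | succ L ihL =>
        obtain ⟨ML, hML⟩ := ihL
        obtain ⟨R, hR⟩ := ih ML
        refine ⟨R + 1, fun α A hA χ => ?_⟩
        have hne : A.Nonempty := Finset.card_pos.1 (by omega)
        obtain ⟨a, ha⟩ := hne
        obtain ⟨B, hB, hBc, hBh⟩ := hR α (A.erase a)
          (by rw [Finset.card_erase_of_mem ha]; omega) (fun T => χ (insert a T))
        have haB : a ∉ B := fun h => by simpa using hB h
        obtain ⟨v, hv⟩ : ∃ v : Prop, ∀ T ⊆ B, T.card = k → (χ (insert a T) ↔ v) := by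
          rcases hBh with h | h
          · exact ⟨True, fun T hT hc => by simp [h T hT hc]⟩
          · exact ⟨False, fun T hT hc => by simp [h T hT hc]⟩
        obtain ⟨S, hS, hSc, g, hg⟩ := hML α B hBc.ge χ
        have haS : a ∉ S := fun h => haB (hS h)
        refine ⟨insert a S, ?_, by rw [Finset.card_insert_of_notMem haS, hSc],
          Function.update g a v, fun T hT hc => ?_⟩
        · intro x hx
          rcases Finset.mem_insert.1 hx with rfl | hx
          · exact ha
          · exact Finset.mem_of_mem_erase (hB (hS hx))
        · by_cases haT : a ∈ T
          · refine ⟨a, haT, ?_⟩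
            have := hv (T.erase a) (fun x hx => by
              have h1 := Finset.mem_erase.1 hx
              exact hS ((Finset.mem_insert.1 (hT h1.2)).resolve_left h1.1))
              (by rw [Finset.card_erase_of_mem haT]; omega)
            rw [Finset.insert_erase haT] at this
            simpa using this
          · have hTS : T ⊆ S := fun x hx =>
              (Finset.mem_insert.1 (hT hx)).resolve_left (fun h => haT (h ▸ hx))
            obtain ⟨m, hm, hm'⟩ := hg T hTS hc
            refine ⟨m, hm, ?_⟩
            have hma : m ≠ a := fun h => haT (h ▸ hm)
            rw [Function.update_of_ne hma]
            exact hm'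
    obtain ⟨M, hM⟩ := key (2 * N)
    refine ⟨M, fun α A hA χ => ?_⟩
    obtain ⟨S, hS, hSc, g, hg⟩ := hM α A hA χ
    have hsum := Finset.card_filter_add_card_filter_not (s := S) g
    rcases le_or_gt N (S.filter g).card with h | h
    · obtain ⟨B, hB, hc⟩ := Finset.exists_subset_card_eq h
      refine ⟨B, (hB.trans (Finset.filter_subset _ _)).trans hS, hc, Or.inl fun T hT hTc => ?_⟩
      obtain ⟨m, hm, hm'⟩ := hg T (hT.trans (hB.trans (Finset.filter_subset _ _))) hTc
      exact hm'.2 (Finset.mem_filter.1 (hB (hT hm))).2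
    · obtain ⟨B, hB, hc⟩ := Finset.exists_subset_card_eq
        (s := S.filter (fun x => ¬ g x)) (n := N) (by omega)
      refine ⟨B, (hB.trans (Finset.filter_subset _ _)).trans hS, hc, Or.inr fun T hT hTc => ?_⟩
      obtain ⟨m, hm, hm'⟩ := hg T (hT.trans (hB.trans (Finset.filter_subset _ _))) hTc
      exact fun h' => (Finset.mem_filter.1 (hB (hT hm))).2 (hm'.1 h')

/-- The average of `f` over the fibre of `π` above `k`. -/
noncomputable def fibreAvg {Ω κ : Type*} [Fintype Ω] (π : Ω → κ) (f : Ω → ℝ) (k : κ) : ℝ :=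
  open Classical in
  (∑ ω with π ω = k, f ω) / ((Finset.univ.filter fun ω => π ω = k).card : ℝ)

section FibreAvg

variable {Ω κ : Type*} [Fintype Ω] (π : Ω → κ) (f : Ω → ℝ)

theorem fibreAvg_nonneg (hf : ∀ ω, 0 ≤ f ω) (k : κ) : 0 ≤ fibreAvg π f k :=
  div_nonneg (Finset.sum_nonneg fun _ _ => hf _) (Nat.cast_nonneg _)

theorem fibreAvg_le_one (hf : ∀ ω, f ω ≤ 1) (k : κ) : fibreAvg π f k ≤ 1 := by
  classical
  refine div_le_one_of_le₀ ?_ (Nat.cast_nonneg _)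
  refine (Finset.sum_le_sum fun ω _ => hf ω).trans ?_
  simp

theorem card_fibre_mul_fibreAvg (k : κ) : open Classical in
    ((Finset.univ.filter fun ω => π ω = k).card : ℝ) * fibreAvg π f k
      = ∑ ω with π ω = k, f ω := by
  classical
  unfold fibreAvg
  rcases (Finset.univ.filter fun ω => π ω = k).eq_empty_or_nonempty with h | h
  · rw [h]; simp
  · have : ((Finset.univ.filter fun ω => π ω = k).card : ℝ) ≠ 0 := by
      exact_mod_cast (Finset.card_pos.2 h).ne'
    field_simp

theorem expect_fibreAvg_mul [Finite κ] (g : κ → ℝ) :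
    𝔼 ω, fibreAvg π f (π ω) * g (π ω) = 𝔼 ω, f ω * g (π ω) := by
  classical
  cases nonempty_fintype κ
  rw [Fintype.expect_eq_sum_div_card, Fintype.expect_eq_sum_div_card]
  congr 1
  rw [← Finset.sum_fiberwise Finset.univ π, ← Finset.sum_fiberwise Finset.univ π]
  refine Finset.sum_congr rfl fun k _ => ?_
  have h1 : ∑ ω with π ω = k, fibreAvg π f (π ω) * g (π ω)
      = ∑ ω with π ω = k, fibreAvg π f k * g k :=
    Finset.sum_congr rfl fun ω hω => by rw [(Finset.mem_filter.1 hω).2]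
  have h2 : ∑ ω with π ω = k, f ω * g (π ω) = ∑ ω with π ω = k, f ω * g k :=
    Finset.sum_congr rfl fun ω hω => by rw [(Finset.mem_filter.1 hω).2]
  rw [h1, h2, ← Finset.sum_mul, Finset.sum_const, nsmul_eq_mul,
    card_fibre_mul_fibreAvg, Finset.sum_mul]

/-- The mean square of the conditional expectation of `f` given `π`. -/
noncomputable def energy : ℝ := 𝔼 ω, fibreAvg π f (π ω) ^ 2

theorem energy_nonneg : 0 ≤ energy π f :=
  Finset.expect_nonneg fun _ _ => sq_nonneg _

theorem energy_le_one [Nonempty Ω] (h0 : ∀ ω, 0 ≤ f ω) (h1 : ∀ ω, f ω ≤ 1) :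
    energy π f ≤ 1 := by
  refine Finset.expect_le Finset.univ_nonempty fun ω _ => ?_
  exact pow_le_one₀ (fibreAvg_nonneg π f h0 _) (fibreAvg_le_one π f h1 _)

theorem expect_sq_fibreAvg_sub {κ' : Type*} [Finite κ'] [Finite κ] (π' : Ω → κ') (ρ : κ' → κ)
    (hρ : ∀ ω, π ω = ρ (π' ω)) :
    𝔼 ω, (fibreAvg π' f (π' ω) - fibreAvg π f (π ω)) ^ 2 = energy π' f - energy π f := by
  have h1 := expect_fibreAvg_mul π' f (fun k => fibreAvg π f (ρ k))
  have h2 := expect_fibreAvg_mul π f (fun k => fibreAvg π f k)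
  simp only [← hρ] at h1
  have h3 : ∀ ω, (fibreAvg π' f (π' ω) - fibreAvg π f (π ω)) ^ 2
      = fibreAvg π' f (π' ω) ^ 2 - 2 * (fibreAvg π' f (π' ω) * fibreAvg π f (π ω))
        + fibreAvg π f (π ω) * fibreAvg π f (π ω) := fun ω => by ring
  simp only [h3, Finset.expect_add_distrib, Finset.expect_sub_distrib, ← Finset.mul_expect]
  rw [h1, ← h2]
  simp only [energy, pow_two]
  ring

theorem expect_abs_le_of_sq [Nonempty Ω] {g : Ω → ℝ} {ε : ℝ} (hε : 0 < ε)
    (h : 𝔼 ω, g ω ^ 2 ≤ ε ^ 2) : 𝔼 ω, |g ω| ≤ ε := by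
  have h1 : ∀ ω, |g ω| ≤ g ω ^ 2 * (1 / (2 * ε)) + ε / 2 := fun ω => by
    have : 0 ≤ (|g ω| - ε) ^ 2 / (2 * ε) := by positivity
    have h2 : (|g ω| - ε) ^ 2 / (2 * ε) = g ω ^ 2 * (1 / (2 * ε)) + ε / 2 - |g ω| := by
      rw [← sq_abs (g ω)]; field_simp; ring
    linarith
  calc 𝔼 ω, |g ω| ≤ 𝔼 ω, (g ω ^ 2 * (1 / (2 * ε)) + ε / 2) :=
        Finset.expect_le_expect fun ω _ => h1 ω
    _ = (𝔼 ω, g ω ^ 2) * (1 / (2 * ε)) + ε / 2 := by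
        rw [Finset.expect_add_distrib, ← Finset.expect_mul, Fintype.expect_const]
    _ ≤ ε ^ 2 * (1 / (2 * ε)) + ε / 2 := by gcongr
    _ = ε := by field_simp; ring

/-- If passing from `π` to the refinement `π'` gains little energy, then `f` and its conditional
expectation given `π` are indistinguishable for bounded `π'`-measurable test functions. -/
theorem expect_sub_fibreAvg_mul_le [Nonempty Ω] {κ' : Type*} [Finite κ'] [Finite κ] (π' : Ω → κ')
    (ρ : κ' → κ) (hρ : ∀ ω, π ω = ρ (π' ω)) {ε : ℝ} (hε : 0 < ε)
    (hen : energy π' f ≤ energy π f + ε ^ 2) (g : κ' → ℝ) (hg : ∀ k, |g k| ≤ 1) :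
    𝔼 ω, (f ω - fibreAvg π f (π ω)) * g (π' ω) ≤ ε := by
  have h1 := expect_fibreAvg_mul π' f g
  have h2 : 𝔼 ω, |fibreAvg π' f (π' ω) - fibreAvg π f (π ω)| ≤ ε :=
    expect_abs_le_of_sq hε (by rw [expect_sq_fibreAvg_sub π f π' ρ hρ]; linarith)
  calc 𝔼 ω, (f ω - fibreAvg π f (π ω)) * g (π' ω)
      = 𝔼 ω, (fibreAvg π' f (π' ω) - fibreAvg π f (π ω)) * g (π' ω) := by
        simp only [sub_mul, Finset.expect_sub_distrib, h1]
    _ ≤ 𝔼 ω, |fibreAvg π' f (π' ω) - fibreAvg π f (π ω)| := by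
        refine Finset.expect_le_expect fun ω _ => ?_
        refine (le_abs_self _).trans ?_
        rw [abs_mul]
        exact mul_le_of_le_one_right (abs_nonneg _) (hg _)
    _ ≤ ε := h2

end FibreAvg

/-- Energy increment: starting anywhere of size at most `s₀`, one finds within bounded size an
element whose refinements of size controlled by `R` gain at most `ε` energy. -/
theorem exists_energy_stable.{u} (R : ℕ → ℕ) (s₀ : ℕ) {ε : ℝ} (hε : 0 < ε) :
    ∃ B : ℕ, ∀ (P : Type u) (size : P → ℕ) (en : P → ℝ) (refines : P → P → Prop),
      (∀ p, 0 ≤ en p) → (∀ p, en p ≤ 1) → ∀ p₀, size p₀ ≤ s₀ →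
      ∃ p, size p ≤ B ∧ ∀ p', refines p' p → size p' ≤ R (size p) → en p' ≤ en p + ε := by
  have key : ∀ k s : ℕ, ∃ B : ℕ, ∀ (P : Type u) (size : P → ℕ) (en : P → ℝ)
      (refines : P → P → Prop), (∀ p, en p ≤ 1) → ∀ p₀, size p₀ ≤ s → 1 - k * ε < en p₀ →
      ∃ p, size p ≤ B ∧ ∀ p', refines p' p → size p' ≤ R (size p) → en p' ≤ en p + ε := by
    intro k
    induction k with
    | zero =>
      refine fun s => ⟨0, fun P size en ref h1 p₀ _ hp => ?_⟩
      have := h1 p₀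
      simp at hp
      linarith
    | succ k ih =>
      intro s
      obtain ⟨B, hB⟩ := ih (∑ i ∈ Finset.range (s + 1), R i)
      refine ⟨max B s, fun P size en ref h1 p₀ hs hp => ?_⟩
      by_cases h : ∀ p', ref p' p₀ → size p' ≤ R (size p₀) → en p' ≤ en p₀ + ε
      · exact ⟨p₀, hs.trans (le_max_right _ _), h⟩
      · push Not at h
        obtain ⟨p', _, hs', he⟩ := h
        obtain ⟨p, hp, hp'⟩ := hB P size en ref h1 p'
          (hs'.trans (Finset.single_le_sum (f := R) (fun _ _ => Nat.zero_le _)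
            (Finset.mem_range.2 (Nat.lt_succ_of_le hs)))) (by push_cast at hp; linarith)
        exact ⟨p, hp.trans (le_max_left _ _), hp'⟩
  obtain ⟨k, hk⟩ := exists_nat_gt (1 / ε)
  obtain ⟨B, hB⟩ := key k s₀
  refine ⟨B, fun P size en ref h0 h1 p₀ hs => hB P size en ref h1 p₀ hs ?_⟩
  have := h0 p₀
  rw [div_lt_iff₀ hε] at hk
  linarith

/-- Regularity for a function of triples with respect to colourings of pairs: up to `ε`, the
function `h` looks like a function of the three pair colours to all test functions of bounded
complexity on pairs. -/
theorem exists_pair_colouring (T : ℕ → ℕ) {ε : ℝ} (hε : 0 < ε) :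
    ∃ B : ℕ, ∀ (V : Type) [Fintype V] [Nonempty V] (h : V → V → V → ℝ),
      (∀ x y z, 0 ≤ h x y z) → (∀ x y z, h x y z ≤ 1) →
      ∃ (κ : Type) (_ : Fintype κ) (q : V → V → κ) (W : κ → κ → κ → ℝ),
        Nat.card κ ≤ B ∧ (∀ a b c, 0 ≤ W a b c) ∧ (∀ a b c, W a b c ≤ 1) ∧
        ∀ (τ : Type) [Finite τ], Nat.card τ ≤ T (Nat.card κ) → ∀ (g : V → V → τ)
          (F : τ → τ → τ → ℝ), (∀ a b c, |F a b c| ≤ 1) →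
          𝔼 x, 𝔼 y, 𝔼 z, (h x y z - W (q x y) (q x z) (q y z)) *
            F (g x y) (g x z) (g y z) ≤ ε := by
  obtain ⟨B, hB⟩ := exists_energy_stable.{1} (fun r => r * T r) 1 (ε := ε ^ 2) (by positivity)
  refine ⟨B, fun V _ _ h h0 h1 => ?_⟩
  let f : V × V × V → ℝ := fun ω => h ω.1 ω.2.1 ω.2.2
  let tri : ∀ {κ : Type}, (V → V → κ) → V × V × V → κ × κ × κ :=
    fun q ω => (q ω.1 ω.2.1, q ω.1 ω.2.2, q ω.2.1 ω.2.2)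
  obtain ⟨⟨⟨κ, hκ⟩, q⟩, hqB, hq⟩ := hB (Σ κ : {κ : Type // Finite κ}, V → V → κ.1)
    (fun p => Nat.card p.1.1) (fun p => energy (tri p.2) f)
    (fun p' p => ∃ ρ : p'.1.1 → p.1.1, ∀ x y, p.2 x y = ρ (p'.2 x y))
    (fun p => energy_nonneg _ _)
    (fun p => energy_le_one _ _ (fun ω => h0 _ _ _) (fun ω => h1 _ _ _))
    ⟨⟨Unit, inferInstance⟩, fun _ _ => ()⟩ (by simp)
  simp only at hqB hq
  cases nonempty_fintype κ
  refine ⟨κ, inferInstance, q, fun a b c => fibreAvg (tri q) f (a, b, c), hqB,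
    fun a b c => fibreAvg_nonneg _ _ (fun ω => h0 _ _ _) _,
    fun a b c => fibreAvg_le_one _ _ (fun ω => h1 _ _ _) _, fun τ _ hτ g F hF => ?_⟩
  have hen := hq ⟨⟨κ × τ, inferInstance⟩, fun x y => (q x y, g x y)⟩ ⟨Prod.fst, fun _ _ => rfl⟩
    (by simp only [Nat.card_prod]; exact Nat.mul_le_mul_left _ hτ)
  have := expect_sub_fibreAvg_mul_le (tri q) f (tri fun x y => (q x y, g x y))
    (fun k => (k.1.1, k.2.1.1, k.2.2.1)) (fun ω => rfl) hε hen
    (fun k => F k.1.2 k.2.1.2 k.2.2.2) (fun k => hF _ _ _)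
  rw [← Finset.univ_product_univ, Finset.expect_product] at this
  simp only [← Finset.univ_product_univ, Finset.expect_product] at this
  exact this

/-- Regularity for a colouring of pairs with respect to a partition of the vertices. -/
theorem exists_vertex_partition (r : ℕ) {ε : ℝ} (hε : 0 < ε) :
    ∃ S : ℕ, ∀ (V : Type) [Fintype V] [Nonempty V] (κ : Type) [Fintype κ] [DecidableEq κ]
      (q : V → V → κ), Nat.card κ ≤ r →
      ∃ (σ : Type) (_ : Fintype σ) (p : V → σ) (μ : κ → σ → σ → ℝ),
        Nat.card σ ≤ S ∧ (∀ α a b, 0 ≤ μ α a b) ∧ (∀ α a b, μ α a b ≤ 1) ∧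
        (∀ x y, ∑ α, μ α (p x) (p y) = 1) ∧
        ∀ (α : κ) (s : σ → σ → ℝ) (u v : V → ℝ), (∀ a b, |s a b| ≤ 1) →
          (∀ x, u x = 0 ∨ u x = 1) → (∀ x, v x = 0 ∨ v x = 1) →
          𝔼 x, 𝔼 y, ((if q x y = α then 1 else 0) - μ α (p x) (p y)) *
            (s (p x) (p y) * u x * v y) ≤ ε := by
  classical
  obtain ⟨S, hS⟩ := exists_energy_stable.{1} (fun r => r * 4) 1 (ε := ε ^ 2 / (r + 1))
    (by positivity)
  refine ⟨S, fun V _ _ κ _ _ q hr => ?_⟩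
  let f : κ → V × V → ℝ := fun α ω => if q ω.1 ω.2 = α then 1 else 0
  have f0 : ∀ α ω, 0 ≤ f α ω := fun α ω => by simp only [f]; split_ifs <;> norm_num
  have f1 : ∀ α ω, f α ω ≤ 1 := fun α ω => by simp only [f]; split_ifs <;> norm_num
  let sq : ∀ {σ : Type}, (V → σ) → V × V → σ × σ := fun p ω => (p ω.1, p ω.2)
  obtain ⟨⟨⟨σ, hσ⟩, p⟩, hpS, hp⟩ := hS (Σ σ : {σ : Type // Finite σ}, V → σ.1)
    (fun p => Nat.card p.1.1) (fun p => 𝔼 α, energy (sq p.2) (f α))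
    (fun p' p => ∃ ρ : p'.1.1 → p.1.1, ∀ x, p.2 x = ρ (p'.2 x))
    (fun p => Finset.expect_nonneg fun _ _ => energy_nonneg _ _)
    (fun p => by
      rcases isEmpty_or_nonempty κ with hκ | hκ
      · simp [Finset.univ_eq_empty]
      · exact Finset.expect_le Finset.univ_nonempty fun α _ => energy_le_one _ _ (f0 α) (f1 α))
    ⟨⟨Unit, inferInstance⟩, fun _ => ()⟩ (by simp)
  simp only at hpS hp
  cases nonempty_fintype σ
  refine ⟨σ, inferInstance, p, fun α a b => fibreAvg (sq p) (f α) (a, b), hpS,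
    fun α a b => fibreAvg_nonneg _ _ (f0 α) _, fun α a b => fibreAvg_le_one _ _ (f1 α) _,
    fun x y => ?_, fun α s u v hs hu hv => ?_⟩
  · simp only [fibreAvg]
    rw [← Finset.sum_div, Finset.sum_comm]
    have : ∀ ω : V × V, ∑ α, f α ω = 1 := fun ω => by simp [f]
    simp only [this, Finset.sum_const, nsmul_eq_mul, mul_one]
    apply div_self
    have : (x, y) ∈ (Finset.univ.filter fun ω => sq p ω = (p x, p y)) := by simp [sq]
    exact_mod_cast (Finset.card_pos.2 ⟨_, this⟩).ne'
  · let p' : V → σ × Prop × Prop := fun x => (p x, u x = 1, v x = 1)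
    have hen := hp ⟨⟨σ × Prop × Prop, inferInstance⟩, p'⟩
      ⟨Prod.fst, fun _ => rfl⟩ (by simp [Nat.card_eq_fintype_card])
    simp only at hen
    have hle : ∀ β, energy (sq p) (f β) ≤ energy (sq p') (f β) := fun β => by
      have := expect_sq_fibreAvg_sub (sq p) (f β) (sq p') (fun k => (k.1.1, k.2.1)) (fun ω => rfl)
      have h2 : 0 ≤ 𝔼 ω, (fibreAvg (sq p') (f β) (sq p' ω)
        - fibreAvg (sq p) (f β) (sq p ω)) ^ 2 := Finset.expect_nonneg fun _ _ => sq_nonneg _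
      linarith
    have hα : energy (sq p') (f α) ≤ energy (sq p) (f α) + ε ^ 2 := by
      have hκ : (0 : ℝ) < Fintype.card κ := by exact_mod_cast Fintype.card_pos_iff.2 ⟨α⟩
      have hκr : (Fintype.card κ : ℝ) ≤ r + 1 := by
        rw [Nat.card_eq_fintype_card] at hr
        have : (Fintype.card κ : ℝ) ≤ r := by exact_mod_cast hr
        linarith
      rw [Fintype.expect_eq_sum_div_card, Fintype.expect_eq_sum_div_card,
        div_le_iff₀ hκ, add_mul, div_mul_cancel₀ _ hκ.ne'] at hen
      have h3 : energy (sq p') (f α) - energy (sq p) (f α)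
          ≤ ∑ β, (energy (sq p') (f β) - energy (sq p) (f β)) :=
        Finset.single_le_sum (f := fun β => energy (sq p') (f β) - energy (sq p) (f β))
          (fun β _ => sub_nonneg.2 (hle β)) (Finset.mem_univ α)
      rw [Finset.sum_sub_distrib] at h3
      have h4 : ε ^ 2 / (r + 1) * Fintype.card κ ≤ ε ^ 2 := by
        rw [div_mul_eq_mul_div, div_le_iff₀ (by positivity)]
        gcongr
      linarith
    have := expect_sub_fibreAvg_mul_le (sq p) (f α) (sq p') (fun k => (k.1.1, k.2.1))
      (fun ω => rfl) hε hα
      (fun k => s k.1.1 k.2.1 * (if k.1.2.1 then 1 else 0) * (if k.2.2.2 then 1 else 0))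
      (fun k => by
        have := hs k.1.1 k.2.1
        split_ifs <;> simp [this])
    simp only [← Finset.univ_product_univ, Finset.expect_product] at this
    convert this using 6 with x _ y
    · simp only [sq, p']
      rcases hu x with h | h <;> simp [h]
    · simp only [sq, p']
      rcases hv y with h | h <;> simp [h]

theorem exists_indicator_mul_le (t c : ℝ) (h0 : 0 ≤ t) (h1 : t ≤ 1) :
    ∃ t' : ℝ, (t' = 0 ∨ t' = 1) ∧ t' * c ≤ t * c := by
  rcases le_or_gt 0 c with hc | hc
  · exact ⟨0, Or.inl rfl, by simpa using mul_nonneg h0 hc⟩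
  · exact ⟨1, Or.inr rfl, by nlinarith⟩

section
variable {V : Type} [Fintype V]

theorem expect_congr₂ {f g : V → V → ℝ} (h : ∀ x y, f x y = g x y) :
    𝔼 x, 𝔼 y, f x y = 𝔼 x, 𝔼 y, g x y := by
  simp only [h]

theorem expect_congr₃ {f g : V → V → V → ℝ} (h : ∀ x y z, f x y z = g x y z) :
    𝔼 x, 𝔼 y, 𝔼 z, f x y z = 𝔼 x, 𝔼 y, 𝔼 z, g x y z := by
  simp only [h]

theorem expect_comm_right (f : V → V → V → ℝ) :
    𝔼 x, 𝔼 y, 𝔼 z, f x y z = 𝔼 x, 𝔼 z, 𝔼 y, f x y z :=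
  Finset.expect_congr rfl fun _ _ => Finset.expect_comm _ _ _

theorem expect_rotate (f : V → V → V → ℝ) :
    𝔼 x, 𝔼 y, 𝔼 z, f x y z = 𝔼 y, 𝔼 z, 𝔼 x, f x y z := by
  rw [Finset.expect_comm]
  exact Finset.expect_congr rfl fun _ _ => Finset.expect_comm _ _ _

/-- A lower bound for indicator weights on pairs extends to `[0,1]`-valued weights. -/
theorem le_expect_pair_weights {D : V → V → V → ℝ} {ε : ℝ}
    (H : ∀ a b c : V → V → ℝ, (∀ x y, a x y = 0 ∨ a x y = 1) → (∀ x y, b x y = 0 ∨ b x y = 1) →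
      (∀ x y, c x y = 0 ∨ c x y = 1) →
      ε ≤ 𝔼 x, 𝔼 y, 𝔼 z, D x y z * (a x y * b x z * c y z))
    (a b c : V → V → ℝ) (ha : ∀ x y, 0 ≤ a x y ∧ a x y ≤ 1) (hb : ∀ x y, 0 ≤ b x y ∧ b x y ≤ 1)
    (hc : ∀ x y, 0 ≤ c x y ∧ c x y ≤ 1) :
    ε ≤ 𝔼 x, 𝔼 y, 𝔼 z, D x y z * (a x y * b x z * c y z) := by
  choose a' ha' ha2 using fun x y => exists_indicator_mul_le (a x y)
    (𝔼 z, D x y z * (b x z * c y z)) (ha x y).1 (ha x y).2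
  choose b' hb' hb2 using fun x z => exists_indicator_mul_le (b x z)
    (𝔼 y, D x y z * (a' x y * c y z)) (hb x z).1 (hb x z).2
  choose c' hc' hc2 using fun y z => exists_indicator_mul_le (c y z)
    (𝔼 x, D x y z * (a' x y * b' x z)) (hc y z).1 (hc y z).2
  refine (H a' b' c' ha' hb' hc').trans ?_
  calc 𝔼 x, 𝔼 y, 𝔼 z, D x y z * (a' x y * b' x z * c' y z)
      = 𝔼 y, 𝔼 z, c' y z * 𝔼 x, D x y z * (a' x y * b' x z) := by
        rw [expect_rotate]; simp only [Finset.mul_expect]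
        exact expect_congr₃ fun _ _ _ => by ring
    _ ≤ 𝔼 y, 𝔼 z, c y z * 𝔼 x, D x y z * (a' x y * b' x z) :=
        Finset.expect_le_expect fun y _ => Finset.expect_le_expect fun z _ => hc2 y z
    _ = 𝔼 x, 𝔼 y, 𝔼 z, D x y z * (a' x y * b' x z * c y z) := by
        rw [expect_rotate]; simp only [Finset.mul_expect]
        exact expect_congr₃ fun _ _ _ => by ring
    _ = 𝔼 x, 𝔼 z, b' x z * 𝔼 y, D x y z * (a' x y * c y z) := by
        rw [expect_comm_right]; simp only [Finset.mul_expect]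
        exact expect_congr₃ fun _ _ _ => by ring
    _ ≤ 𝔼 x, 𝔼 z, b x z * 𝔼 y, D x y z * (a' x y * c y z) :=
        Finset.expect_le_expect fun y _ => Finset.expect_le_expect fun z _ => hb2 y z
    _ = 𝔼 x, 𝔼 y, 𝔼 z, D x y z * (a' x y * b x z * c y z) := by
        rw [expect_comm_right]; simp only [Finset.mul_expect]
        exact expect_congr₃ fun _ _ _ => by ring
    _ = 𝔼 x, 𝔼 y, a' x y * 𝔼 z, D x y z * (b x z * c y z) := by
        simp only [Finset.mul_expect]
        exact expect_congr₃ fun _ _ _ => by ring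
    _ ≤ 𝔼 x, 𝔼 y, a x y * 𝔼 z, D x y z * (b x z * c y z) :=
        Finset.expect_le_expect fun y _ => Finset.expect_le_expect fun z _ => ha2 y z
    _ = 𝔼 x, 𝔼 y, 𝔼 z, D x y z * (a x y * b x z * c y z) := by
        simp only [Finset.mul_expect]
        exact expect_congr₃ fun _ _ _ => by ring

/-- A lower bound for indicator weights on vertices extends to `[0,1]`-valued weights. -/
theorem le_expect_vertex_weights {D : V → V → ℝ} {ε : ℝ}
    (H : ∀ u v : V → ℝ, (∀ x, u x = 0 ∨ u x = 1) → (∀ x, v x = 0 ∨ v x = 1) →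
      ε ≤ 𝔼 x, 𝔼 y, D x y * (u x * v y))
    (u v : V → ℝ) (hu : ∀ x, 0 ≤ u x ∧ u x ≤ 1) (hv : ∀ x, 0 ≤ v x ∧ v x ≤ 1) :
    ε ≤ 𝔼 x, 𝔼 y, D x y * (u x * v y) := by
  choose u' hu' hu2 using fun x => exists_indicator_mul_le (u x)
    (𝔼 y, D x y * v y) (hu x).1 (hu x).2
  choose v' hv' hv2 using fun y => exists_indicator_mul_le (v y)
    (𝔼 x, D x y * u' x) (hv y).1 (hv y).2
  refine (H u' v' hu' hv').trans ?_
  calc 𝔼 x, 𝔼 y, D x y * (u' x * v' y)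
      = 𝔼 y, v' y * 𝔼 x, D x y * u' x := by
        rw [Finset.expect_comm]; simp only [Finset.mul_expect]
        exact expect_congr₂ fun _ _ => by ring
    _ ≤ 𝔼 y, v y * 𝔼 x, D x y * u' x := Finset.expect_le_expect fun y _ => hv2 y
    _ = 𝔼 x, u' x * 𝔼 y, D x y * v y := by
        simp only [Finset.mul_expect]
        rw [Finset.expect_comm]
        exact expect_congr₂ fun _ _ => by ring
    _ ≤ 𝔼 x, u x * 𝔼 y, D x y * v y := Finset.expect_le_expect fun y _ => hu2 y
    _ = 𝔼 x, 𝔼 y, D x y * (u x * v y) := by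
        simp only [Finset.mul_expect]
        exact expect_congr₂ fun _ _ => by ring

end

/-- The expected weight of a triple whose pairs receive independent random colours. -/
noncomputable def meanWeight {κ σ : Type} [Fintype κ] (W : κ → κ → κ → ℝ) (μ : κ → σ → σ → ℝ)
    (a b c : σ) : ℝ :=
  ∑ α, ∑ β, ∑ γ, W α β γ * (μ α a b * μ β a c * μ γ b c)

theorem expect_weight_sub_meanWeight_le {V κ σ : Type} [Fintype V] [Nonempty V] [Fintype κ]
    [DecidableEq κ] (q : V → V → κ) (W : κ → κ → κ → ℝ) (hW0 : ∀ a b c, 0 ≤ W a b c)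
    (hW1 : ∀ a b c, W a b c ≤ 1) (p : V → σ) (μ : κ → σ → σ → ℝ) (hμ0 : ∀ α a b, 0 ≤ μ α a b)
    (hμ1 : ∀ α a b, μ α a b ≤ 1) {ε : ℝ}
    (H : ∀ (α : κ) (s : σ → σ → ℝ) (u v : V → ℝ), (∀ a b, |s a b| ≤ 1) →
          (∀ x, u x = 0 ∨ u x = 1) → (∀ x, v x = 0 ∨ v x = 1) →
          𝔼 x, 𝔼 y, ((if q x y = α then 1 else 0) - μ α (p x) (p y)) *
            (s (p x) (p y) * u x * v y) ≤ ε)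
    (s : σ → σ → σ → ℝ) (hs : ∀ a b c, |s a b c| ≤ 1) :
    𝔼 x, 𝔼 y, 𝔼 z, (W (q x y) (q x z) (q y z) - meanWeight W μ (p x) (p y) (p z)) *
      s (p x) (p y) (p z) ≤ Fintype.card κ ^ 3 * (3 * ε) := by
  set f : κ → V → V → ℝ := fun α x y => if q x y = α then 1 else 0 with hf
  have f01 : ∀ α x y, f α x y = 0 ∨ f α x y = 1 := fun α x y => by
    simp only [hf]; split_ifs <;> simp
  have expand : ∀ x y z, (W (q x y) (q x z) (q y z) - meanWeight W μ (p x) (p y) (p z)) *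
      s (p x) (p y) (p z) = ∑ α, ∑ β, ∑ γ,
        ((f α x y - μ α (p x) (p y)) * (s (p x) (p y) (p z) * W α β γ * f β x z * f γ y z)
        + (f β x z - μ β (p x) (p z)) *
          (s (p x) (p y) (p z) * W α β γ * μ α (p x) (p y) * 1 * f γ y z)
        + (f γ y z - μ γ (p y) (p z)) *
          (s (p x) (p y) (p z) * W α β γ * μ α (p x) (p y) * μ β (p x) (p z) * 1 * 1)) := by
    intro x y z
    have h1 : W (q x y) (q x z) (q y z)
        = ∑ α, ∑ β, ∑ γ, W α β γ * (f α x y * f β x z * f γ y z) := by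
      simp [hf, mul_ite]
    rw [h1, meanWeight]
    simp only [← Finset.sum_sub_distrib, Finset.sum_mul]
    refine Finset.sum_congr rfl fun α _ => Finset.sum_congr rfl fun β _ =>
      Finset.sum_congr rfl fun γ _ => ?_
    ring
  simp only [expand, Finset.expect_sum_comm]
  have hb : ∀ (α β γ : κ) (a b c : σ), |s a b c * W α β γ| ≤ 1 := fun α β γ a b c => by
    rw [abs_mul, abs_of_nonneg (hW0 _ _ _)]
    exact mul_le_one₀ (hs _ _ _) (hW0 _ _ _) (hW1 _ _ _)
  have hb2 : ∀ (t m : ℝ), |t| ≤ 1 → 0 ≤ m → m ≤ 1 → |t * m| ≤ 1 := fun t m ht h0 h1 => by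
    rw [abs_mul, abs_of_nonneg h0]
    exact mul_le_one₀ ht h0 h1
  have main : ∀ α β γ : κ, 𝔼 x, 𝔼 y, 𝔼 z,
      ((f α x y - μ α (p x) (p y)) * (s (p x) (p y) (p z) * W α β γ * f β x z * f γ y z)
        + (f β x z - μ β (p x) (p z)) *
          (s (p x) (p y) (p z) * W α β γ * μ α (p x) (p y) * 1 * f γ y z)
        + (f γ y z - μ γ (p y) (p z)) *
          (s (p x) (p y) (p z) * W α β γ * μ α (p x) (p y) * μ β (p x) (p z) * 1 * 1))
      ≤ 3 * ε := by
    intro α β γ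
    simp only [Finset.expect_add_distrib]
    have t1 : 𝔼 x, 𝔼 y, 𝔼 z, (f α x y - μ α (p x) (p y)) *
        (s (p x) (p y) (p z) * W α β γ * f β x z * f γ y z) ≤ ε := by
      rw [← expect_rotate (fun z x y => (f α x y - μ α (p x) (p y)) *
        (s (p x) (p y) (p z) * W α β γ * f β x z * f γ y z))]
      refine Finset.expect_le Finset.univ_nonempty fun z _ => ?_
      exact H α (fun a b => s a b (p z) * W α β γ) (fun x => f β x z) (fun y => f γ y z)
        (fun a b => hb _ _ _ _ _ _) (fun x => f01 _ _ _) (fun x => f01 _ _ _)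
    have t2 : 𝔼 x, 𝔼 y, 𝔼 z, (f β x z - μ β (p x) (p z)) *
          (s (p x) (p y) (p z) * W α β γ * μ α (p x) (p y) * 1 * f γ y z) ≤ ε := by
      rw [Finset.expect_comm]
      refine Finset.expect_le Finset.univ_nonempty fun y _ => ?_
      exact H β (fun a c => s a (p y) c * W α β γ * μ α a (p y)) (fun x => 1) (fun z => f γ y z)
        (fun a b => hb2 _ _ (hb _ _ _ _ _ _) (hμ0 _ _ _) (hμ1 _ _ _))
        (fun x => Or.inr rfl) (fun x => f01 _ _ _)
    have t3 : 𝔼 x, 𝔼 y, 𝔼 z, (f γ y z - μ γ (p y) (p z)) *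
          (s (p x) (p y) (p z) * W α β γ * μ α (p x) (p y) * μ β (p x) (p z) * 1 * 1) ≤ ε := by
      refine Finset.expect_le Finset.univ_nonempty fun x _ => ?_
      exact H γ (fun b c => s (p x) b c * W α β γ * μ α (p x) b * μ β (p x) c) (fun x => 1)
        (fun z => 1)
        (fun a b => hb2 _ _ (hb2 _ _ (hb _ _ _ _ _ _) (hμ0 _ _ _) (hμ1 _ _ _))
          (hμ0 _ _ _) (hμ1 _ _ _))
        (fun x => Or.inr rfl) (fun x => Or.inr rfl)
    linarith
  calc _ ≤ ∑ α : κ, ∑ β : κ, ∑ γ : κ, 3 * ε :=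
        Finset.sum_le_sum fun α _ => Finset.sum_le_sum fun β _ => Finset.sum_le_sum fun γ _ =>
          main α β γ
    _ = _ := by simp; ring

/-- The combined regularity statement: a pair colouring `q` approximating `h`, and a vertex
partition `p` whose colour densities `μ` approximate `q`. -/
theorem exists_regular_structure {ε : ℝ} (hε : 0 < ε) (δ : ℕ → ℝ) (hδ : ∀ r, 0 < δ r) :
    ∃ S : ℕ, ∀ (V : Type) [Fintype V] [Nonempty V] (h : V → V → V → ℝ),
      (∀ x y z, 0 ≤ h x y z) → (∀ x y z, h x y z ≤ 1) →
      ∃ (κ : Type) (_ : Fintype κ) (_ : DecidableEq κ) (q : V → V → κ) (W : κ → κ → κ → ℝ)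
        (σ : Type) (_ : Fintype σ) (p : V → σ) (μ : κ → σ → σ → ℝ),
        Fintype.card σ ≤ S ∧ (∀ a b c, 0 ≤ W a b c) ∧ (∀ a b c, W a b c ≤ 1) ∧
        (∀ α a b, 0 ≤ μ α a b) ∧ (∀ α a b, μ α a b ≤ 1) ∧
        (∀ x y, ∑ α, μ α (p x) (p y) = 1) ∧
        (∀ a b c : V → V → ℝ, (∀ x y, 0 ≤ a x y ∧ a x y ≤ 1) → (∀ x y, 0 ≤ b x y ∧ b x y ≤ 1) →
          (∀ x y, 0 ≤ c x y ∧ c x y ≤ 1) →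
          -ε ≤ 𝔼 x, 𝔼 y, 𝔼 z, (h x y z - W (q x y) (q x z) (q y z)) *
            (a x y * b x z * c y z)) ∧
        (∀ (α : κ) (u v : V → ℝ), (∀ x, 0 ≤ u x ∧ u x ≤ 1) → (∀ x, 0 ≤ v x ∧ v x ≤ 1) →
          -δ (Fintype.card κ) ≤
            𝔼 x, 𝔼 y, ((if q x y = α then 1 else 0) - μ α (p x) (p y)) * (u x * v y)) ∧
        (∀ s : σ → σ → σ → ℝ, (∀ a b c, |s a b c| ≤ 1) →
          𝔼 x, 𝔼 y, 𝔼 z, (h x y z - meanWeight W μ (p x) (p y) (p z)) * s (p x) (p y) (p z)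
            ≤ ε) := by
  classical
  let δ' : ℕ → ℝ := fun r => min (δ r) (ε / (6 * (r + 1) ^ 3))
  have hδ' : ∀ r, 0 < δ' r := fun r => lt_min (hδ r) (by positivity)
  choose S hS using fun r => exists_vertex_partition r (hδ' r)
  obtain ⟨B, hB⟩ := exists_pair_colouring (fun r => max 8 (S r * S r)) (ε := ε / 2) (by positivity)
  refine ⟨∑ r ∈ Finset.range (B + 1), S r, fun V _ _ h h0 h1 => ?_⟩
  obtain ⟨κ, iκ, q, W, hκ, hW0, hW1, hq⟩ := hB V h h0 h1
  obtain ⟨σ, iσ, p, μ, hσ, hμ0, hμ1, hμs, hp⟩ := hS (Nat.card κ) V κ q le_rfl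
  refine ⟨κ, iκ, inferInstance, q, W, σ, iσ, p, μ, ?_, hW0, hW1, hμ0, hμ1, hμs, ?_, ?_, ?_⟩
  · rw [← Nat.card_eq_fintype_card]
    exact hσ.trans (Finset.single_le_sum (f := S) (fun _ _ => Nat.zero_le _)
      (Finset.mem_range.2 (Nat.lt_succ_of_le hκ)))
  · refine le_expect_pair_weights fun a b c ha hb hc => ?_
    have := hq (Prop × Prop × Prop) (by simp [Nat.card_eq_fintype_card])
      (fun x y => (a x y = 1, b x y = 1, c x y = 1))
      (fun k l m => - ((if k.1 then 1 else 0) * (if l.2.1 then 1 else 0)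
        * (if m.2.2 then 1 else 0))) (fun k l m => by split_ifs <;> simp)
    have h2 : ∀ x y z, a x y * b x z * c y z = ((if a x y = 1 then 1 else 0) *
        (if b x z = 1 then 1 else 0) * (if c y z = 1 then 1 else 0) : ℝ) := fun x y z => by
      rcases ha x y with h | h <;> rcases hb x z with h' | h' <;> rcases hc y z with h'' | h'' <;>
        simp [h, h', h'']
    simp only [h2]
    simp only [mul_neg, Finset.expect_neg_distrib] at this
    linarith
  · intro α
    refine le_expect_vertex_weights fun u v hu hv => ?_
    have := hp α (fun _ _ => -1) u v (by simp) hu hv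
    have h2 := min_le_left (δ (Nat.card κ)) (ε / (6 * ((Nat.card κ : ℕ) + 1) ^ 3))
    rw [← Nat.card_eq_fintype_card]
    simp only [neg_mul, one_mul, mul_neg, Finset.expect_neg_distrib] at this
    simp only [δ'] at this
    linarith
  · intro s hs
    have h1 := hq (σ × σ) (by
      rw [Nat.card_prod]
      exact (Nat.mul_le_mul hσ hσ).trans (le_max_right _ _)) (fun x y => (p x, p y))
      (fun k l _ => s k.1 k.2 l.2) (fun k l m => hs _ _ _)
    have h2 := expect_weight_sub_meanWeight_le q W hW0 hW1 p μ hμ0 hμ1 hp s hs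
    have h3 : (Fintype.card κ : ℝ) ^ 3 * (3 * δ' (Nat.card κ)) ≤ ε / 2 := by
      have := min_le_right (δ (Nat.card κ)) (ε / (6 * ((Nat.card κ : ℕ) + 1) ^ 3))
      rw [Nat.card_eq_fintype_card] at this ⊢
      calc (Fintype.card κ : ℝ) ^ 3 * (3 * δ' (Fintype.card κ))
          ≤ (Fintype.card κ + 1 : ℝ) ^ 3 * (3 * (ε / (6 * ((Fintype.card κ : ℕ) + 1) ^ 3))) := by
            gcongr
            · have := hδ' (Fintype.card κ)
              positivity
            · linarith
        _ = ε / 2 := by field_simp; ring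
    calc _ = 𝔼 x, 𝔼 y, 𝔼 z, ((h x y z - W (q x y) (q x z) (q y z)) * s (p x) (p y) (p z)
          + (W (q x y) (q x z) (q y z) - meanWeight W μ (p x) (p y) (p z))
            * s (p x) (p y) (p z)) := expect_congr₃ fun _ _ _ => by ring
      _ ≤ ε := by
        simp only [Finset.expect_add_distrib]
        linarith

/-- A lower bound for a multi-affine function at the vertices of a cube holds on the cube. -/
theorem le_of_multiaffine {V : Type*} [Fintype V] [DecidableEq V] (G : (V → ℝ) → ℝ) (c : ℝ)
    (haff : ∀ ω a, G ω = (1 - ω a) * G (Function.update ω a 0)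
      + ω a * G (Function.update ω a 1))
    (hG : ∀ ω : V → ℝ, (∀ v, ω v = 0 ∨ ω v = 1) → c ≤ G ω)
    (ω : V → ℝ) (h0 : ∀ v, 0 ≤ ω v) (h1 : ∀ v, ω v ≤ 1) : c ≤ G ω := by
  have key : ∀ A : Finset V, ∀ ω : V → ℝ, (∀ v, 0 ≤ ω v) → (∀ v, ω v ≤ 1) →
      (∀ v, v ∉ A → ω v = 0 ∨ ω v = 1) → c ≤ G ω := by
    intro A
    induction A using Finset.induction_on with
    | empty => exact fun ω _ _ h => hG ω fun v => h v (Finset.notMem_empty v)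
    | insert a A _ ih =>
      intro ω h0 h1 h
      have step : ∀ t : ℝ, (t = 0 ∨ t = 1) → c ≤ G (Function.update ω a t) := by
        intro t ht
        refine ih _ (fun v => ?_) (fun v => ?_) (fun v hv => ?_)
        all_goals rcases eq_or_ne v a with rfl | hva
        · rw [Function.update_self]; rcases ht with rfl | rfl <;> norm_num
        · rw [Function.update_of_ne hva]; exact h0 v
        · rw [Function.update_self]; rcases ht with rfl | rfl <;> norm_num
        · rw [Function.update_of_ne hva]; exact h1 v
        · rw [Function.update_self]; exact ht
        · rw [Function.update_of_ne hva]; exact h v (by simp [hva, hv])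
      rw [haff ω a]
      have e0 := step 0 (Or.inl rfl)
      have e1 := step 1 (Or.inr rfl)
      have := h0 a
      have := h1 a
      nlinarith
  exact key Finset.univ ω h0 h1 fun v hv => absurd (Finset.mem_univ v) hv

theorem weighted_dense {V : Type} [Fintype V] [DecidableEq V] (H : H3 V) {d η : ℝ}
    (hH : H.uniformlyDense d η) (ω : V → ℝ) (h0 : ∀ v, 0 ≤ ω v) (h1 : ∀ v, ω v ≤ 1) :
    -(η * (Fintype.card V : ℝ) ^ 3) ≤ ∑ e ∈ Finset.powersetCard 3 Finset.univ,
      ((if e ∈ H.edges then 1 else 0) - d) * ∏ v ∈ e, ω v := by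
  classical
  refine le_of_multiaffine (fun ω => ∑ e ∈ Finset.powersetCard 3 Finset.univ,
      ((if e ∈ H.edges then (1 : ℝ) else 0) - d) * ∏ v ∈ e, ω v) _ (fun ω a => ?_)
    (fun ω hω => ?_) ω h0 h1
  · simp only [Finset.mul_sum, ← Finset.sum_add_distrib]
    refine Finset.sum_congr rfl fun e _ => ?_
    by_cases ha : a ∈ e
    · rw [Finset.prod_update_of_mem ha, Finset.prod_update_of_mem ha,
        ← Finset.mul_prod_erase e ω ha, Finset.sdiff_singleton_eq_erase]
      ring
    · rw [Finset.prod_update_of_notMem ha, Finset.prod_update_of_notMem ha]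
      ring
  · let U := Finset.univ.filter fun v => ω v = 1
    have hp : ∀ e : Finset V, ∏ v ∈ e, ω v = if e ⊆ U then 1 else 0 := by
      intro e
      split_ifs with h
      · exact Finset.prod_eq_one fun v hv => (Finset.mem_filter.1 (h hv)).2
      · obtain ⟨v, hv, hvU⟩ := Finset.not_subset.1 h
        refine Finset.prod_eq_zero hv ((hω v).resolve_right fun h => hvU ?_)
        simp [U, h]
    have hU := hH U
    have h2 : ∑ e ∈ Finset.powersetCard 3 Finset.univ,
        ((if e ∈ H.edges then (1 : ℝ) else 0) - d) * ∏ v ∈ e, ω v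
        = ((H.edges.filter fun e => e ⊆ U).card : ℝ) - d * (U.card.choose 3 : ℝ) := by
      simp only [hp, mul_ite, mul_one, mul_zero]
      rw [← Finset.sum_filter]
      have h3 : (Finset.powersetCard 3 (Finset.univ : Finset V)).filter (fun e => e ⊆ U)
          = Finset.powersetCard 3 U := by
        ext e
        simp [Finset.mem_powersetCard, and_comm]
      rw [h3, Finset.sum_sub_distrib, Finset.sum_const, Finset.card_powersetCard, nsmul_eq_mul,
        mul_comm d, ← Finset.sum_filter, Finset.sum_const, nsmul_eq_mul, mul_one]
      congr 3
      ext e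
      simp only [Finset.mem_filter, Finset.mem_powersetCard]
      exact ⟨fun h => ⟨h.2, h.1.1⟩, fun h => ⟨⟨h.2, H.card3 e h.1⟩, h.1⟩⟩
    rw [h2]
    linarith

/-- Summing over ordered triples of distinct points counts every 3-set six times. -/
theorem sum_triples_eq {V : Type*} [Fintype V] [DecidableEq V] (φ : Finset V → ℝ) :
    ∑ t : V × V × V with (t.1 ≠ t.2.1 ∧ t.1 ≠ t.2.2 ∧ t.2.1 ≠ t.2.2), φ {t.1, t.2.1, t.2.2}
      = 6 * ∑ e ∈ Finset.powersetCard 3 Finset.univ, φ e := by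
  rw [← Finset.sum_fiberwise_of_maps_to (t := Finset.powersetCard 3 (Finset.univ : Finset V))
    (g := fun t : V × V × V => {t.1, t.2.1, t.2.2}), Finset.mul_sum]
  · refine Finset.sum_congr rfl fun e he => ?_
    obtain ⟨a, b, c, hab, hac, hbc, rfl⟩ := Finset.card_eq_three.1 (Finset.mem_powersetCard.1 he).2
    rw [Finset.sum_congr rfl (g := fun _ => φ {a, b, c})
      fun t ht => by rw [(Finset.mem_filter.1 ht).2], Finset.sum_const, nsmul_eq_mul]
    congr 1
    have : (Finset.univ.filter (fun t : V × V × V =>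
        t.1 ≠ t.2.1 ∧ t.1 ≠ t.2.2 ∧ t.2.1 ≠ t.2.2)).filter
          (fun t => ({t.1, t.2.1, t.2.2} : Finset V) = {a, b, c})
        = {(a, b, c), (a, c, b), (b, a, c), (b, c, a), (c, a, b), (c, b, a)} := by
      ext ⟨x, y, z⟩
      simp only [Finset.mem_filter, Finset.mem_univ, true_and, Finset.mem_insert,
        Finset.mem_singleton, Prod.mk.injEq]
      constructor
      · rintro ⟨⟨h1, h2, h3⟩, h⟩
        have hx : x ∈ ({a, b, c} : Finset V) := h ▸ by simp
        have hy : y ∈ ({a, b, c} : Finset V) := h ▸ by simp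
        have hz : z ∈ ({a, b, c} : Finset V) := h ▸ by simp
        simp only [Finset.mem_insert, Finset.mem_singleton] at hx hy hz
        grind
      · rintro (⟨rfl, rfl, rfl⟩ | ⟨rfl, rfl, rfl⟩ | ⟨rfl, rfl, rfl⟩ | ⟨rfl, rfl, rfl⟩ |
          ⟨rfl, rfl, rfl⟩ | ⟨rfl, rfl, rfl⟩)
        all_goals refine ⟨⟨?_, ?_, ?_⟩, ?_⟩
        all_goals first
          | assumption | (symm; assumption) | (ext v; simp; done) | (ext v; simp; tauto)
    rw [this]
    have hc : ({(a, b, c), (a, c, b), (b, a, c), (b, c, a), (c, a, b), (c, b, a)}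
        : Finset (V × V × V)).card = 6 := by
      rw [Finset.card_insert_of_notMem, Finset.card_insert_of_notMem,
        Finset.card_insert_of_notMem, Finset.card_insert_of_notMem,
        Finset.card_insert_of_notMem, Finset.card_singleton]
      all_goals
        simp only [Finset.mem_insert, Finset.mem_singleton, Prod.mk.injEq]
        grind
    rw [hc]; norm_num
  · rintro ⟨x, y, z⟩ h
    simp only [Finset.mem_filter, Finset.mem_univ, true_and] at h
    simp only [Finset.mem_powersetCard, Finset.subset_univ, true_and]
    exact Finset.card_eq_three.2 ⟨x, y, z, h.1, h.2.1, h.2.2, rfl⟩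

/-- The indicator of the edges of `H`, on ordered triples. -/
noncomputable def edgeInd {V : Type} [DecidableEq V] (H : H3 V) (x y z : V) : ℝ :=
  if {x, y, z} ∈ H.edges then 1 else 0

section edgeInd
variable {V : Type} [DecidableEq V] (H : H3 V)

theorem edgeInd_nonneg (x y z : V) : 0 ≤ edgeInd H x y z := by
  unfold edgeInd; split_ifs <;> norm_num

theorem edgeInd_le_one (x y z : V) : edgeInd H x y z ≤ 1 := by
  unfold edgeInd; split_ifs <;> norm_num

theorem edgeInd_swap_left (x y z : V) : edgeInd H x y z = edgeInd H y x z := by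
  unfold edgeInd; rw [Finset.insert_comm]

theorem edgeInd_swap_right (x y z : V) : edgeInd H x y z = edgeInd H x z y := by
  unfold edgeInd; rw [Finset.pair_comm]

theorem edgeInd_eq_zero {x y z : V} (h : ¬ (x ≠ y ∧ x ≠ z ∧ y ≠ z)) : edgeInd H x y z = 0 := by
  unfold edgeInd
  rw [if_neg]
  intro he
  have h3 := H.card3 _ he
  refine h ⟨fun e => ?_, fun e => ?_, fun e => ?_⟩
  · rw [e, Finset.insert_eq_of_mem (by simp)] at h3
    exact absurd h3 (Finset.card_le_two.trans_lt (by norm_num)).ne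
  · rw [e, Finset.insert_eq_of_mem (by simp)] at h3
    exact absurd h3 (Finset.card_le_two.trans_lt (by norm_num)).ne
  · rw [e, Finset.pair_eq_singleton] at h3
    exact absurd h3 (Finset.card_le_two.trans_lt (by norm_num)).ne

variable [Fintype V]

theorem weighted_dense_triples {d η : ℝ} (hd : 0 ≤ d) (hH : H.uniformlyDense d η)
    (ω : V → ℝ) (h0 : ∀ v, 0 ≤ ω v) (h1 : ∀ v, ω v ≤ 1) :
    d * ((∑ v, ω v) ^ 3 - 3 * (∑ v, ω v) ^ 2) - 6 * η * (Fintype.card V : ℝ) ^ 3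
      ≤ ∑ x, ∑ y, ∑ z, edgeInd H x y z * (ω x * ω y * ω z) := by
  have h := weighted_dense H hH ω h0 h1
  have h6 := sum_triples_eq (V := V)
    (fun e => ((if e ∈ H.edges then (1 : ℝ) else 0) - d) * ∏ v ∈ e, ω v)
  set s := ∑ v, ω v with hs
  have hsum : ∀ F : V → V → V → ℝ, ∑ x, ∑ y, ∑ z, F x y z
      = ∑ t : V × V × V, F t.1 t.2.1 t.2.2 := fun F => by
    simp only [Fintype.sum_prod_type]
  have e1 : ∑ t : V × V × V with (t.1 ≠ t.2.1 ∧ t.1 ≠ t.2.2 ∧ t.2.1 ≠ t.2.2),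
      ((if ({t.1, t.2.1, t.2.2} : Finset V) ∈ H.edges then (1 : ℝ) else 0) - d)
        * ∏ v ∈ {t.1, t.2.1, t.2.2}, ω v
      = ∑ x, ∑ y, ∑ z, edgeInd H x y z * (ω x * ω y * ω z)
        - d * ∑ t : V × V × V with (t.1 ≠ t.2.1 ∧ t.1 ≠ t.2.2 ∧ t.2.1 ≠ t.2.2),
          ω t.1 * ω t.2.1 * ω t.2.2 := by
    rw [hsum, ← Finset.sum_filter_add_sum_filter_not Finset.univ
      (fun t : V × V × V => t.1 ≠ t.2.1 ∧ t.1 ≠ t.2.2 ∧ t.2.1 ≠ t.2.2)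
      (fun t => edgeInd H t.1 t.2.1 t.2.2 * (ω t.1 * ω t.2.1 * ω t.2.2))]
    rw [Finset.sum_eq_zero (s := Finset.univ.filter (fun t : V × V × V =>
      ¬ (t.1 ≠ t.2.1 ∧ t.1 ≠ t.2.2 ∧ t.2.1 ≠ t.2.2)))
      fun t ht => by rw [edgeInd_eq_zero H (Finset.mem_filter.1 ht).2, zero_mul], add_zero,
      Finset.mul_sum, ← Finset.sum_sub_distrib]
    refine Finset.sum_congr rfl fun t ht => ?_
    have ht' := (Finset.mem_filter.1 ht).2
    rw [Finset.prod_insert (by simp [ht'.1, ht'.2.1]), Finset.prod_pair ht'.2.2, edgeInd]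
    ring
  have e2 : s ^ 3 - 3 * s ^ 2 ≤ ∑ t : V × V × V with
      (t.1 ≠ t.2.1 ∧ t.1 ≠ t.2.2 ∧ t.2.1 ≠ t.2.2), ω t.1 * ω t.2.1 * ω t.2.2 := by
    have hsq : ∑ x, ω x * ω x ≤ s := Finset.sum_le_sum fun v _ =>
      mul_le_of_le_one_right (h0 v) (h1 v)
    have hs0 : 0 ≤ s := Finset.sum_nonneg fun v _ => h0 v
    have c1 : ∀ x y z, ω x * ω y * ω z - (if x = y then ω x * ω x * ω z else 0)
        - (if x = z then ω x * ω y * ω x else 0) - (if y = z then ω x * (ω y * ω y) else 0)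
        ≤ if (x ≠ y ∧ x ≠ z ∧ y ≠ z) then ω x * ω y * ω z else 0 := by
      intro x y z
      have hx := h0 x
      have hy := h0 y
      have hz := h0 z
      have p1 : 0 ≤ ω x * ω x * ω z := by positivity
      have p2 : 0 ≤ ω x * ω y * ω x := by positivity
      have p3 : 0 ≤ ω x * (ω y * ω y) := by positivity
      by_cases a1 : x = y
      · subst a1
        simp only [ne_eq, not_true_eq_false, false_and, if_false, if_true]
        split_ifs <;> linarith
      · by_cases a2 : x = z
        · subst a2
          simp only [ne_eq, not_true_eq_false, false_and, and_false, if_false, if_true, a1]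
          split_ifs <;> linarith
        · by_cases a3 : y = z
          · subst a3
            simp only [ne_eq, not_true_eq_false, and_false, if_false, if_true, a1]
            linarith
          · simp [a1, a2, a3]
    rw [Finset.sum_filter, ← hsum (fun x y z => if (x ≠ y ∧ x ≠ z ∧ y ≠ z) then
      ω x * ω y * ω z else 0)]
    refine le_trans ?_ (Finset.sum_le_sum fun x _ => Finset.sum_le_sum fun y _ =>
      Finset.sum_le_sum fun z _ => c1 x y z)
    simp only [Finset.sum_sub_distrib]
    have d0 : ∑ x, ∑ y, ∑ z, ω x * ω y * ω z = s ^ 3 := by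
      simp only [← Finset.mul_sum, ← Finset.sum_mul, ← hs]; ring
    have d1 : ∑ x, ∑ y, ∑ z, (if x = y then ω x * ω x * ω z else 0) = (∑ x, ω x * ω x) * s := by
      rw [Finset.sum_mul]
      refine Finset.sum_congr rfl fun x _ => ?_
      rw [Finset.sum_eq_single x]
      · simp [Finset.mul_sum, hs]
      · intro b _ hb; simp [hb.symm]
      · simp
    have d2 : ∑ x, ∑ y, ∑ z, (if x = z then ω x * ω y * ω x else 0) = (∑ x, ω x * ω x) * s := by
      simp only [Finset.sum_ite_eq, Finset.mem_univ, if_true]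
      rw [Finset.sum_mul]
      refine Finset.sum_congr rfl fun x _ => ?_
      rw [hs, Finset.mul_sum]
      exact Finset.sum_congr rfl fun y _ => by ring
    have d3 : ∑ x, ∑ y, ∑ z, (if y = z then ω x * (ω y * ω y) else 0)
        = (∑ x, ω x * ω x) * s := by
      simp only [Finset.sum_ite_eq, Finset.mem_univ, if_true, ← Finset.mul_sum, ← Finset.sum_mul]
      rw [hs]; ring
    rw [d0, d1, d2, d3]
    nlinarith
  have e3 := mul_le_mul_of_nonneg_left e2 hd
  rw [e1] at h6
  linarith

end edgeInd

theorem sum_not_distinct_le {ι : Type} [DecidableEq ι] (S : Finset ι) :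
    ∑ i ∈ S, ∑ j ∈ S, ∑ k ∈ S, (if i ≠ j ∧ i ≠ k ∧ j ≠ k then (0 : ℝ) else 1)
      ≤ 3 * (S.card : ℝ) ^ 2 := by
  have h1 : ∀ i j k : ι, (if i ≠ j ∧ i ≠ k ∧ j ≠ k then (0 : ℝ) else 1)
      ≤ (if i = j then 1 else 0) + (if i = k then 1 else 0) + (if j = k then 1 else 0) := by
    intro i j k
    by_cases h1 : i = j <;> by_cases h2 : i = k <;> by_cases h3 : j = k <;> simp_all
  refine (Finset.sum_le_sum fun i _ => Finset.sum_le_sum fun j _ => Finset.sum_le_sum fun k _ =>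
    h1 i j k).trans (le_of_eq ?_)
  have e : ∀ i ∈ S, ∑ j ∈ S, (if i = j then (1 : ℝ) else 0) = 1 := fun i hi => by simp [hi]
  have e1 : ∑ i ∈ S, ∑ j ∈ S, ∑ k ∈ S, (if i = j then (1 : ℝ) else 0) = S.card ^ 2 := by
    simp only [Finset.sum_const, nsmul_eq_mul, ← Finset.mul_sum]
    rw [Finset.sum_congr rfl e]; simp [sq]
  have e2 : ∑ i ∈ S, ∑ j ∈ S, ∑ k ∈ S, (if i = k then (1 : ℝ) else 0) = S.card ^ 2 := by
    simp only [Finset.sum_const, nsmul_eq_mul, ← Finset.mul_sum]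
    rw [Finset.sum_congr rfl e]; simp [sq]
  have e3 : ∑ i ∈ S, ∑ j ∈ S, ∑ k ∈ S, (if j = k then (1 : ℝ) else 0) = S.card ^ 2 := by
    simp only [Finset.sum_const, nsmul_eq_mul]
    rw [Finset.sum_congr rfl e]; simp [sq]
  simp only [Finset.sum_add_distrib]
  rw [e1, e2, e3]; ring

section VertexStep

variable {V σ : Type} [Fintype V]

/-- The average of `h` over the product of three atoms of the vertex partition `p`. -/
noncomputable def atomAvg (p : V → σ) (h : V → V → V → ℝ) (a b c : σ) : ℝ :=
  fibreAvg (fun ω : V × V × V => (p ω.1, p ω.2.1, p ω.2.2)) (fun ω => h ω.1 ω.2.1 ω.2.2) (a, b, c)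

variable [DecidableEq σ]

/-- The number of vertices in the atom `a` of `p`. -/
def atomSize (p : V → σ) (a : σ) : ℕ := (Finset.univ.filter fun v => p v = a).card

theorem atomSize_mul_atomAvg (p : V → σ) (h : V → V → V → ℝ) (a b c : σ) :
    (atomSize p a * atomSize p b * atomSize p c : ℝ) * atomAvg p h a b c
      = ∑ x, ∑ y, ∑ z, h x y z * ((if p x = a then 1 else 0) * (if p y = b then 1 else 0)
        * (if p z = c then 1 else 0)) := by
  have h1 := card_fibre_mul_fibreAvg (fun ω : V × V × V => (p ω.1, p ω.2.1, p ω.2.2))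
    (fun ω => h ω.1 ω.2.1 ω.2.2) (a, b, c)
  have h2 : (Finset.univ.filter fun ω : V × V × V => (p ω.1, p ω.2.1, p ω.2.2) = (a, b, c))
      = (Finset.univ.filter fun v => p v = a) ×ˢ (Finset.univ.filter fun v => p v = b) ×ˢ
        (Finset.univ.filter fun v => p v = c) := by
    ext ⟨x, y, z⟩
    simp
  have h3 : ((Finset.univ.filter fun ω : V × V × V =>
      (p ω.1, p ω.2.1, p ω.2.2) = (a, b, c)).card : ℝ)
      = atomSize p a * atomSize p b * atomSize p c := by
    rw [h2, Finset.card_product, Finset.card_product]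
    simp [atomSize, mul_assoc]
  rw [← h3, atomAvg]
  convert h1 using 1
  · congr!
  · rw [Finset.sum_filter]
    simp only [Fintype.sum_prod_type]
    refine Finset.sum_congr rfl fun x _ => Finset.sum_congr rfl fun y _ =>
      Finset.sum_congr rfl fun z _ => ?_
    by_cases ha : p x = a <;> by_cases hb : p y = b <;> by_cases hc : p z = c <;>
      simp [ha, hb, hc]

theorem atomAvg_swap_left (p : V → σ) {h : V → V → V → ℝ} (hs : ∀ x y z, h x y z = h y x z)
    (x y z : V) : atomAvg p h (p x) (p y) (p z) = atomAvg p h (p y) (p x) (p z) := by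
  have pos : ∀ v, (0 : ℝ) < atomSize p (p v) := fun v => by
    exact_mod_cast Finset.card_pos.2 ⟨v, by simp⟩
  have h1 := atomSize_mul_atomAvg p h (p x) (p y) (p z)
  have h2 := atomSize_mul_atomAvg p h (p y) (p x) (p z)
  rw [Finset.sum_comm] at h2
  have : (atomSize p (p x) * atomSize p (p y) * atomSize p (p z) : ℝ) ≠ 0 := by
    have := pos x; have := pos y; have := pos z
    positivity
  apply mul_left_cancel₀ this
  rw [h1, mul_comm (atomSize p (p x) : ℝ), h2]
  refine Finset.sum_congr rfl fun x _ => Finset.sum_congr rfl fun y _ =>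
      Finset.sum_congr rfl fun z _ => ?_
  rw [hs x y z]; ring

theorem atomAvg_swap_right (p : V → σ) {h : V → V → V → ℝ} (hs : ∀ x y z, h x y z = h x z y)
    (x y z : V) : atomAvg p h (p x) (p y) (p z) = atomAvg p h (p x) (p z) (p y) := by
  have pos : ∀ v, (0 : ℝ) < atomSize p (p v) := fun v => by
    exact_mod_cast Finset.card_pos.2 ⟨v, by simp⟩
  have h1 := atomSize_mul_atomAvg p h (p x) (p y) (p z)
  have h2 := atomSize_mul_atomAvg p h (p x) (p z) (p y)
  have : (atomSize p (p x) * atomSize p (p y) * atomSize p (p z) : ℝ) ≠ 0 := by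
    have := pos x; have := pos y; have := pos z
    positivity
  apply mul_left_cancel₀ this
  rw [h1, mul_right_comm (atomSize p (p x) : ℝ), h2]
  refine Finset.sum_congr rfl fun x _ => ?_
  rw [Finset.sum_comm]
  refine Finset.sum_congr rfl fun y _ => Finset.sum_congr rfl fun z _ => ?_
  rw [hs x y z]; ring

theorem exists_dense_atom_triple [DecidableEq V] {ι : Type} [DecidableEq ι] (H : H3 V)
    {d η τ : ℝ} (hd : 0 < d)
    (hH : H.uniformlyDense d η) (hn : 48 ≤ τ * Fintype.card V) (hη : 96 * η ≤ d * τ ^ 3)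
    (p : V → σ) (x : ι → V) (S : Finset ι) (hS : 12 ≤ d * S.card)
    (hx : ∀ l ∈ S, τ * Fintype.card V ≤ atomSize p (p (x l))) :
    ∃ i ∈ S, ∃ j ∈ S, ∃ k ∈ S, i ≠ j ∧ i ≠ k ∧ j ≠ k ∧
      d / 2 ≤ atomAvg p (edgeInd H) (p (x i)) (p (x j)) (p (x k)) := by
  by_contra! hcon
  set n : ℝ := (Fintype.card V : ℝ) with hn'
  set t := τ * n with ht
  set L : ℝ := (S.card : ℝ) with hL
  have hL0 : 0 < L := by
    by_contra h
    nlinarith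
  have ht0 : 0 < t := by linarith
  set N : ι → ℝ := fun l => atomSize p (p (x l)) with hN
  have hN0 : ∀ l, 0 < N l := fun l => by
    simp only [hN]; exact_mod_cast Finset.card_pos.2 ⟨x l, by simp⟩
  let I : ι → V → ℝ := fun l v => if p v = p (x l) then 1 else 0
  have hI : ∀ l, ∑ v, I l v = N l := fun l => by simp [I, hN, atomSize]
  let ω : V → ℝ := fun v => ∑ l ∈ S, t / (L * N l) * I l v
  have hterm : ∀ l v, 0 ≤ t / (L * N l) * I l v := fun l v => by
    have := hN0 l
    simp only [I]
    split_ifs <;> positivity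
  have ω0 : ∀ v, 0 ≤ ω v := fun v => Finset.sum_nonneg fun l _ => hterm l v
  have ω1 : ∀ v, ω v ≤ 1 := fun v => by
    calc ω v ≤ ∑ l ∈ S, 1 / L := by
          refine Finset.sum_le_sum fun l hl => ?_
          have h1 := hN0 l
          have h2 : t ≤ N l := hx l hl
          have h3 : t / (L * N l) ≤ 1 / L := by
            rw [div_le_div_iff₀ (by positivity) hL0]
            nlinarith
          simp only [I]
          split_ifs
          · linarith
          · rw [mul_zero]; positivity
      _ = 1 := by rw [Finset.sum_const, nsmul_eq_mul, ← hL]; field_simp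
  have ωs : ∑ v, ω v = t := by
    simp only [ω]
    rw [Finset.sum_comm]
    simp only [← Finset.mul_sum, hI]
    rw [Finset.sum_congr rfl (g := fun _ => t / L) fun l _ => by have := hN0 l; field_simp]
    rw [Finset.sum_const, nsmul_eq_mul, ← hL]; field_simp
  have main := weighted_dense_triples H hd.le hH ω ω0 ω1
  rw [ωs] at main
  have expand : ∑ a, ∑ b, ∑ c, edgeInd H a b c * (ω a * ω b * ω c)
      = (t / L) ^ 3 * ∑ i ∈ S, ∑ j ∈ S, ∑ k ∈ S,
        atomAvg p (edgeInd H) (p (x i)) (p (x j)) (p (x k)) := by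
    have e1 : ∀ i j k, (t / L) ^ 3 * atomAvg p (edgeInd H) (p (x i)) (p (x j)) (p (x k))
        = ∑ w : V × V × V, edgeInd H w.1 w.2.1 w.2.2 * ((t / (L * N i) * I i w.1)
          * (t / (L * N j) * I j w.2.1) * (t / (L * N k) * I k w.2.2)) := by
      intro i j k
      have h := atomSize_mul_atomAvg p (edgeInd H) (p (x i)) (p (x j)) (p (x k))
      have := hN0 i; have := hN0 j; have := hN0 k
      calc _ = (t / (L * N i)) * (t / (L * N j)) * (t / (L * N k)) *
            (N i * N j * N k * atomAvg p (edgeInd H) (p (x i)) (p (x j)) (p (x k))) := by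
            field_simp
        _ = _ := by
            simp only [hN] at h ⊢
            rw [h]
            simp only [Fintype.sum_prod_type, Finset.mul_sum, I]
            refine Finset.sum_congr rfl fun x _ => Finset.sum_congr rfl fun y _ =>
              Finset.sum_congr rfl fun z _ => ?_
            ring
    have e2 : ∀ w : V × V × V, edgeInd H w.1 w.2.1 w.2.2 * (ω w.1 * ω w.2.1 * ω w.2.2)
        = ∑ l ∈ S ×ˢ S ×ˢ S, edgeInd H w.1 w.2.1 w.2.2 * ((t / (L * N l.1) * I l.1 w.1)
          * (t / (L * N l.2.1) * I l.2.1 w.2.1) * (t / (L * N l.2.2) * I l.2.2 w.2.2)) := by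
      intro w
      rw [← Finset.mul_sum]
      congr 1
      simp only [ω, Finset.sum_product, ← Finset.sum_mul, ← Finset.mul_sum]
    have e3 : ∑ a, ∑ b, ∑ c, edgeInd H a b c * (ω a * ω b * ω c)
        = ∑ w : V × V × V, edgeInd H w.1 w.2.1 w.2.2 * (ω w.1 * ω w.2.1 * ω w.2.2) := by
      simp only [Fintype.sum_prod_type]
    rw [e3, Finset.sum_congr rfl fun w _ => e2 w, Finset.sum_comm]
    simp only [Finset.mul_sum, e1, Finset.sum_product]
  rw [expand] at main
  have upper : ∑ i ∈ S, ∑ j ∈ S, ∑ k ∈ S,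
      atomAvg p (edgeInd H) (p (x i)) (p (x j)) (p (x k)) ≤ L ^ 3 * (d / 2) + 3 * L ^ 2 := by
    calc _ ≤ ∑ i ∈ S, ∑ j ∈ S, ∑ k ∈ S,
          (d / 2 + if i ≠ j ∧ i ≠ k ∧ j ≠ k then (0 : ℝ) else 1) := by
          refine Finset.sum_le_sum fun i hi => Finset.sum_le_sum fun j hj =>
            Finset.sum_le_sum fun k hk => ?_
          split_ifs with h
          · simpa using (hcon i hi j hj k hk h.1 h.2.1 h.2.2).le
          · have : atomAvg p (edgeInd H) (p (x i)) (p (x j)) (p (x k)) ≤ 1 :=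
              fibreAvg_le_one _ _ (fun _ => edgeInd_le_one H _ _ _) _
            linarith
      _ ≤ _ := by
          simp only [Finset.sum_add_distrib]
          have := sum_not_distinct_le S
          simp only [Finset.sum_const, nsmul_eq_mul, ← hL] at this ⊢
          nlinarith
  have h3 : (t / L) ^ 3 * (L ^ 3 * (d / 2) + 3 * L ^ 2) = t ^ 3 * (d / 2 + 3 / L) := by
    field_simp
  have h4 := mul_le_mul_of_nonneg_left upper (show 0 ≤ (t / L) ^ 3 by positivity)
  rw [h3] at h4
  have h5 : 3 / L ≤ d / 4 := by
    rw [div_le_iff₀ hL0]; linarith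
  have h6 : t ^ 3 * (d / 2 + 3 / L) ≤ t ^ 3 * (3 * d / 4) := by
    gcongr; linarith
  have h7 : 3 * t ^ 2 ≤ t ^ 3 / 16 := by nlinarith [sq_nonneg t]
  have h8 : 6 * η * n ^ 3 ≤ d * t ^ 3 / 16 := by
    have : 0 ≤ n ^ 3 := by positivity
    have h9 := mul_le_mul_of_nonneg_right hη this
    rw [ht]; nlinarith
  have h10 := mul_le_mul_of_nonneg_left h7 hd.le
  have : 0 < d * t ^ 3 := by positivity
  nlinarith

/-- If all atoms met by a long sequence are large, some subsequence has all its triples of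
atoms dense. -/
theorem exists_dense_atom_subset {d : ℝ} (hd : 0 < d) (K : ℕ) :
    ∃ M : ℕ, ∀ (V σ : Type) [Fintype V] [DecidableEq V] [DecidableEq σ] (H : H3 V) (η τ : ℝ),
      H.uniformlyDense d η → 48 ≤ τ * Fintype.card V → 96 * η ≤ d * τ ^ 3 →
      ∀ (p : V → σ) (x : Fin M → V), (∀ l, τ * Fintype.card V ≤ atomSize p (p (x l))) →
      ∃ B : Finset (Fin M), B.card = K ∧ ∀ i ∈ B, ∀ j ∈ B, ∀ k ∈ B, i < j → j < k →
        d / 2 ≤ atomAvg p (edgeInd H) (p (x i)) (p (x j)) (p (x k)) := by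
  obtain ⟨L, hL⟩ := exists_nat_gt (12 / d)
  rw [div_lt_iff₀ hd] at hL
  obtain ⟨M, hM⟩ := exists_ramsey 3 (max K L)
  refine ⟨M, fun V σ _ _ _ H η τ hH hn hη p x hx => ?_⟩
  let w : Fin M → Fin M → Fin M → ℝ := fun i j k =>
    atomAvg p (edgeInd H) (p (x i)) (p (x j)) (p (x k))
  have sl : ∀ i j k, w i j k = w j i k := fun i j k =>
    atomAvg_swap_left p (edgeInd_swap_left H) _ _ _
  have sr : ∀ i j k, w i j k = w i k j := fun i j k =>
    atomAvg_swap_right p (edgeInd_swap_right H) _ _ _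
  obtain ⟨B, -, hBc, hBh⟩ := hM (Fin M) Finset.univ (by simp) (fun T => ∀ i ∈ T, ∀ j ∈ T, ∀ k ∈ T,
    i ≠ j → i ≠ k → j ≠ k → d / 2 ≤ w i j k)
  obtain ⟨B', hB', hc'⟩ := Finset.exists_subset_card_eq (s := B) (n := K)
    (by rw [hBc]; exact le_max_left _ _)
  refine ⟨B', hc', ?_⟩
  rcases hBh with h | h
  · intro i hi j hj k hk hij hjk
    refine h {i, j, k} ?_ (Finset.card_eq_three.2 ⟨i, j, k, hij.ne, (hij.trans hjk).ne, hjk.ne,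
      rfl⟩) i (by simp) j (by simp) k (by simp) hij.ne (hij.trans hjk).ne hjk.ne
    intro a ha
    simp only [Finset.mem_insert, Finset.mem_singleton] at ha
    rcases ha with rfl | rfl | rfl
    · exact hB' hi
    · exact hB' hj
    · exact hB' hk
  · exfalso
    have hLB : (L : ℝ) ≤ B.card := by rw [hBc]; exact_mod_cast le_max_right _ _
    obtain ⟨i, hi, j, hj, k, hk, h1, h2, h3, hd2⟩ := exists_dense_atom_triple H hd hH hn hη p x B
      (by nlinarith) (fun l _ => hx l)
    refine h {i, j, k} ?_ (Finset.card_eq_three.2 ⟨i, j, k, h1, h2, h3, rfl⟩) ?_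
    · intro a ha
      simp only [Finset.mem_insert, Finset.mem_singleton] at ha
      rcases ha with rfl | rfl | rfl <;> assumption
    · change d / 2 ≤ w i j k at hd2
      intro a ha b hb c hc hab hac hbc
      simp only [Finset.mem_insert, Finset.mem_singleton] at ha hb hc
      have q1 := sl i j k; have q2 := sr i j k; have q3 := sr j i k; have q4 := sl i k j
      have q5 := sr k i j
      rcases ha with rfl | rfl | rfl <;> rcases hb with rfl | rfl | rfl <;>
        rcases hc with rfl | rfl | rfl <;> first | contradiction | linarith

end VertexStep

/-- The three possible positions of a third point relative to a pair `x < y`. -/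
inductive IsRole {ι : Type} [LinearOrder ι] : (ι → ι → ι → Prop) → Prop
  | above : IsRole fun _ y z => y < z
  | below : IsRole fun x _ z => z < x
  | between : IsRole fun x y z => x < z ∧ z < y

theorem exists_spread_subset {ι : Type} [LinearOrder ι] {P : ι → ι → ι → Prop} (hP : IsRole P)
    (Y : Finset ι) (t w : ℕ) (hY : (t + 1) * (w + 1) ≤ Y.card) :
    ∃ T ⊆ Y, T.card = t ∧ ∀ x ∈ T, ∀ y ∈ T, x < y → ∃ Z ⊆ Y, Z.card = w ∧ ∀ z ∈ Z, P x y z := by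
  classical
  let e := Y.orderEmbOfFin rfl
  have heY : ∀ i, e i ∈ Y := fun i => Finset.orderEmbOfFin_mem Y rfl i
  have hidx : ∀ g : Fin t, (g.1 + 1) * (w + 1) + (w + 1) ≤ Y.card := fun g => by
    have h1 : (g.1 + 1) * (w + 1) ≤ t * (w + 1) := Nat.mul_le_mul_right _ g.2
    nlinarith
  let f : Fin t → ι := fun g => e ⟨(g.1 + 1) * (w + 1), by have := hidx g; omega⟩
  have hf : StrictMono f := fun a b hab => by
    refine e.strictMono ?_
    have h1 : a.1 + 1 < b.1 + 1 := Nat.succ_lt_succ hab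
    exact Nat.mul_lt_mul_of_pos_right h1 (Nat.succ_pos w)
  refine ⟨Finset.univ.image f, ?_, ?_, ?_⟩
  · intro x hx
    obtain ⟨g, _, rfl⟩ := Finset.mem_image.1 hx
    exact heY _
  · rw [Finset.card_image_of_injective _ hf.injective, Finset.card_univ, Fintype.card_fin]
  · intro x hx y hy hxy
    obtain ⟨a, _, rfl⟩ := Finset.mem_image.1 hx
    obtain ⟨b, _, rfl⟩ := Finset.mem_image.1 hy
    have hab : a < b := hf.lt_iff_lt.1 hxy
    have key : ∀ base : ℕ, base + w ≤ Y.card → ∃ Z ⊆ Y, Z.card = w ∧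
        ∀ z ∈ Z, ∃ (s : ℕ) (h : base + s < Y.card), s < w ∧ z = e ⟨base + s, h⟩ := by
      intro base hb
      refine ⟨Finset.univ.image fun s : Fin w => e ⟨base + s.1, by omega⟩, ?_, ?_, ?_⟩
      · intro z hz
        obtain ⟨s, _, rfl⟩ := Finset.mem_image.1 hz
        exact heY _
      · rw [Finset.card_image_of_injective, Finset.card_univ, Fintype.card_fin]
        intro s s' hs
        have := e.injective hs
        simp only [Fin.mk.injEq] at this
        exact Fin.ext (by omega)
      · intro z hz
        obtain ⟨s, _, rfl⟩ := Finset.mem_image.1 hz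
        exact ⟨s.1, by omega, s.2, rfl⟩
    have ha := hidx a
    have hb := hidx b
    have hab' : (a.1 + 1) * (w + 1) + (w + 1) ≤ (b.1 + 1) * (w + 1) := by
      have : a.1 + 1 + 1 ≤ b.1 + 1 := Nat.succ_le_succ hab
      have := Nat.mul_le_mul_right (w + 1) this
      linarith
    cases hP with
    | above =>
      obtain ⟨Z, hZ, hc, hZ'⟩ := key ((b.1 + 1) * (w + 1) + 1) (by omega)
      refine ⟨Z, hZ, hc, fun z hz => ?_⟩
      obtain ⟨s, h, hs, rfl⟩ := hZ' z hz
      exact e.strictMono (Fin.mk_lt_mk.2 (by omega))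
    | below =>
      obtain ⟨Z, hZ, hc, hZ'⟩ := key 0 (by omega)
      refine ⟨Z, hZ, hc, fun z hz => ?_⟩
      obtain ⟨s, h, hs, rfl⟩ := hZ' z hz
      have : w + 1 ≤ (a.1 + 1) * (w + 1) := Nat.le_mul_of_pos_left _ (Nat.succ_pos _)
      exact e.strictMono (Fin.mk_lt_mk.2 (by omega))
    | between =>
      obtain ⟨Z, hZ, hc, hZ'⟩ := key ((a.1 + 1) * (w + 1) + 1) (by omega)
      refine ⟨Z, hZ, hc, fun z hz => ?_⟩
      obtain ⟨s, h, hs, rfl⟩ := hZ' z hz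
      exact ⟨e.strictMono (Fin.mk_lt_mk.2 (by omega)), e.strictMono (Fin.mk_lt_mk.2 (by omega))⟩

theorem IsRole.unique {ι : Type} [LinearOrder ι] {P : ι → ι → ι → Prop} (hP : IsRole P)
    {x y x' y' : ι} (h : x < y) (h' : x' < y') (h1 : x' = x ∨ x' = y ∨ P x y x')
    (h2 : y' = x ∨ y' = y ∨ P x y y') (h3 : x = x' ∨ x = y' ∨ P x' y' x)
    (h4 : y = x' ∨ y = y' ∨ P x' y' y) : x' = x ∧ y' = y := by
  cases hP <;> grind

theorem IsRole.ne {ι : Type} [LinearOrder ι] {P : ι → ι → ι → Prop} (hP : IsRole P)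
    {x y z : ι} (h : x < y) (hz : P x y z) : z ≠ x ∧ z ≠ y := by
  cases hP <;> grind

/-- Among many events of probability at least `ε`, some `w` occur simultaneously with probability
bounded below. -/
theorem exists_joint_events {ι κ : Type} [DecidableEq ι] [Fintype κ] [DecidableEq κ] (ν : κ → ℝ)
    (h0 : ∀ a, 0 ≤ ν a) (h1 : ∑ a, ν a = 1) {ε : ℝ} (w : ℕ) (Z : Finset ι) (D : ι → Finset κ)
    (hZ : 2 * w ≤ ε * Z.card) (hpos : 0 < Z.card) (hD : ∀ z ∈ Z, ε ≤ ∑ a ∈ D z, ν a) :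
    ∃ Z' ⊆ Z, Z'.card = w ∧ ε / 2 / 2 ^ Z.card ≤ ∑ a with (∀ z ∈ Z', a ∈ D z), ν a := by
  by_contra! hcon
  let cnt : κ → Finset ι := fun a => Z.filter fun z => a ∈ D z
  have hsum : ε * Z.card ≤ ∑ a, ν a * (cnt a).card := by
    calc ε * Z.card = ∑ z ∈ Z, ε := by rw [Finset.sum_const, nsmul_eq_mul, mul_comm]
      _ ≤ ∑ z ∈ Z, ∑ a ∈ D z, ν a := Finset.sum_le_sum hD
      _ = ∑ z ∈ Z, ∑ a, if a ∈ D z then ν a else 0 := by simp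
      _ = ∑ a, ∑ z ∈ Z, if a ∈ D z then ν a else 0 := Finset.sum_comm
      _ = ∑ a, ν a * (cnt a).card := by
        refine Finset.sum_congr rfl fun a _ => ?_
        rw [← Finset.sum_filter, Finset.sum_const, nsmul_eq_mul, mul_comm]
  have hle : ∀ a, ν a * (cnt a).card ≤ ν a * w
      + Z.card * ∑ Z' ∈ Finset.powersetCard w Z, if (∀ z ∈ Z', a ∈ D z) then ν a else 0 := by
    intro a
    have hn : 0 ≤ ∑ Z' ∈ Finset.powersetCard w Z, if (∀ z ∈ Z', a ∈ D z) then ν a else 0 :=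
      Finset.sum_nonneg fun _ _ => by split_ifs <;> simp [h0]
    rcases le_or_gt w (cnt a).card with h | h
    · obtain ⟨Z', hZ', hc⟩ := Finset.exists_subset_card_eq h
      have hm : Z' ∈ Finset.powersetCard w Z :=
        Finset.mem_powersetCard.2 ⟨hZ'.trans (Finset.filter_subset _ _), hc⟩
      have h2 := Finset.single_le_sum
        (f := fun Z' : Finset ι => if (∀ z ∈ Z', a ∈ D z) then ν a else 0)
        (fun _ _ => by split_ifs <;> simp [h0]) hm
      beta_reduce at h2
      rw [if_pos fun z hz => (Finset.mem_filter.1 (hZ' hz)).2] at h2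
      have h3 : ((cnt a).card : ℝ) ≤ Z.card := by
        exact_mod_cast Finset.card_le_card (Finset.filter_subset _ _)
      have h4 : ν a * (cnt a).card ≤ Z.card * ν a := by
        rw [mul_comm]; exact mul_le_mul_of_nonneg_right h3 (h0 a)
      have h5 := mul_le_mul_of_nonneg_left h2 (Nat.cast_nonneg (α := ℝ) Z.card)
      have : 0 ≤ ν a * w := mul_nonneg (h0 a) (Nat.cast_nonneg _)
      linarith
    · have : ν a * (cnt a).card ≤ ν a * w :=
        mul_le_mul_of_nonneg_left (by exact_mod_cast h.le) (h0 a)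
      have : 0 ≤ (Z.card : ℝ) * ∑ Z' ∈ Finset.powersetCard w Z,
        if (∀ z ∈ Z', a ∈ D z) then ν a else 0 := mul_nonneg (Nat.cast_nonneg _) hn
      linarith
  have h2 := hsum.trans (Finset.sum_le_sum fun a _ => hle a)
  rw [Finset.sum_add_distrib, ← Finset.sum_mul, h1, one_mul, ← Finset.mul_sum,
    Finset.sum_comm] at h2
  have h3 : ∑ Z' ∈ Finset.powersetCard w Z, ∑ a, (if (∀ z ∈ Z', a ∈ D z) then ν a else 0)
      < ε / 2 ∨ (Finset.powersetCard w Z) = ∅ := by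
    rcases (Finset.powersetCard w Z).eq_empty_or_nonempty with he | he
    · exact Or.inr he
    · left
      have hcard : ((Finset.powersetCard w Z).card : ℝ) ≤ 2 ^ Z.card := by
        rw [Finset.card_powersetCard]
        exact_mod_cast Nat.choose_le_two_pow _ _
      have hε : 0 ≤ ε := by
        by_contra hneg
        have : (0 : ℝ) < Z.card := by exact_mod_cast hpos
        have : (0 : ℝ) ≤ w := Nat.cast_nonneg _
        nlinarith
      calc _ < ∑ Z' ∈ Finset.powersetCard w Z, ε / 2 / 2 ^ Z.card := by
            refine Finset.sum_lt_sum_of_nonempty he fun Z' hZ' => ?_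
            rw [← Finset.sum_filter]
            exact hcon Z' (Finset.mem_powersetCard.1 hZ').1 (Finset.mem_powersetCard.1 hZ').2
        _ ≤ 2 ^ Z.card * (ε / 2 / 2 ^ Z.card) := by
            rw [Finset.sum_const, nsmul_eq_mul]
            gcongr
        _ = ε / 2 := by field_simp
  have hZp : (0 : ℝ) < Z.card := by exact_mod_cast hpos
  rcases h3 with h3 | h3
  · nlinarith
  · have hwc : Z.card < w := by
      by_contra hw
      exact (Finset.powersetCard_nonempty.2 (not_lt.1 hw)).ne_empty h3
    have hwc' : (Z.card : ℝ) < w := by exact_mod_cast hwc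
    obtain ⟨z, hz⟩ := Finset.card_pos.1 hpos
    have hε1 : ε ≤ 1 := (hD z hz).trans (h1 ▸ Finset.sum_le_sum_of_subset_of_nonneg
      (Finset.subset_univ _) fun a _ _ => h0 a)
    nlinarith

open Classical in
/-- One cleaning step: if every event attached to a pair and an admissible third point is likely,
then on some subset, for each pair, all the events attached to it are simultaneously likely. -/
theorem exists_clean_subset (t : ℕ) {ε : ℝ} (hε : 0 < ε) :
    ∃ (K : ℕ) (c : ℝ), 0 < c ∧ c ≤ 1 ∧ ∀ (ι κ : Type) [LinearOrder ι] [Fintype κ] [DecidableEq κ]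
      (P : ι → ι → ι → Prop), IsRole P →
      ∀ (μ : ι → ι → κ → ℝ), (∀ x y a, 0 ≤ μ x y a) → (∀ x y, ∑ a, μ x y a = 1) →
      ∀ (D : ι → ι → ι → Finset κ) (A : Finset ι), K ≤ A.card →
      (∀ x ∈ A, ∀ y ∈ A, ∀ z ∈ A, x < y → P x y z → ε ≤ ∑ a ∈ D x y z, μ x y a) →
      ∃ T ⊆ A, T.card = t ∧ ∀ x ∈ T, ∀ y ∈ T, x < y →
        c ≤ ∑ a, if (∀ z ∈ T, P x y z → a ∈ D x y z) then μ x y a else 0 := by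
  obtain ⟨N, hN⟩ := exists_nat_gt (2 * t / ε)
  rw [div_lt_iff₀ hε] at hN
  obtain ⟨K, hK⟩ := exists_ramsey (t + 2) (max ((2 + 1) * (N + 1 + 1)) ((t + 1) * (t + 1)))
  refine ⟨K, min 1 (ε / 2 / 2 ^ (N + 1)), by positivity, min_le_left _ _, ?_⟩
  intro ι κ _ _ _ P hP μ h0 h1 D A hA hD
  let c := ε / 2 / 2 ^ (N + 1)
  obtain ⟨Y, hYA, hYc, hY⟩ := hK ι A hA fun Q => ∃ x ∈ Q, ∃ y ∈ Q, x < y ∧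
    (∀ z ∈ Q, z = x ∨ z = y ∨ P x y z) ∧
    c ≤ ∑ a with (∀ z ∈ Q, P x y z → a ∈ D x y z), μ x y a
  have build : ∀ x ∈ Y, ∀ y ∈ Y, x < y → ∀ Z ⊆ Y, Z.card = t → (∀ z ∈ Z, P x y z) →
      insert x (insert y Z) ⊆ Y ∧ (insert x (insert y Z)).card = t + 2 := by
    intro x hx y hy hxy Z hZ hZc hZP
    refine ⟨Finset.insert_subset hx (Finset.insert_subset hy hZ), ?_⟩
    rw [Finset.card_insert_of_notMem, Finset.card_insert_of_notMem, hZc]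
    · exact fun h => (hP.ne hxy (hZP y h)).2 rfl
    · rw [Finset.mem_insert, not_or]
      exact ⟨hxy.ne, fun h => (hP.ne hxy (hZP x h)).1 rfl⟩
  rcases hY with hgood | hbad
  · obtain ⟨T, hTY, hTc, hT⟩ := exists_spread_subset hP Y t t
      (by rw [hYc]; exact le_max_right _ _)
    refine ⟨T, hTY.trans hYA, hTc, fun x hx y hy hxy => ?_⟩
    obtain ⟨Z, hZY, hZc, hZP⟩ := hT x hx y hy hxy
    let Z₀ := T.filter fun z => P x y z
    obtain ⟨Z₁, hZ₀, hZ₁, hZ₁c⟩ := Finset.exists_subsuperset_card_eq (s := Z₀) (t := Z₀ ∪ Z)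
      (n := t) Finset.subset_union_left (hTc ▸ Finset.card_le_card (Finset.filter_subset _ _))
      (hZc ▸ Finset.card_le_card Finset.subset_union_right)
    have hZ₁P : ∀ z ∈ Z₁, P x y z := fun z hz => by
      rcases Finset.mem_union.1 (hZ₁ hz) with h | h
      · exact (Finset.mem_filter.1 h).2
      · exact hZP z h
    have hZ₁Y : Z₁ ⊆ Y := hZ₁.trans (Finset.union_subset
      ((Finset.filter_subset _ _).trans hTY) hZY)
    obtain ⟨hQ, hQc⟩ := build x (hTY hx) y (hTY hy) hxy Z₁ hZ₁Y hZ₁c hZ₁P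
    have hmem : ∀ z ∈ insert x (insert y Z₁), z = x ∨ z = y ∨ P x y z := fun z hz => by
      simp only [Finset.mem_insert] at hz
      rcases hz with h | h | h
      · exact Or.inl h
      · exact Or.inr (Or.inl h)
      · exact Or.inr (Or.inr (hZ₁P z h))
    obtain ⟨x', hx', y', hy', hxy', hall, hc⟩ := hgood _ hQ hQc
    obtain ⟨rfl, rfl⟩ := hP.unique hxy hxy' (hmem x' hx') (hmem y' hy')
      (hall x (by simp)) (hall y (by simp))
    refine (min_le_right _ _).trans (hc.trans ?_)
    rw [← Finset.sum_filter]
    refine Finset.sum_le_sum_of_subset_of_nonneg (fun a ha => ?_) fun a _ _ => h0 _ _ _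
    simp only [Finset.mem_filter, Finset.mem_univ, true_and] at ha ⊢
    exact fun z hz hPz => ha z (by
      simp only [Finset.mem_insert]
      exact Or.inr (Or.inr (hZ₀ (Finset.mem_filter.2 ⟨hz, hPz⟩)))) hPz
  · exfalso
    obtain ⟨T, hTY, hTc, hT⟩ := exists_spread_subset hP Y 2 (N + 1)
      (by rw [hYc]; exact le_max_left _ _)
    obtain ⟨x, hx, y, hy, hxy⟩ : ∃ x ∈ T, ∃ y ∈ T, x < y := by
      obtain ⟨a, b, hab, rfl⟩ := Finset.card_eq_two.1 hTc
      rcases lt_or_gt_of_ne hab with h | h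
      · exact ⟨a, by simp, b, by simp, h⟩
      · exact ⟨b, by simp, a, by simp, h⟩
    obtain ⟨Z, hZY, hZc, hZP⟩ := hT x hx y hy hxy
    have hx' := hTY hx
    have hy' := hTY hy
    obtain ⟨Z', hZ', hZ'c, hm⟩ := exists_joint_events (μ x y) (h0 x y) (h1 x y) (ε := ε) t Z (D x y)
      (by rw [hZc]; push_cast; nlinarith) (by omega)
      (fun z hz => hD x (hYA hx') y (hYA hy') z (hYA (hZY hz)) hxy (hZP z hz))
    obtain ⟨hQ, hQc⟩ := build x hx' y hy' hxy Z' (hZ'.trans hZY) hZ'c fun z hz => hZP z (hZ' hz)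
    refine hbad _ hQ hQc ⟨x, by simp, y, by simp, hxy, fun z hz => ?_, ?_⟩
    · simp only [Finset.mem_insert] at hz
      rcases hz with h | h | h
      · exact Or.inl h
      · exact Or.inr (Or.inl h)
      · exact Or.inr (Or.inr (hZP z (hZ' h)))
    · rw [hZc] at hm
      refine hm.trans (Finset.sum_le_sum_of_subset_of_nonneg (fun a ha => ?_)
        fun a _ _ => h0 _ _ _)
      simp only [Finset.mem_filter, Finset.mem_univ, true_and] at ha ⊢
      intro z hz hPz
      simp only [Finset.mem_insert] at hz
      have hne := hP.ne hxy hPz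
      exact ha z ((hz.resolve_left hne.1).resolve_left hne.2)

section ProductMean

variable {I J κ : Type} [Fintype I] [DecidableEq I] [Fintype J] [DecidableEq J] [Fintype κ]

/-- The mean of `F` when the coordinates are independent with laws `ν i`. -/
noncomputable def productMean (ν : I → κ → ℝ) (F : (I → κ) → ℝ) : ℝ :=
  ∑ R : I → κ, (∏ i, ν i (R i)) * F R

theorem productMean_nonneg {ν : I → κ → ℝ} (h0 : ∀ i a, 0 ≤ ν i a) {F : (I → κ) → ℝ}
    (hF : ∀ R, 0 ≤ F R) : 0 ≤ productMean ν F :=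
  Finset.sum_nonneg fun R _ => mul_nonneg (Finset.prod_nonneg fun i _ => h0 i _) (hF R)

theorem productMean_finset_sum {σ : Type} (ν : I → κ → ℝ) (s : Finset σ)
    (F : σ → (I → κ) → ℝ) :
    productMean ν (fun R => ∑ x ∈ s, F x R) = ∑ x ∈ s, productMean ν (F x) := by
  simp only [productMean, Finset.mul_sum]
  exact Finset.sum_comm

theorem productMean_prod (ν : I → κ → ℝ) (g : I → κ → ℝ) :
    productMean ν (fun R => ∏ i, g i (R i)) = ∏ i, ∑ a, ν i a * g i a := by
  simp only [productMean, ← Finset.prod_mul_distrib]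
  exact (Fintype.prod_sum fun i a => ν i a * g i a).symm

theorem productMean_const {ν : I → κ → ℝ} (h1 : ∀ i, ∑ a, ν i a = 1) (c : ℝ) :
    productMean ν (fun _ => c) = c := by
  have := productMean_prod ν fun _ _ => 1
  simp only [mul_one, h1, Finset.prod_const_one] at this
  simp only [productMean, mul_one] at this ⊢
  rw [← Finset.sum_mul, this, one_mul]

theorem productMean_sum_type (ν : I → κ → ℝ) (ν' : J → κ → ℝ) (F : (I ⊕ J → κ) → ℝ) :
    productMean (Sum.elim ν ν') F =
      productMean ν fun R => productMean ν' fun B => F (Sum.elim R B) := by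
  simp only [productMean, Finset.mul_sum]
  rw [← Fintype.sum_prod_type']
  refine Fintype.sum_equiv (Equiv.sumArrowEquivProdArrow I J κ) _ _ fun R => ?_
  have hR : Sum.elim (fun i => R (Sum.inl i)) (fun j => R (Sum.inr j)) = R := by
    ext s; cases s <;> rfl
  simp only [Equiv.sumArrowEquivProdArrow, Equiv.coe_fn_mk, Fintype.prod_sum_type, Sum.elim_inl,
    Sum.elim_inr, Function.comp_def, hR, mul_assoc]

theorem productMean_reindex (e : J ≃ I) (ν : I → κ → ℝ) (F : (I → κ) → ℝ) :
    productMean ν F = productMean (fun j => ν (e j)) fun R => F (R ∘ e.symm) := by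
  refine Fintype.sum_equiv (Equiv.arrowCongr e.symm (Equiv.refl κ)) _ _ fun R => ?_
  have h1 : (∏ i, ν i (R i)) = ∏ j, ν (e j) (R (e j)) :=
    (Fintype.prod_equiv e _ _ fun _ => rfl).symm
  have h2 : (fun j => R (e j)) ∘ e.symm = R := by ext; simp
  simp only [Equiv.arrowCongr, Equiv.coe_fn_mk, Equiv.symm_symm, Equiv.coe_refl,
    Function.id_comp, h1]
  rw [show (R ∘ ⇑e) = fun j => R (e j) from rfl, h2]

theorem productMean_comp {ν : I → κ → ℝ} (h1 : ∀ i, ∑ a, ν i a = 1) {f : J → I}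
    (hf : Function.Injective f) (F : (J → κ) → ℝ) :
    productMean ν (fun R => F (R ∘ f)) = productMean (fun j => ν (f j)) F := by
  classical
  let e : J ⊕ {i // ¬ i ∈ Set.range f} ≃ I :=
    (Equiv.sumCongr (Equiv.ofInjective f hf) (Equiv.refl _)).trans
      (Equiv.sumCompl fun i => i ∈ Set.range f)
  have he : ∀ j, e (Sum.inl j) = f j := fun j => rfl
  have hν : (fun s => ν (e s)) = Sum.elim (fun j => ν (f j)) fun i => ν i.1 := by
    ext s; cases s <;> rfl
  rw [productMean_reindex e, hν, productMean_sum_type]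
  have : ∀ (R : J → κ) (B : {i // ¬ i ∈ Set.range f} → κ),
      (Sum.elim R B ∘ e.symm) ∘ f = R := fun R B => by
    ext j
    simp only [Function.comp_apply, ← he, Equiv.symm_apply_apply, Sum.elim_inl]
  simp only [this]
  congr 1
  ext R
  exact productMean_const (ν := fun i : {i // ¬ i ∈ Set.range f} => ν i.1)
    (fun i => h1 i.1) (F R)

theorem pow_mul_le_productMean {ν : I → κ → ℝ} (h0 : ∀ i a, 0 ≤ ν i a) {c v : ℝ} (hc : 0 ≤ c)
    (hv : 0 ≤ v) (P : I → κ → Prop) {_ : ∀ i a, Decidable (P i a)}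
    (hP : ∀ i, c ≤ ∑ a, if P i a then ν i a else 0)
    {F : (I → κ) → ℝ} (hF : ∀ R, 0 ≤ F R) (hPF : ∀ R, (∀ i, P i (R i)) → v ≤ F R) :
    c ^ Fintype.card I * v ≤ productMean ν F := by
  have h1 : c ^ Fintype.card I ≤ productMean ν fun R => ∏ i, if P i (R i) then 1 else 0 := by
    rw [productMean_prod ν fun i a => if P i a then 1 else 0, ← Finset.card_univ,
      ← Finset.prod_const]
    refine Finset.prod_le_prod (fun _ _ => hc) fun i _ => (hP i).trans_eq ?_
    simp
  refine (mul_le_mul_of_nonneg_right h1 hv).trans ?_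
  simp only [productMean, Finset.sum_mul, mul_assoc]
  refine Finset.sum_le_sum fun R _ =>
    mul_le_mul_of_nonneg_left ?_ (Finset.prod_nonneg fun i _ => h0 i _)
  by_cases h : ∀ i, P i (R i)
  · simpa [h] using hPF R h
  · obtain ⟨i, hi⟩ := not_forall.1 h
    rw [Finset.prod_eq_zero (Finset.mem_univ i) (if_neg hi), zero_mul]
    exact hF R

end ProductMean

theorem le_sum_filter_of_le_mean {κ : Type} [Fintype κ] {ν f : κ → ℝ} {ε ε' : ℝ}
    (hε : ε' = 2 * ε) (hε0 : 0 ≤ ε)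
    (h0 : ∀ a, 0 ≤ ν a) (h1 : ∑ a, ν a = 1) (hf1 : ∀ a, f a ≤ 1)
    (h : ε' ≤ ∑ a, ν a * f a) : ε ≤ ∑ a with ε ≤ f a, ν a := by
  have h2 : ∑ a, ν a * f a ≤ ∑ a, (ν a * ε + if ε ≤ f a then ν a else 0) := by
    refine Finset.sum_le_sum fun a _ => ?_
    split_ifs with hc
    · nlinarith [h0 a, hf1 a, mul_le_mul_of_nonneg_left (hf1 a) (h0 a), mul_nonneg (h0 a) hε0]
    · nlinarith [h0 a, mul_le_mul_of_nonneg_left (not_le.1 hc).le (h0 a)]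
  rw [Finset.sum_add_distrib, ← Finset.sum_mul, h1, one_mul, ← Finset.sum_filter] at h2
  linarith

theorem sum_sum_mul_le_one {κ : Type} [Fintype κ] {w : κ → κ → ℝ} {ν ν' : κ → ℝ}
    (hw : ∀ a b, w a b ≤ 1) (h0 : ∀ a, 0 ≤ ν a) (h1 : ∑ a, ν a = 1) (h0' : ∀ a, 0 ≤ ν' a)
    (h1' : ∑ a, ν' a = 1) : ∑ a, ∑ b, w a b * (ν a * ν' b) ≤ 1 := by
  calc ∑ a, ∑ b, w a b * (ν a * ν' b) ≤ ∑ a, ∑ b, ν a * ν' b :=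
        Finset.sum_le_sum fun a _ => Finset.sum_le_sum fun b _ =>
          mul_le_of_le_one_left (mul_nonneg (h0 a) (h0' b)) (hw a b)
    _ = 1 := by rw [← Finset.sum_mul_sum, h1, h1', one_mul]

theorem sum_mul_le_one {κ : Type} [Fintype κ] {w : κ → ℝ} {ν : κ → ℝ}
    (hw : ∀ a, w a ≤ 1) (h0 : ∀ a, 0 ≤ ν a) (h1 : ∑ a, ν a = 1) : ∑ a, w a * ν a ≤ 1 :=
  h1 ▸ Finset.sum_le_sum fun a _ => mul_le_of_le_one_left (h0 a) (hw a)

theorem le_sum_ite_of_mem {ι κ : Type} [LinearOrder ι] [Fintype κ]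
    {μ : ι → ι → κ → ℝ} {c : ℝ} (hc : c ≤ 1) (h1 : ∀ x y, ∑ a, μ x y a = 1) {T : Finset ι}
    {Q : ι → ι → κ → Prop} {_ : ∀ x y a, Decidable (Q x y a)}
    (h : ∀ x ∈ T, ∀ y ∈ T, x < y → c ≤ ∑ a, if Q x y a then μ x y a else 0) (i : ι × ι) :
    c ≤ ∑ a, if (i.1 ∈ T → i.2 ∈ T → i.1 < i.2 → Q i.1 i.2 a) then μ i.1 i.2 a else 0 := by
  by_cases hi : i.1 ∈ T ∧ i.2 ∈ T ∧ i.1 < i.2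
  · obtain ⟨ha, hb, hab⟩ := hi
    simpa [ha, hb, hab] using h _ ha _ hb hab
  · have : ∀ a, (i.1 ∈ T → i.2 ∈ T → i.1 < i.2 → Q i.1 i.2 a) := fun a ha hb hab =>
      (hi ⟨ha, hb, hab⟩).elim
    simpa only [if_pos (this _), h1] using hc

/-- A red-green-blue pattern with positive weight in a dense weighted reduced structure. -/
theorem exists_pattern_embedding {m : ℕ} {S : Type} [Fintype S] [DecidableEq S] (l r : S → Fin m)
    (hlr : ∀ s, l s < r s) (hinj : Function.Injective fun s => (l s, r s)) (col : S → Fin 3)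
    (E : Finset (S × S × S))
    (hE : ∀ e ∈ E, l e.1 = l e.2.1 ∧ r e.1 = l e.2.2 ∧ r e.2.1 = r e.2.2 ∧
      col e.1 = 0 ∧ col e.2.1 = 1 ∧ col e.2.2 = 2) {δ : ℝ} (hδ : 0 < δ) :
    ∃ K : ℕ, ∀ M : ℕ, ∃ c > 0, ∀ (κ : Type) [Fintype κ] [DecidableEq κ]
      (μ : Fin M → Fin M → κ → ℝ) (W : κ → κ → κ → ℝ), (∀ x y a, 0 ≤ μ x y a) →
      (∀ x y, ∑ a, μ x y a = 1) → (∀ a b c, 0 ≤ W a b c) → (∀ a b c, W a b c ≤ 1) →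
      ∀ A : Finset (Fin M), K ≤ A.card →
      (∀ i ∈ A, ∀ j ∈ A, ∀ k ∈ A, i < j → j < k →
        δ ≤ ∑ a, ∑ b, ∑ c, W a b c * (μ i j a * μ i k b * μ j k c)) →
      ∃ σ : Fin m → Fin M, StrictMono σ ∧ c ≤ ∑ α : S → κ,
        (∏ s, μ (σ (l s)) (σ (r s)) (α s)) * ∏ e ∈ E, W (α e.1) (α e.2.1) (α e.2.2) := by
  classical
  obtain ⟨K₃, c₃, hc₃, hc₃', H₃⟩ := exists_clean_subset m (ε := δ / 8) (by positivity)
  obtain ⟨K₂, c₂, hc₂, hc₂', H₂⟩ := exists_clean_subset K₃ (ε := δ / 4) (by positivity)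
  obtain ⟨K₁, c₁, hc₁, hc₁', H₁⟩ := exists_clean_subset K₂ (ε := δ / 2) (by positivity)
  refine ⟨K₁, fun M => ?_⟩
  let n := Fintype.card (Fin M × Fin M)
  let v := (δ / 8) ^ E.card
  have hv : 0 < v := by positivity
  let Sm : Finset (Fin m → Fin M) := Finset.univ.filter StrictMono
  let C := c₁ ^ n * (c₂ ^ n * (c₃ ^ n * v))
  have hC : 0 < C := by positivity
  refine ⟨C / (Sm.card + 1), by positivity, ?_⟩
  intro κ _ _ μ W h0 h1 hW0 hW1 A hA hdense
  let ν : Fin M × Fin M → κ → ℝ := fun i => μ i.1 i.2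
  have hν0 : ∀ i a, 0 ≤ ν i a := fun i a => h0 _ _ _
  have hν1 : ∀ i, ∑ a, ν i a = 1 := fun i => h1 _ _
  let sel : (Fin m → Fin M) → (Fin M × Fin M → κ) → (Fin M × Fin M → κ) →
      (Fin M × Fin M → κ) → S → κ := fun σ R B G s =>
    if col s = 0 then R (σ (l s), σ (r s))
    else if col s = 2 then B (σ (l s), σ (r s)) else G (σ (l s), σ (r s))
  let Φ : (S → κ) → ℝ := fun α => ∏ e ∈ E, W (α e.1) (α e.2.1) (α e.2.2)
  have hΦ : ∀ α, 0 ≤ Φ α := fun α => Finset.prod_nonneg fun e _ => hW0 _ _ _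
  have marg : ∀ σ ∈ Sm, productMean ν (fun R => productMean ν fun B => productMean ν fun G =>
      Φ (sel σ R B G)) = ∑ α : S → κ, (∏ s, μ (σ (l s)) (σ (r s)) (α s)) * Φ α := by
    intro σ hσ
    have hσ' : StrictMono σ := (Finset.mem_filter.1 hσ).2
    let f : S → (Fin M × Fin M) ⊕ ((Fin M × Fin M) ⊕ (Fin M × Fin M)) := fun s =>
      if col s = 0 then Sum.inl (σ (l s), σ (r s))
      else if col s = 2 then Sum.inr (Sum.inl (σ (l s), σ (r s)))
      else Sum.inr (Sum.inr (σ (l s), σ (r s)))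
    have hf : Function.Injective f := by
      have key : ∀ s, Sum.elim id (Sum.elim id id) (f s) = (σ (l s), σ (r s)) := fun s => by
        simp only [f]; split_ifs <;> rfl
      intro s s' hs
      have := (key s).symm.trans ((congrArg _ hs).trans (key s'))
      simp only [Prod.mk.injEq, hσ'.injective.eq_iff] at this
      exact hinj (Prod.ext this.1 this.2)
    have h2 := productMean_comp (ν := Sum.elim ν (Sum.elim ν ν))
      (by rintro (i | i | i) <;> exact hν1 i) hf Φ
    rw [productMean_sum_type] at h2
    simp only [productMean_sum_type] at h2
    have h3 : ∀ R B G, Sum.elim R (Sum.elim B G) ∘ f = sel σ R B G := fun R B G => by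
      ext s
      simp only [f, sel, Function.comp_apply]
      split_ifs <;> rfl
    simp only [h3] at h2
    rw [h2, productMean]
    refine Finset.sum_congr rfl fun α _ => ?_
    congr 1
    refine Finset.prod_congr rfl fun s _ => ?_
    simp only [f]
    split_ifs <;> rfl
  suffices hmain : C ≤ productMean ν fun R => productMean ν fun B => productMean ν fun G =>
      ∑ σ ∈ Sm, Φ (sel σ R B G) by
    simp only [productMean_finset_sum] at hmain
    by_contra! hcon
    have h2 : ∑ σ ∈ Sm, productMean ν (fun R => productMean ν fun B => productMean ν fun G =>
        Φ (sel σ R B G)) ≤ ∑ σ ∈ Sm, C / (Sm.card + 1) :=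
      Finset.sum_le_sum fun σ hσ =>
        (marg σ hσ).trans_le (hcon σ (Finset.mem_filter.1 hσ).2).le
    rw [Finset.sum_const, nsmul_eq_mul] at h2
    have h3 : (Sm.card : ℝ) * (C / (Sm.card + 1)) < C := by
      rw [mul_div_assoc', div_lt_iff₀ (by positivity)]
      nlinarith
    linarith
  have hX : ∀ R B G, 0 ≤ ∑ σ ∈ Sm, Φ (sel σ R B G) := fun R B G =>
    Finset.sum_nonneg fun σ _ => hΦ _
  obtain ⟨T₁, hT₁, hT₁c, hT₁'⟩ := H₁ (Fin M) κ _ .above μ h0 h1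
    (fun i j k => Finset.univ.filter fun a =>
      δ / 2 ≤ ∑ b, ∑ c, W a b c * (μ i k b * μ j k c)) A hA (by
    intro i hi j hj k hk hij hjk
    refine le_sum_filter_of_le_mean (ε' := δ) (by ring) (by positivity) (h0 _ _) (h1 _ _)
      (fun a => sum_sum_mul_le_one (hW1 a) (h0 _ _) (h1 _ _) (h0 _ _) (h1 _ _))
      ((hdense i hi j hj k hk hij hjk).trans_eq ?_)
    simp only [Finset.mul_sum]
    refine Finset.sum_congr rfl fun a _ => Finset.sum_congr rfl fun b _ =>
      Finset.sum_congr rfl fun c _ => by ring)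
  refine pow_mul_le_productMean hν0 hc₁.le (by positivity) _ (le_sum_ite_of_mem hc₁' h1 hT₁')
    (fun R => productMean_nonneg hν0 fun B => productMean_nonneg hν0 fun G => hX R B G)
    fun R hR => ?_
  obtain ⟨T₂, hT₂, hT₂c, hT₂'⟩ := H₂ (Fin M) κ _ .below μ h0 h1
    (fun j k i => Finset.univ.filter fun c => δ / 4 ≤ ∑ b, W (R (i, j)) b c * μ i k b) T₁ hT₁c.ge
    (by
    intro j hj k hk i hi hjk hij
    have h2 := hR (i, j) hi hj hij k hk hjk
    rw [Finset.mem_filter] at h2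
    refine le_sum_filter_of_le_mean (ε' := δ / 2) (by ring) (by positivity) (h0 _ _) (h1 _ _)
      (fun c => sum_mul_le_one (fun b => hW1 _ b c) (h0 _ _) (h1 _ _)) (h2.2.trans_eq ?_)
    rw [Finset.sum_comm]
    simp only [Finset.mul_sum]
    refine Finset.sum_congr rfl fun a _ => Finset.sum_congr rfl fun b _ => by ring)
  refine pow_mul_le_productMean hν0 hc₂.le (by positivity) _ (le_sum_ite_of_mem hc₂' h1 hT₂')
    (fun B => productMean_nonneg hν0 fun G => hX R B G) fun B hB => ?_
  obtain ⟨T₃, hT₃, hT₃c, hT₃'⟩ := H₃ (Fin M) κ _ .between μ h0 h1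
    (fun i k j => Finset.univ.filter fun b => δ / 8 ≤ W (R (i, j)) b (B (j, k))) T₂ hT₂c.ge
    (by
    intro i hi k hk j hj hik hijk
    have h2 := hB (j, k) hj hk hijk.2 i hi hijk.1
    rw [Finset.mem_filter] at h2
    refine le_sum_filter_of_le_mean (ε' := δ / 4) (by ring) (by positivity) (h0 _ _) (h1 _ _)
      (fun b => hW1 _ b _) (h2.2.trans_eq ?_)
    exact Finset.sum_congr rfl fun a _ => mul_comm _ _)
  refine pow_mul_le_productMean hν0 hc₃.le hv.le _ (le_sum_ite_of_mem hc₃' h1 hT₃')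
    (fun G => hX R B G) fun G hG => ?_
  let σ : Fin m → Fin M := T₃.orderEmbOfFin hT₃c
  have hσ : StrictMono σ := (T₃.orderEmbOfFin hT₃c).strictMono
  have hσT : ∀ i, σ i ∈ T₃ := fun i => Finset.orderEmbOfFin_mem _ _ i
  refine le_trans ?_ (Finset.single_le_sum (f := fun σ => Φ (sel σ R B G)) (fun σ _ => hΦ _)
    (Finset.mem_filter.2 ⟨Finset.mem_univ σ, hσ⟩))
  simp only [v, Φ, ← Finset.prod_const]
  refine Finset.prod_le_prod (fun _ _ => by positivity) fun e he => ?_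
  obtain ⟨e1, e2, e3, k1, k2, k3⟩ := hE e he
  have h2 := hG (σ (l e.2.1), σ (r e.2.1)) (hσT _) (hσT _) (hσ (hlr _)) (σ (r e.1)) (hσT _)
    ⟨hσ (e1 ▸ hlr _), by rw [e2, e3]; exact hσ (hlr _)⟩
  rw [Finset.mem_filter] at h2
  have h3 := h2.2
  dsimp only at h3
  simpa only [sel, k1, k2, k3, e1, ← e3, ← e2, if_true, if_false, Fin.reduceEq] using h3

/-- Replacing the factors of a product one at a time. -/
theorem expect_prod_ge {Ω J : Type} [Fintype Ω] [DecidableEq J] (E : Finset J) (a b : J → Ω → ℝ)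
    {ε : ℝ} (h : ∀ e ∈ E, ∀ c : J → Ω → ℝ, (∀ i, c i = a i ∨ c i = b i) →
      -ε ≤ 𝔼 ω, (a e ω - b e ω) * ∏ i ∈ E.erase e, c i ω) :
    𝔼 ω, ∏ i ∈ E, b i ω - E.card * ε ≤ 𝔼 ω, ∏ i ∈ E, a i ω := by
  suffices H : ∀ A : Finset J, A ⊆ E → 𝔼 ω, ∏ i ∈ E, b i ω - A.card * ε ≤
      𝔼 ω, ∏ i ∈ E, (if i ∈ A then a i else b i) ω by
    refine (H E subset_rfl).trans_eq (Finset.expect_congr rfl fun ω _ =>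
      Finset.prod_congr rfl fun i hi => by rw [if_pos hi])
  intro A
  induction A using Finset.induction_on with
  | empty => intro _; simp
  | insert e A he ih =>
    intro hA
    have heE : e ∈ E := hA (Finset.mem_insert_self _ _)
    have h1 := ih ((Finset.subset_insert _ _).trans hA)
    have h2 := h e heE (fun i => if i ∈ A then a i else b i) fun i => by
      by_cases hi : i ∈ A <;> simp [hi]
    have h3 : 𝔼 ω, ∏ i ∈ E, (if i ∈ insert e A then a i else b i) ω =
        𝔼 ω, ∏ i ∈ E, (if i ∈ A then a i else b i) ω +
        𝔼 ω, (a e ω - b e ω) * ∏ i ∈ E.erase e, (if i ∈ A then a i else b i) ω := by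
      rw [← Finset.expect_add_distrib]
      refine Finset.expect_congr rfl fun ω _ => ?_
      rw [← Finset.mul_prod_erase E _ heE, ← Finset.mul_prod_erase E _ heE,
        if_pos (Finset.mem_insert_self _ _), if_neg he]
      have : ∏ i ∈ E.erase e, (if i ∈ insert e A then a i else b i) ω =
          ∏ i ∈ E.erase e, (if i ∈ A then a i else b i) ω :=
        Finset.prod_congr rfl fun i hi => by
          simp only [Finset.mem_insert, (Finset.mem_erase.1 hi).1, false_or]
      rw [this]
      ring
    rw [h3, Finset.card_insert_of_notMem he]
    push_cast
    linarith

section Coordinates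

variable {I V : Type} [DecidableEq I]

/-- `f` does not depend on the coordinate `i`. -/
def Ignores (i : I) (f : (I → V) → ℝ) : Prop :=
  ∀ x a, f (Function.update x i a) = f x

theorem Ignores.prod {i : I} {J : Type} {s : Finset J} {c : J → (I → V) → ℝ}
    (h : ∀ e ∈ s, Ignores i (c e)) : Ignores i fun x => ∏ e ∈ s, c e x :=
  fun x a => Finset.prod_congr rfl fun e he => h e he x a

variable [Fintype I] [Fintype V]

theorem expect_update [Nonempty V] (i : I) (f : (I → V) → ℝ) :
    𝔼 x, f x = 𝔼 x, 𝔼 a, f (Function.update x i a) := by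
  let e : (I → V) × V ≃ (I → V) × V :=
    { toFun := fun y => (Function.update y.1 i y.2, y.1 i)
      invFun := fun y => (Function.update y.1 i y.2, y.1 i)
      left_inv := fun y => by simp
      right_inv := fun y => by simp }
  have h1 : 𝔼 x, f x = 𝔼 y : (I → V) × V, f y.1 := by
    rw [← Finset.univ_product_univ, Finset.expect_product]
    simp
  rw [h1, Fintype.expect_equiv e.symm (fun y : (I → V) × V => f y.1)
    (fun y : (I → V) × V => f (Function.update y.1 i y.2)) fun y => by simp [e],
    ← Finset.univ_product_univ, Finset.expect_product]

theorem prod_mem_unit {Ω J : Type} {s : Finset J} {c : J → Ω → ℝ}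
    (h : ∀ e x, 0 ≤ c e x ∧ c e x ≤ 1) (x : Ω) : 0 ≤ ∏ e ∈ s, c e x ∧ ∏ e ∈ s, c e x ≤ 1 :=
  ⟨Finset.prod_nonneg fun e _ => (h e x).1, Finset.prod_le_one (fun e _ => (h e x).1)
    fun e _ => (h e x).2⟩

theorem expect_pair_ge [Nonempty V] {g : V → V → ℝ} {ε : ℝ}
    (hg : ∀ u v : V → ℝ, (∀ x, 0 ≤ u x ∧ u x ≤ 1) → (∀ x, 0 ≤ v x ∧ v x ≤ 1) →
      -ε ≤ 𝔼 x, 𝔼 y, g x y * (u x * v y)) {i j : I} (hij : i ≠ j) {J : Type} (s : Finset J)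
    (c : J → (I → V) → ℝ) (hc : ∀ e x, 0 ≤ c e x ∧ c e x ≤ 1)
    (hs : ∀ e ∈ s, Ignores i (c e) ∨ Ignores j (c e)) :
    -ε ≤ 𝔼 x : I → V, g (x i) (x j) * ∏ e ∈ s, c e x := by
  classical
  let A : (I → V) → ℝ := fun x => ∏ e ∈ s with Ignores j (c e), c e x
  let B : (I → V) → ℝ := fun x => ∏ e ∈ s with ¬ Ignores j (c e), c e x
  have hA : Ignores j A := Ignores.prod fun e he => (Finset.mem_filter.1 he).2
  have hB : Ignores i B := Ignores.prod fun e he => by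
    have := Finset.mem_filter.1 he
    exact (hs e this.1).resolve_right this.2
  have hx : ∀ (x : I → V) a b, A (Function.update (Function.update x i a) j b) =
      A (Function.update x i a) ∧ B (Function.update (Function.update x i a) j b) =
      B (Function.update x j b) := fun x a b =>
    ⟨hA _ _, by rw [Function.update_comm hij]; exact hB _ _⟩
  have hprod : ∀ x, ∏ e ∈ s, c e x = A x * B x := fun x =>
    (Finset.prod_filter_mul_prod_filter_not s _ _).symm
  rw [expect_update j, expect_update i]
  refine Finset.le_expect Finset.univ_nonempty fun x _ => ?_
  refine (hg (fun a => A (Function.update x i a)) (fun b => B (Function.update x j b))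
    (fun a => prod_mem_unit hc (Function.update x i a)) fun b =>
      prod_mem_unit hc (Function.update x j b)).trans_eq ?_
  refine Finset.expect_congr rfl fun a _ => Finset.expect_congr rfl fun b _ => ?_
  rw [hprod, (hx x a b).1, (hx x a b).2]
  simp [Function.update_of_ne hij]

theorem expect_triple_ge [Nonempty V] {g : V → V → V → ℝ} {ε : ℝ}
    (hg : ∀ u v w : V → V → ℝ, (∀ x y, 0 ≤ u x y ∧ u x y ≤ 1) → (∀ x y, 0 ≤ v x y ∧ v x y ≤ 1) →
      (∀ x y, 0 ≤ w x y ∧ w x y ≤ 1) →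
      -ε ≤ 𝔼 x, 𝔼 y, 𝔼 z, g x y z * (u x y * v x z * w y z)) {i j k : I} (hij : i ≠ j)
    (hik : i ≠ k) (hjk : j ≠ k) {J : Type} (s : Finset J)
    (c : J → (I → V) → ℝ) (hc : ∀ e x, 0 ≤ c e x ∧ c e x ≤ 1)
    (hs : ∀ e ∈ s, Ignores i (c e) ∨ Ignores j (c e) ∨ Ignores k (c e)) :
    -ε ≤ 𝔼 x : I → V, g (x i) (x j) (x k) * ∏ e ∈ s, c e x := by
  classical
  let A : (I → V) → ℝ := fun x => ∏ e ∈ s with Ignores k (c e), c e x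
  let s' := s.filter fun e => ¬ Ignores k (c e)
  let B : (I → V) → ℝ := fun x => ∏ e ∈ s' with Ignores j (c e), c e x
  let C : (I → V) → ℝ := fun x => ∏ e ∈ s' with ¬ Ignores j (c e), c e x
  have hA : Ignores k A := Ignores.prod fun e he => (Finset.mem_filter.1 he).2
  have hB : Ignores j B := Ignores.prod fun e he => (Finset.mem_filter.1 he).2
  have hC : Ignores i C := Ignores.prod fun e he => by
    have h1 := Finset.mem_filter.1 he
    have h2 := Finset.mem_filter.1 h1.1
    rcases hs e h2.1 with h | h | h
    · exact h
    · exact (h1.2 h).elim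
    · exact (h2.2 h).elim
  have hprod : ∀ x, ∏ e ∈ s, c e x = A x * B x * C x := fun x => by
    rw [← Finset.prod_filter_mul_prod_filter_not s (fun e => Ignores k (c e)),
      ← Finset.prod_filter_mul_prod_filter_not s' (fun e => Ignores j (c e)), mul_assoc]
  rw [expect_update k, expect_update j, expect_update i]
  refine Finset.le_expect Finset.univ_nonempty fun x _ => ?_
  refine (hg (fun a b => A (Function.update (Function.update x i a) j b))
    (fun a b => B (Function.update (Function.update x i a) k b))
    (fun a b => C (Function.update (Function.update x j a) k b))
    (fun a b => prod_mem_unit hc (Function.update (Function.update x i a) j b))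
    (fun a b => prod_mem_unit hc (Function.update (Function.update x i a) k b))
    (fun a b => prod_mem_unit hc (Function.update (Function.update x j a) k b))).trans_eq ?_
  refine Finset.expect_congr rfl fun a _ => Finset.expect_congr rfl fun b _ =>
    Finset.expect_congr rfl fun d _ => ?_
  let y := Function.update (Function.update (Function.update x i a) j b) k d
  have h1 : A y = A (Function.update (Function.update x i a) j b) := hA _ _
  have h2 : B y = B (Function.update (Function.update x i a) k d) := by
    have : y = Function.update (Function.update (Function.update x i a) k d) j b :=
      Function.update_comm hjk ..
    rw [this]; exact hB _ _
  have h3 : C y = C (Function.update (Function.update x j b) k d) := by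
    have : y = Function.update (Function.update (Function.update x j b) k d) i a := by
      simp only [y]
      rw [Function.update_comm hij, Function.update_comm hik]
    rw [this]; exact hC _ _
  change _ = g (y i) (y j) (y k) * ∏ e ∈ s, c e y
  rw [hprod, h1, h2, h3]
  simp [y, Function.update_of_ne hij, Function.update_of_ne hik, Function.update_of_ne hjk]

end Coordinates

/-- The counting lemma for a regular structure. -/
theorem expect_pattern_ge {V κ σ S : Type} [Fintype V] [Nonempty V] [Fintype κ] [DecidableEq κ]
    [Fintype S] [DecidableEq S] {m : ℕ} {l r : S → Fin m} (hlr : ∀ s, l s < r s)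
    (hinj : Function.Injective fun s => (l s, r s)) (E : Finset (S × S × S))
    (hE : ∀ e ∈ E, l e.1 = l e.2.1 ∧ r e.1 = l e.2.2 ∧ r e.2.1 = r e.2.2)
    {h : V → V → V → ℝ} (hh0 : ∀ x y z, 0 ≤ h x y z) (hh1 : ∀ x y z, h x y z ≤ 1)
    (q : V → V → κ) {W : κ → κ → κ → ℝ} (hW0 : ∀ a b c, 0 ≤ W a b c) (hW1 : ∀ a b c, W a b c ≤ 1)
    (p : V → σ) {μ : κ → σ → σ → ℝ} (hμ0 : ∀ α a b, 0 ≤ μ α a b) (hμ1 : ∀ α a b, μ α a b ≤ 1)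
    {ε δ : ℝ} (hδ : 0 ≤ δ)
    (hb : ∀ a b c : V → V → ℝ, (∀ x y, 0 ≤ a x y ∧ a x y ≤ 1) → (∀ x y, 0 ≤ b x y ∧ b x y ≤ 1) →
      (∀ x y, 0 ≤ c x y ∧ c x y ≤ 1) → -ε ≤ 𝔼 x, 𝔼 y, 𝔼 z,
        (h x y z - W (q x y) (q x z) (q y z)) * (a x y * b x z * c y z))
    (hd : ∀ α, ∀ u v : V → ℝ, (∀ x, 0 ≤ u x ∧ u x ≤ 1) → (∀ x, 0 ≤ v x ∧ v x ≤ 1) →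
      -δ ≤ 𝔼 x, 𝔼 y, ((if q x y = α then 1 else 0) - μ α (p x) (p y)) * (u x * v y)) :
    𝔼 x : Fin m → V, ∑ α : S → κ, (∏ s, μ (α s) (p (x (l s))) (p (x (r s)))) *
        ∏ e ∈ E, W (α e.1) (α e.2.1) (α e.2.2)
      - Fintype.card (S → κ) * (Fintype.card S * δ) - E.card * ε ≤
    𝔼 x : Fin m → V, ∏ e ∈ E, h (x (l e.1)) (x (r e.1)) (x (r e.2.1)) := by
  classical
  let Q : S → (Fin m → V) → κ := fun s x => q (x (l s)) (x (r s))
  let Φ : (S → κ) → ℝ := fun α => ∏ e ∈ E, W (α e.1) (α e.2.1) (α e.2.2)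
  have hΦ : ∀ α, 0 ≤ Φ α ∧ Φ α ≤ 1 := fun α =>
    ⟨Finset.prod_nonneg fun e _ => hW0 _ _ _,
      Finset.prod_le_one (fun e _ => hW0 _ _ _) fun e _ => hW1 _ _ _⟩
  have step₁ := expect_prod_ge E
    (fun e (x : Fin m → V) => h (x (l e.1)) (x (r e.1)) (x (r e.2.1)))
    (fun e x => W (Q e.1 x) (Q e.2.1 x) (Q e.2.2 x)) (ε := ε) (by
      intro e he c hc
      obtain ⟨h1, h2, h3⟩ := hE e he
      have := expect_triple_ge hb (hlr e.1).ne (h1 ▸ (hlr e.2.1).ne : l e.1 ≠ r e.2.1)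
        (by rw [h2, h3]; exact (hlr e.2.2).ne : r e.1 ≠ r e.2.1) (E.erase e) c ?_ ?_
      · simpa only [Q, h1, h2, h3] using this
      · intro i x
        rcases hc i with h | h <;> rw [h]
        · exact ⟨hh0 _ _ _, hh1 _ _ _⟩
        · exact ⟨hW0 _ _ _, hW1 _ _ _⟩
      · intro e' he'
        obtain ⟨hne, heE⟩ := Finset.mem_erase.1 he'
        obtain ⟨h1', h2', h3'⟩ := hE e' heE
        have hig : ∀ i, i ≠ l e'.1 → i ≠ r e'.1 → i ≠ r e'.2.1 → Ignores i (c e') := by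
          intro i n1 n2 n3 x a
          rcases hc e' with h | h <;> rw [h]
          · simp [Function.update_of_ne n1.symm, Function.update_of_ne n2.symm,
              Function.update_of_ne n3.symm]
          · simp [Q, ← h1', ← h2', ← h3', Function.update_of_ne n1.symm,
              Function.update_of_ne n2.symm, Function.update_of_ne n3.symm]
        by_contra! hcon
        have c1 := mt (fun H : _ ∧ _ ∧ _ => hig (l e.1) H.1 H.2.1 H.2.2) hcon.1
        have c2 := mt (fun H : _ ∧ _ ∧ _ => hig (r e.1) H.1 H.2.1 H.2.2) hcon.2.1
        have c3 := mt (fun H : _ ∧ _ ∧ _ => hig (r e.2.1) H.1 H.2.1 H.2.2) hcon.2.2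
        have i1 := hlr e.1
        have i2 := hlr e.2.2
        have i1' := hlr e'.1
        have i2' := hlr e'.2.2
        rw [← h2, ← h3] at i2
        rw [← h2', ← h3'] at i2'
        have heq : l e.1 = l e'.1 ∧ r e.1 = r e'.1 ∧ r e.2.1 = r e'.2.1 := by
          clear hig hcon hc
          refine ⟨?_, ?_, ?_⟩ <;> grind
        refine hne (Prod.ext (hinj ?_) (Prod.ext (hinj ?_) (hinj ?_)))
        · simp [heq]
        · simp [← h1, ← h1', heq]
        · simp [← h2, ← h2', ← h3, ← h3', heq])
  have step₂ : ∀ α : S → κ, 𝔼 x : Fin m → V, ∏ s, μ (α s) (p (x (l s))) (p (x (r s)))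
      - Fintype.card S * δ ≤ 𝔼 x : Fin m → V, ∏ s, if Q s x = α s then 1 else 0 := by
    intro α
    refine expect_prod_ge Finset.univ (fun s (x : Fin m → V) => if Q s x = α s then 1 else 0)
      (fun s x => μ (α s) (p (x (l s))) (p (x (r s)))) ?_
    intro s _ c hc
    refine expect_pair_ge (hd (α s)) (hlr s).ne (Finset.univ.erase s) c ?_ ?_
    · intro i x
      rcases hc i with h | h <;> rw [h]
      · beta_reduce; split_ifs <;> norm_num
      · exact ⟨hμ0 _ _ _, hμ1 _ _ _⟩
    · intro s' hs'
      have hne := (Finset.mem_erase.1 hs').1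
      have hig : ∀ i, i ≠ l s' → i ≠ r s' → Ignores i (c s') := by
        intro i n1 n2 x a
        rcases hc s' with h | h <;> rw [h] <;>
          simp [Q, Function.update_of_ne n1.symm, Function.update_of_ne n2.symm]
      by_contra! hcon
      have c1 := mt (fun H : _ ∧ _ => hig (l s) H.1 H.2) hcon.1
      have c2 := mt (fun H : _ ∧ _ => hig (r s) H.1 H.2) hcon.2
      have i1 := hlr s
      have i1' := hlr s'
      have heq : l s = l s' ∧ r s = r s' := by
        clear hig hcon hc
        refine ⟨?_, ?_⟩ <;> grind
      exact hne (hinj (by simp [heq]))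
  have step₃ : 𝔼 x : Fin m → V, ∏ e ∈ E, W (Q e.1 x) (Q e.2.1 x) (Q e.2.2 x) =
      ∑ α : S → κ, Φ α * 𝔼 x : Fin m → V, ∏ s, if Q s x = α s then 1 else 0 := by
    simp only [Finset.mul_expect]
    rw [← Finset.expect_sum_comm]
    refine Finset.expect_congr rfl fun x _ => ?_
    have : ∀ α : S → κ, (∏ s, if Q s x = α s then (1 : ℝ) else 0) =
        if α = (fun s => Q s x) then 1 else 0 := fun α => by
      rw [Finset.prod_ite_zero]
      simp [funext_iff, eq_comm]
    simp [this, Φ]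
  have step₄ : 𝔼 x : Fin m → V, ∑ α : S → κ, (∏ s, μ (α s) (p (x (l s))) (p (x (r s)))) *
        ∏ e ∈ E, W (α e.1) (α e.2.1) (α e.2.2) =
      ∑ α : S → κ, Φ α * 𝔼 x : Fin m → V, ∏ s, μ (α s) (p (x (l s))) (p (x (r s))) := by
    simp only [Finset.mul_expect]
    rw [← Finset.expect_sum_comm]
    exact Finset.expect_congr rfl fun x _ => Finset.sum_congr rfl fun α _ => mul_comm _ _
  have step₅ : ∑ α : S → κ, Φ α * 𝔼 x : Fin m → V, ∏ s, μ (α s) (p (x (l s))) (p (x (r s))) -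
      Fintype.card (S → κ) * (Fintype.card S * δ) ≤
      ∑ α : S → κ, Φ α * 𝔼 x : Fin m → V, ∏ s, if Q s x = α s then 1 else 0 := by
    rw [← Finset.card_univ (α := S → κ), ← nsmul_eq_mul, ← Finset.sum_const,
      ← Finset.sum_sub_distrib]
    refine Finset.sum_le_sum fun α _ => ?_
    have h1 := mul_le_mul_of_nonneg_left (step₂ α) (hΦ α).1
    have h2 : Φ α * (Fintype.card S * δ) ≤ Fintype.card S * δ :=
      mul_le_of_le_one_left (mul_nonneg (Nat.cast_nonneg _) hδ) (hΦ α).2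
    linarith
  linarith

section Sampling

variable {I J V : Type} [Fintype I] [DecidableEq I] [Fintype J] [DecidableEq J] [Fintype V]

theorem expect_eq_productMean (F : (I → V) → ℝ) :
    𝔼 x, F x = productMean (fun _ _ => (Fintype.card V : ℝ)⁻¹) F := by
  simp only [productMean, Finset.prod_const, Finset.card_univ, ← Finset.mul_sum]
  rw [Finset.expect_eq_sum_div_card, Finset.card_univ, Fintype.card_fun, div_eq_inv_mul]
  push_cast
  rw [inv_pow]

variable [Nonempty V]

theorem expect_comp_injective {f : J → I} (hf : Function.Injective f) (F : (J → V) → ℝ) :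
    𝔼 x : I → V, F (x ∘ f) = 𝔼 y, F y := by
  rw [expect_eq_productMean, expect_eq_productMean, productMean_comp _ hf]
  intro i
  have : (Fintype.card V : ℝ) ≠ 0 := by simp
  simp [this]

theorem expect_coordinate (i : I) (u : V → ℝ) : 𝔼 x : I → V, u (x i) = 𝔼 a, u a := by
  rw [expect_update i]
  simp

theorem expect_two_coordinates {i j : I} (hij : i ≠ j) (u : V → V → ℝ) :
    𝔼 x : I → V, u (x i) (x j) = 𝔼 a, 𝔼 b, u a b := by
  rw [expect_update j, expect_update i]
  simp [Function.update_of_ne hij]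

theorem expect_three_coordinates {i j k : I} (hij : i ≠ j) (hik : i ≠ k) (hjk : j ≠ k)
    (u : V → V → V → ℝ) :
    𝔼 x : I → V, u (x i) (x j) (x k) = 𝔼 a, 𝔼 b, 𝔼 c, u a b c := by
  rw [expect_update k, expect_update j, expect_update i]
  simp [Function.update_of_ne hij, Function.update_of_ne hik, Function.update_of_ne hjk]

end Sampling

theorem expect_small_atom_le {V σ : Type} [Fintype V] [Nonempty V] [Fintype σ] [DecidableEq σ]
    (p : V → σ) {τ : ℝ} (hτ : 0 ≤ τ) :
    𝔼 v, (if (atomSize p (p v) : ℝ) < τ * Fintype.card V then (1 : ℝ) else 0) ≤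
      Fintype.card σ * τ := by
  have hn : (0 : ℝ) < Fintype.card V := by exact_mod_cast Fintype.card_pos
  rw [Fintype.expect_eq_sum_div_card, div_le_iff₀ hn, ← Finset.sum_fiberwise _ p, mul_assoc,
    ← nsmul_eq_mul, ← Finset.card_univ (α := σ), ← Finset.sum_const]
  refine Finset.sum_le_sum fun a _ => ?_
  rw [Finset.sum_congr rfl (g := fun _ => if (atomSize p a : ℝ) < τ * Fintype.card V then 1 else 0)
    fun v hv => by rw [(Finset.mem_filter.1 hv).2], Finset.sum_const, nsmul_eq_mul]
  change (atomSize p a : ℝ) * _ ≤ _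
  split_ifs with h
  · rw [mul_one]; exact h.le
  · rw [mul_zero]; positivity

theorem expect_bad_triple_le {V σ : Type} [Fintype V] [Nonempty V] [Fintype σ] {h : V → V → V → ℝ}
    {p : V → σ} {w : σ → σ → σ → ℝ} {d ε : ℝ} (hd : 0 < d)
    (hc : ∀ s : σ → σ → σ → ℝ, (∀ a b c, |s a b c| ≤ 1) →
      𝔼 x, 𝔼 y, 𝔼 z, (h x y z - w (p x) (p y) (p z)) * s (p x) (p y) (p z) ≤ ε)
    (B : σ → σ → σ → Prop) [∀ a b c, Decidable (B a b c)]
    (hB : ∀ a b c, B a b c → w a b c + d ≤ atomAvg p h a b c) :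
    𝔼 x, 𝔼 y, 𝔼 z, (if B (p x) (p y) (p z) then (1 : ℝ) else 0) ≤ ε / d := by
  let s : σ → σ → σ → ℝ := fun a b c => if B a b c then 1 else 0
  have h1 := hc s fun a b c => by simp only [s]; split_ifs <;> norm_num
  have flat : ∀ f : V → V → V → ℝ,
      𝔼 x, 𝔼 y, 𝔼 z, f x y z = 𝔼 ω : V × V × V, f ω.1 ω.2.1 ω.2.2 := fun f => by
    rw [← Finset.univ_product_univ, Finset.expect_product, ← Finset.univ_product_univ]
    refine Finset.expect_congr rfl fun x _ => ?_
    rw [Finset.expect_product]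
  have h2 := expect_fibreAvg_mul (fun ω : V × V × V => (p ω.1, p ω.2.1, p ω.2.2))
    (fun ω => h ω.1 ω.2.1 ω.2.2) (fun a => s a.1 a.2.1 a.2.2)
  rw [le_div_iff₀ hd]
  refine le_trans ?_ h1
  rw [flat, flat]
  simp only [sub_mul]
  rw [Finset.expect_sub_distrib, ← h2, ← Finset.expect_sub_distrib, Finset.expect_mul]
  refine Finset.expect_le_expect fun ω _ => ?_
  simp only [s]
  split_ifs with hb
  · have := hB _ _ _ hb
    simp only [atomAvg] at this
    linarith
  · simp

theorem expect_le_of_injective_eq_zero {m : ℕ} {V : Type} [Fintype V] [DecidableEq V] [Nonempty V]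
    {G : (Fin m → V) → ℝ} (hG1 : ∀ y, G y ≤ 1) (hG0 : ∀ y, Function.Injective y → G y = 0) :
    𝔼 y, G y ≤ m ^ 2 / Fintype.card V := by
  let prs : Finset (Fin m × Fin m) := Finset.univ.filter fun t => t.1 ≠ t.2
  let eq : V → V → ℝ := fun a b => if a = b then 1 else 0
  have heq : ∀ a b, 0 ≤ eq a b := fun a b => by simp only [eq]; split_ifs <;> norm_num
  calc _ ≤ 𝔼 y : Fin m → V, ∑ t ∈ prs, eq (y t.1) (y t.2) := by
        refine Finset.expect_le_expect fun y _ => ?_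
        have h0 := Finset.sum_nonneg fun t (_ : t ∈ prs) => heq (y t.1) (y t.2)
        by_cases hy : Function.Injective y
        · rw [hG0 y hy]
          exact h0
        · simp only [Function.Injective, not_forall] at hy
          obtain ⟨i, j, hij, hne⟩ := hy
          have h1 : eq (y i) (y j) = 1 := if_pos hij
          refine (hG1 y).trans (h1.symm.trans_le ?_)
          exact Finset.single_le_sum (f := fun t : Fin m × Fin m => eq (y t.1) (y t.2))
            (fun t _ => heq _ _) (Finset.mem_filter.2 ⟨Finset.mem_univ (i, j), hne⟩)
    _ = ∑ t ∈ prs, (1 : ℝ) / Fintype.card V := by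
        rw [Finset.expect_sum_comm]
        refine Finset.sum_congr rfl fun t ht => ?_
        rw [expect_two_coordinates (Finset.mem_filter.1 ht).2 eq]
        have : ∀ a, 𝔼 b, eq a b = (1 : ℝ) / Fintype.card V := fun a => by
          simp [eq]
        simp only [this, Fintype.expect_const]
    _ ≤ m ^ 2 / Fintype.card V := by
        rw [Finset.sum_const, nsmul_eq_mul, mul_one_div]
        gcongr
        have h1 : prs.card ≤ m ^ 2 := by
          refine (Finset.card_le_univ _).trans_eq ?_
          simp only [Fintype.card_prod, Fintype.card_fin]
          ring
        exact_mod_cast h1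

set_option maxHeartbeats 1000000 in
/-- Uniformly dense 3-graphs contain every red-green-blue pattern injectively. -/
theorem exists_pattern {m : ℕ} {S : Type} [Fintype S] [DecidableEq S] (l r : S → Fin m)
    (hlr : ∀ s, l s < r s) (hinj : Function.Injective fun s => (l s, r s)) (col : S → Fin 3)
    (E : Finset (S × S × S))
    (hE : ∀ e ∈ E, l e.1 = l e.2.1 ∧ r e.1 = l e.2.2 ∧ r e.2.1 = r e.2.2 ∧
      col e.1 = 0 ∧ col e.2.1 = 1 ∧ col e.2.2 = 2) {d : ℝ} (hd : 0 < d) :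
    ∃ η > 0, ∃ n₀ : ℕ, ∀ (V : Type) [Fintype V] [DecidableEq V] (H : H3 V),
      n₀ ≤ Fintype.card V → H.uniformlyDense d η →
      ∃ f : Fin m → V, Function.Injective f ∧
        ∀ e ∈ E, {f (l e.1), f (r e.1), f (r e.2.1)} ∈ H.edges := by
  classical
  obtain ⟨K, hK⟩ := exists_pattern_embedding l r hlr hinj col E hE (δ := d / 4) (by positivity)
  obtain ⟨M, hM⟩ := exists_dense_atom_subset hd K
  obtain ⟨c, hc, hcK⟩ := hK M
  let emb : Finset (Fin m → Fin M) := Finset.univ.filter StrictMono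
  let c₁ := c / (2 * (emb.card + 1))
  have hc₁ : 0 < c₁ := by positivity
  let ε := min (c₁ / (4 * (E.card + 1))) (d / (16 * (M ^ 3 + 1)))
  have hε : 0 < ε := lt_min (by positivity) (by positivity)
  let δ : ℕ → ℝ := fun k => c₁ / (4 * ((k ^ Fintype.card S : ℕ) * Fintype.card S + 1))
  have hδ : ∀ k, 0 < δ k := fun k => by positivity
  obtain ⟨S₀, hS₀⟩ := exists_regular_structure hε δ hδ
  let τ : ℝ := 1 / (4 * (M + 1) * (S₀ + 1))
  have hτ : 0 < τ := by positivity
  obtain ⟨n₁, hn₁⟩ := exists_nat_gt (48 / τ)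
  obtain ⟨n₂, hn₂⟩ := exists_nat_gt (m ^ 2 / (c₁ / 2))
  refine ⟨d * τ ^ 3 / 96, by positivity, max n₁ (n₂ + 1), fun V _ _ H hn hH => ?_⟩
  have hnpos : 0 < Fintype.card V := by
    have := (le_max_right _ _).trans hn; omega
  have : Nonempty V := Fintype.card_pos_iff.1 hnpos
  have hnR : (0 : ℝ) < Fintype.card V := by exact_mod_cast hnpos
  obtain ⟨κ, _, _, q, W, σ, _, p, μ, hσ, hW0, hW1, hμ0, hμ1, hμ, hb, hd', hcc⟩ :=
    hS₀ V (edgeInd H) (edgeInd_nonneg H) (edgeInd_le_one H)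
  let Ψ : (Fin m → V) → ℝ := fun y => ∑ α : S → κ,
    (∏ s, μ (α s) (p (y (l s))) (p (y (r s)))) * ∏ e ∈ E, W (α e.1) (α e.2.1) (α e.2.2)
  have hΨ : ∀ y, 0 ≤ Ψ y := fun y => Finset.sum_nonneg fun α _ =>
    mul_nonneg (Finset.prod_nonneg fun _ _ => hμ0 _ _ _) (Finset.prod_nonneg fun _ _ => hW0 _ _ _)
  let small : V → ℝ := fun v => if (atomSize p (p v) : ℝ) < τ * Fintype.card V then 1 else 0
  let Bad : σ → σ → σ → Prop := fun a b c =>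
    d / 2 ≤ atomAvg p (edgeInd H) a b c ∧ meanWeight W μ a b c < d / 4
  let bad : V → V → V → ℝ := fun a b c => if Bad (p a) (p b) (p c) then 1 else 0
  have hsmall : 𝔼 v, small v ≤ S₀ * τ := (expect_small_atom_le p hτ.le).trans
    (mul_le_mul_of_nonneg_right (by exact_mod_cast hσ) hτ.le)
  have hbad : 𝔼 x, 𝔼 y, 𝔼 z, bad x y z ≤ ε / (d / 4) :=
    expect_bad_triple_le (by positivity) hcc Bad fun a b c h => by linarith [h.1, h.2]
  have hΨ_ge : c₁ ≤ 𝔼 y, Ψ y := by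
    let tri : Finset (Fin M × Fin M × Fin M) :=
      Finset.univ.filter fun t => t.1 < t.2.1 ∧ t.2.1 < t.2.2
    have hs0 : ∀ v, 0 ≤ small v := fun v => by simp only [small]; split_ifs <;> norm_num
    have hb0 : ∀ a b c, 0 ≤ bad a b c := fun a b c => by
      simp only [bad]; split_ifs <;> norm_num
    have pointwise : ∀ x : Fin M → V, c * (1 - ∑ i, small (x i)
        - ∑ t ∈ tri, bad (x t.1) (x t.2.1) (x t.2.2)) ≤ ∑ f ∈ emb, Ψ (x ∘ f) := by
      intro x
      have hs0' := Finset.sum_nonneg fun i (_ : i ∈ Finset.univ) => hs0 (x i)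
      have hb0' := Finset.sum_nonneg fun t (_ : t ∈ tri) => hb0 (x t.1) (x t.2.1) (x t.2.2)
      have hR : 0 ≤ ∑ f ∈ emb, Ψ (x ∘ f) := Finset.sum_nonneg fun f _ => hΨ _
      by_cases h1 : ∃ i, small (x i) = 1
      · obtain ⟨i, hi⟩ := h1
        have := Finset.single_le_sum (fun i (_ : i ∈ Finset.univ) => hs0 (x i))
          (Finset.mem_univ i)
        refine le_trans (mul_nonpos_of_nonneg_of_nonpos hc.le ?_) hR
        linarith
      by_cases h2 : ∃ t ∈ tri, bad (x t.1) (x t.2.1) (x t.2.2) = 1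
      · obtain ⟨t, ht, hi⟩ := h2
        have := Finset.single_le_sum
          (fun t (_ : t ∈ tri) => hb0 (x t.1) (x t.2.1) (x t.2.2)) ht
        refine le_trans (mul_nonpos_of_nonneg_of_nonpos hc.le ?_) hR
        linarith
      · push Not at h1 h2
        obtain ⟨B, hBc, hB⟩ := hM V σ H (d * τ ^ 3 / 96) τ hH
          (by
            have : (n₁ : ℝ) ≤ Fintype.card V := by exact_mod_cast (le_max_left _ _).trans hn
            rw [div_lt_iff₀ hτ] at hn₁
            nlinarith) (by linarith) p x fun i => by
            by_contra! hlt
            exact h1 i (if_pos hlt)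
        obtain ⟨f, hf, hfc⟩ := hcK κ (fun i j α => μ α (p (x i)) (p (x j))) W
          (fun _ _ _ => hμ0 _ _ _) (fun _ _ => hμ _ _) hW0 hW1 B hBc.ge
          fun i hi j hj k hk hij hjk => by
            have h3 := hB i hi j hj k hk hij hjk
            by_contra! hlt
            exact h2 (i, j, k) (Finset.mem_filter.2 ⟨Finset.mem_univ _, hij, hjk⟩)
              (if_pos ⟨h3, hlt⟩)
        refine le_trans ?_ (hfc.trans (Finset.single_le_sum (f := fun f => Ψ (x ∘ f))
          (fun f _ => hΨ _) (Finset.mem_filter.2 ⟨Finset.mem_univ f, hf⟩)))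
        exact mul_le_of_le_one_right hc.le (by linarith)
    have avg : 𝔼 x : Fin M → V, c * (1 - ∑ i, small (x i)
        - ∑ t ∈ tri, bad (x t.1) (x t.2.1) (x t.2.2)) ≤ 𝔼 x : Fin M → V, ∑ f ∈ emb, Ψ (x ∘ f) :=
      Finset.expect_le_expect fun x _ => pointwise x
    rw [← Finset.mul_expect, Finset.expect_sub_distrib, Finset.expect_sub_distrib,
      Fintype.expect_const, Finset.expect_sum_comm, Finset.expect_sum_comm,
      Finset.expect_sum_comm] at avg
    have a1 : ∑ i : Fin M, 𝔼 x : Fin M → V, small (x i) ≤ 1 / 4 := by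
      calc ∑ i : Fin M, 𝔼 x : Fin M → V, small (x i) ≤ ∑ i : Fin M, S₀ * τ :=
            Finset.sum_le_sum fun i _ => (expect_coordinate i small).trans_le hsmall
        _ = M * (S₀ * τ) := by simp
        _ ≤ 1 / 4 := by
            simp only [τ]
            rw [mul_one_div, mul_div_assoc', div_le_div_iff₀ (by positivity) (by positivity)]
            have : (0 : ℝ) ≤ M := Nat.cast_nonneg _
            have : (0 : ℝ) ≤ S₀ := Nat.cast_nonneg _
            nlinarith
    have a2 : ∑ t ∈ tri, 𝔼 x : Fin M → V, bad (x t.1) (x t.2.1) (x t.2.2) ≤ 1 / 4 := by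
      calc ∑ t ∈ tri, 𝔼 x : Fin M → V, bad (x t.1) (x t.2.1) (x t.2.2)
          ≤ ∑ t ∈ tri, ε / (d / 4) := Finset.sum_le_sum fun t ht => by
            obtain ⟨h1, h2⟩ := (Finset.mem_filter.1 ht).2
            exact (expect_three_coordinates h1.ne (h1.trans h2).ne h2.ne bad).trans_le hbad
        _ = tri.card * (ε / (d / 4)) := by rw [Finset.sum_const, nsmul_eq_mul]
        _ ≤ M ^ 3 * (ε / (d / 4)) := by
            have : (tri.card : ℝ) ≤ M ^ 3 := by
              have h1 : tri.card ≤ M ^ 3 := by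
                refine (Finset.card_le_univ _).trans_eq ?_
                simp only [Fintype.card_prod, Fintype.card_fin]
                ring
              exact_mod_cast h1
            gcongr
        _ ≤ M ^ 3 * (d / (16 * (M ^ 3 + 1)) / (d / 4)) := by
            gcongr
            exact min_le_right _ _
        _ = M ^ 3 / (M ^ 3 + 1) * (1 / 4) := by field_simp; norm_num
        _ ≤ 1 / 4 := by
            refine mul_le_of_le_one_left (by norm_num) ((div_le_one (by positivity)).2 ?_)
            linarith
    have a3 : ∑ f ∈ emb, 𝔼 x : Fin M → V, Ψ (x ∘ f) = emb.card * 𝔼 y, Ψ y := by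
      rw [← nsmul_eq_mul, ← Finset.sum_const]
      exact Finset.sum_congr rfl fun f hf =>
        expect_comp_injective (Finset.mem_filter.1 hf).2.injective Ψ
    have a4 : 0 ≤ 𝔼 y, Ψ y := Finset.expect_nonneg fun y _ => hΨ y
    rw [a3] at avg
    simp only [c₁]
    rw [div_le_iff₀ (by positivity)]
    nlinarith
  have hcount := expect_pattern_ge hlr hinj E (fun e he => ⟨(hE e he).1, (hE e he).2.1,
    (hE e he).2.2.1⟩) (edgeInd_nonneg H) (edgeInd_le_one H) q hW0 hW1 p hμ0 hμ1 (hδ _).le hb hd'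
  have e1 : (Fintype.card (S → κ) : ℝ) * (Fintype.card S * δ (Fintype.card κ)) ≤ c₁ / 4 := by
    simp only [δ, Fintype.card_fun]
    rw [mul_div_assoc', mul_div_assoc', div_le_div_iff₀ (by positivity) (by positivity)]
    nlinarith
  have e2 : E.card * ε ≤ c₁ / 4 := by
    refine (mul_le_mul_of_nonneg_left (min_le_left _ _) (Nat.cast_nonneg _)).trans ?_
    rw [mul_div_assoc', div_le_div_iff₀ (by positivity) (by positivity)]
    nlinarith
  by_contra! hcon
  have hninj : 𝔼 y : Fin m → V, ∏ e ∈ E, edgeInd H (y (l e.1)) (y (r e.1)) (y (r e.2.1)) ≤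
      m ^ 2 / Fintype.card V :=
    expect_le_of_injective_eq_zero (fun y => Finset.prod_le_one
      (fun _ _ => edgeInd_nonneg H _ _ _) fun _ _ => edgeInd_le_one H _ _ _) fun y hy => by
        obtain ⟨e, he, hne⟩ := hcon y hy
        exact Finset.prod_eq_zero he (if_neg hne)
  have e3 : (m : ℝ) ^ 2 / Fintype.card V < c₁ / 2 := by
    rw [div_lt_iff₀ (half_pos hc₁)] at hn₂
    rw [div_lt_iff₀ hnR]
    have : (n₂ : ℝ) + 1 ≤ Fintype.card V := by exact_mod_cast (le_max_right _ _).trans hn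
    nlinarith
  change 𝔼 y, Ψ y - _ - _ ≤ _ at hcount
  linarith

/-- `F` has a vertex ordering and a red-green-blue colouring of the pairs such that in every edge
`x < y < z` the pairs `xy`, `xz`, `yz` are red, green and blue respectively. -/
def HasVanishingColoring {W : Type} [DecidableEq W] (F : H3 W) : Prop :=
  ∃ (L : Type) (_ : LinearOrder L) (r : W → L) (col : W → W → Fin 3), Function.Injective r ∧
    ∀ e ∈ F.edges, ∃ x y z, e = {x, y, z} ∧ r x < r y ∧ r y < r z ∧
      col x y = 0 ∧ col x z = 1 ∧ col y z = 2

theorem HasVanishingColoring.exists_contains {W : Type} [DecidableEq W] [Fintype W] {F : H3 W}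
    (hF : HasVanishingColoring F) {d : ℝ} (hd : 0 < d) :
    ∃ η > 0, ∃ n₀ : ℕ, ∀ (V : Type) [Fintype V] [DecidableEq V] (H : H3 V),
      n₀ ≤ Fintype.card V → H.uniformlyDense d η → H.contains F := by
  obtain ⟨L, _, r, col, hr, hcol⟩ := hF
  let _ : LinearOrder W := LinearOrder.lift' r hr
  let g : W ≃o Fin (Fintype.card W) := (Fintype.orderIsoFinOfCardEq W rfl).symm
  let S := {s : Fin (Fintype.card W) × Fin (Fintype.card W) // s.1 < s.2}
  let c : S → Fin 3 := fun s => col (g.symm s.1.1) (g.symm s.1.2)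
  let E : Finset (S × S × S) := Finset.univ.filter fun e =>
    e.1.1.1 = e.2.1.1.1 ∧ e.1.1.2 = e.2.2.1.1 ∧ e.2.1.1.2 = e.2.2.1.2 ∧
      c e.1 = 0 ∧ c e.2.1 = 1 ∧ c e.2.2 = 2
  obtain ⟨η, hη, n₀, hn₀⟩ := exists_pattern (fun s : S => s.1.1) (fun s => s.1.2)
    (fun s => s.2) (fun _ _ h => Subtype.ext h) c E (fun e he => (Finset.mem_filter.1 he).2) hd
  refine ⟨η, hη, n₀, fun V _ _ H hn hH => ?_⟩
  obtain ⟨f, hf, hfE⟩ := hn₀ V H hn hH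
  refine ⟨f ∘ g, hf.comp g.injective, fun e he => ?_⟩
  obtain ⟨x, y, z, rfl, hxy, hyz, h0, h1, h2⟩ := hcol e he
  have hxy' : g x < g y := g.lt_iff_lt.2 hxy
  have hyz' : g y < g z := g.lt_iff_lt.2 hyz
  have := hfE (⟨(g x, g y), hxy'⟩, ⟨(g x, g z), hxy'.trans hyz'⟩, ⟨(g y, g z), hyz'⟩)
    (Finset.mem_filter.2 ⟨Finset.mem_univ _, rfl, rfl, rfl, by simpa [c] using h0,
      by simpa [c] using h1, by simpa [c] using h2⟩)
  simpa [Finset.image_insert] using this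

theorem HasVanishingColoring.uniformTuranDensity_eq_zero {W : Type} [DecidableEq W] [Fintype W]
    {F : H3 W} (hF : HasVanishingColoring F) : uniformTuranDensity F = 0 := by
  refine le_antisymm (Real.sSup_nonpos fun d hd => ?_) (Real.sSup_nonneg fun d hd => hd.1)
  by_contra! hpos
  obtain ⟨η, hη, n₀, hn₀⟩ := hF.exists_contains hpos
  obtain ⟨n, hn, H, hfree, hH⟩ := hd.2.2 η hη n₀
  exact hfree (hn₀ (Fin n) H (by simpa using hn) hH)

/-- `u` precedes `v` lexicographically and `i` is the first coordinate where they differ. -/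
def SplitsAt {k : ℕ} (u v : Fin k → ZMod 2) (i : Fin k) : Prop :=
  u i = 0 ∧ v i = 1 ∧ ∀ j < i, u j = v j

theorem exists_splitsAt {k : ℕ} {u v : Fin k → ZMod 2} (h : u ≠ v) :
    ∃ i, SplitsAt u v i ∨ SplitsAt v u i := by
  obtain ⟨i, hi, hmin⟩ := WellFounded.has_min (wellFounded_lt (α := Fin k)) {i | u i ≠ v i}
    (Function.ne_iff.1 h)
  have hlt : ∀ j < i, u j = v j := fun j hj => by_contra fun hne => hmin j hne hj
  have key : ∀ a b : ZMod 2, a ≠ b → a = 0 ∧ b = 1 ∨ b = 0 ∧ a = 1 := by decide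
  rcases key _ _ hi with h1 | h1
  · exact ⟨i, Or.inl ⟨h1.1, h1.2, hlt⟩⟩
  · exact ⟨i, Or.inr ⟨h1.1, h1.2, fun j hj => (hlt j hj).symm⟩⟩

theorem SplitsAt.ne {k : ℕ} {u v : Fin k → ZMod 2} {i : Fin k} (h : SplitsAt u v i) : u ≠ v := by
  rintro rfl
  exact zero_ne_one (h.1.symm.trans h.2.1)

theorem SplitsAt.unique {k : ℕ} {u v : Fin k → ZMod 2} {i j : Fin k} (hi : SplitsAt u v i)
    (hj : SplitsAt u v j) : i = j := by
  have key : ∀ {a b : Fin k}, SplitsAt u v a → SplitsAt u v b → ¬ a < b := fun ha hb hab =>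
    zero_ne_one (ha.1.symm.trans ((hb.2.2 _ hab).trans ha.2.1))
  exact le_antisymm (not_lt.1 (key hj hi)) (not_lt.1 (key hi hj))

/-- The differences between blocks that are used by the fixed part of the construction. -/
def nearDiffs : Finset ℕ := {1, 2, 3, 4, 7}

/-- `p < q` and the cyclic differences of `p` and `q` are not among `nearDiffs`. -/
def Far {N : ℕ} (p q : ZMod N) : Prop :=
  p.val < q.val ∧ (q - p).val ∉ nearDiffs ∧ (p - q).val ∉ nearDiffs

section Construction

variable {N t : ℕ}

/-- The vertices: in each of `N` blocks, all nonzero binary vectors of length `N + t`. -/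
abbrev Vert (N t : ℕ) : Type := ZMod N × {u : Fin (N + t) → ZMod 2 // u ≠ 0}

theorem val_sub_add_val_sub {p q r : ZMod N} (h : (q - p).val + (r - q).val < N) :
    (r - p).val = (q - p).val + (r - q).val := by
  rw [← ZMod.val_add_of_lt h]
  congr 1
  ring

theorem ne_of_val_sub {x y : Vert N t} {d : ℕ} (h : (y.1 - x.1).val = d) (hd : d ≠ 0) : x ≠ y := by
  rintro rfl
  exact hd (by rw [← h]; simp)

theorem Far.ne {p q : ZMod N} (h : Far p q) : p ≠ q := by
  rintro rfl
  exact lt_irrefl _ h.1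

variable [NeZero N]

/-- The coordinate associated with a block. -/
def coord (t : ℕ) (q : ZMod N) : Fin (N + t) := Fin.castAdd t ⟨q.val, q.val_lt⟩

theorem coord_injective : Function.Injective (coord (N := N) t) := fun p q h =>
  ZMod.val_injective N (by simpa [coord, Fin.ext_iff] using h)

/-- The four kinds of edges of the construction. -/
inductive IsTriple : Vert N t → Vert N t → Vert N t → Prop
  | next {x y z : Vert N t} {i : Fin (N + t)} (hxy : x.1 = y.1) (hxz : (z.1 - x.1).val = 3)
      (h0 : x.2.1 ⬝ᵥ z.2.1 = 0) (h1 : y.2.1 ⬝ᵥ z.2.1 = 1) (hi : SplitsAt x.2.1 y.2.1 i)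
      (hq : ∀ q, Far x.1 q → i ≠ coord t q) : IsTriple x y z
  | orthogonal {x y z : Vert N t} (hxy : (y.1 - x.1).val = 1) (hyz : (z.1 - y.1).val = 2)
      (h0 : x.2.1 ⬝ᵥ z.2.1 = 0) : IsTriple x y z
  | nonorthogonal {x y z : Vert N t} (hxy : (y.1 - x.1).val = 4) (hyz : (z.1 - y.1).val = 3)
      (h1 : y.2.1 ⬝ᵥ z.2.1 = 1) : IsTriple x y z
  | far {x y z : Vert N t} (hxy : x.1 = y.1) (hxz : Far x.1 z.1)
      (hi : SplitsAt x.2.1 y.2.1 (coord t z.1)) : IsTriple x y z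

theorem IsTriple.ne (hN : 14 < N) {x y z : Vert N t} (h : IsTriple x y z) :
    x ≠ y ∧ x ≠ z ∧ y ≠ z := by
  cases h with
  | next hxy hxz h0 h1 hi hq =>
    exact ⟨fun h => hi.ne (by rw [h]), ne_of_val_sub hxz (by norm_num),
      ne_of_val_sub (hxy ▸ hxz) (by norm_num)⟩
  | orthogonal hxy hyz h0 =>
    exact ⟨ne_of_val_sub hxy (by norm_num),
      ne_of_val_sub (val_sub_add_val_sub (by rw [hxy, hyz]; omega)) (by rw [hxy]; omega),
      ne_of_val_sub hyz (by norm_num)⟩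
  | nonorthogonal hxy hyz h1 =>
    exact ⟨ne_of_val_sub hxy (by norm_num),
      ne_of_val_sub (val_sub_add_val_sub (by rw [hxy, hyz]; omega)) (by rw [hxy]; omega),
      ne_of_val_sub hyz (by norm_num)⟩
  | far hxy hxz hi =>
    exact ⟨fun h => hi.ne (by rw [h]), fun h => hxz.ne (by rw [h]),
      fun h => hxz.ne (by rw [hxy, h])⟩

open Classical in
/-- The 3-graph with linear minimum codegree all of whose bounded subgraphs have a vanishing
colouring. -/
noncomputable def blockGraph (t : ℕ) (hN : 14 < N) : H3 (Vert N t) where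
  edges := Finset.univ.filter fun e => ∃ x y z, e = {x, y, z} ∧ IsTriple x y z
  card3 := by
    intro e he
    obtain ⟨x, y, z, rfl, h⟩ := (Finset.mem_filter.1 he).2
    obtain ⟨h1, h2, h3⟩ := h.ne hN
    exact Finset.card_eq_three.2 ⟨x, y, z, h1, h2, h3, rfl⟩

theorem mem_blockGraph {hN : 14 < N} {e : Finset (Vert N t)} :
    e ∈ (blockGraph t hN).edges ↔ ∃ x y z, e = {x, y, z} ∧ IsTriple x y z := by
  simp [blockGraph]

end Construction

theorem codeg_comm {V : Type} [DecidableEq V] (H : H3 V) (u v : V) : H.codeg u v = H.codeg v u := by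
  simp only [H3.codeg, and_comm]

theorem card_le_codeg {V : Type} [DecidableEq V] (H : H3 V) {u v : V} (A : Finset V)
    (hA : ∀ a ∈ A, {u, v, a} ∈ H.edges) : A.card ≤ H.codeg u v := by
  refine Finset.card_le_card_of_injOn (fun a => {u, v, a})
    (fun a ha => Finset.mem_filter.2 ⟨hA a ha, by simp⟩) fun a ha b hb hab => ?_
  have hmem : a ∈ ({u, v, b} : Finset V) := by
    rw [← show ({u, v, a} : Finset V) = {u, v, b} from hab]
    simp
  have hc := H.card3 _ (hA a ha)
  simp only [Finset.mem_insert, Finset.mem_singleton] at hmem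
  rcases hmem with rfl | rfl | h
  · have : ({a, v, a} : Finset V) = {a, v} := by ext; simp [or_comm]
    have := Finset.card_le_two (a := a) (b := v)
    simp_all
  · have : ({u, a, a} : Finset V) = {u, a} := by ext; simp
    have := Finset.card_le_two (a := u) (b := a)
    simp_all
  · exact h

theorem card_le_card_mul_card_fibre {A G : Type} [AddCommGroup A] [Fintype A] [AddCommGroup G]
    [Fintype G] [DecidableEq G] (φ : A →+ G) (a₀ : A) :
    Fintype.card A ≤ Fintype.card G * (Finset.univ.filter fun a => φ a = φ a₀).card := by
  rw [← Finset.card_univ, Finset.card_eq_sum_card_fiberwise (f := φ) (t := Finset.univ)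
    (fun _ _ => Finset.mem_coe.2 (Finset.mem_univ _)), ← Finset.card_univ (α := G),
    ← smul_eq_mul, ← Finset.sum_const]
  refine Finset.sum_le_sum fun g _ => ?_
  rcases Finset.eq_empty_or_nonempty (Finset.univ.filter fun a => φ a = g) with h | ⟨b, hb⟩
  · rw [h]; simp
  · have hb := (Finset.mem_filter.1 hb).2
    refine Finset.card_le_card_of_injOn (fun a => a - b + a₀) (fun a ha => ?_)
      fun a _ a' _ h => by simpa using h
    have ha : φ a = g := (Finset.mem_filter.1 ha).2
    simp [ha, hb]

theorem pow_le_card_nonzero_fibre {N t : ℕ} {G : Type} [AddCommGroup G] [Fintype G] [DecidableEq G]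
    (hG : Fintype.card G ≤ 2 ^ N) (φ : (Fin (N + t) → ZMod 2) →+ G) (w₀ : Fin (N + t) → ZMod 2) :
    2 ^ t - 1 ≤ (Finset.univ.filter
      fun w : {w : Fin (N + t) → ZMod 2 // w ≠ 0} => φ w = φ w₀).card := by
  have h1 := card_le_card_mul_card_fibre φ w₀
  simp only [Fintype.card_fun, ZMod.card, Fintype.card_fin] at h1
  have h2 : 2 ^ t ≤ (Finset.univ.filter fun a => φ a = φ w₀).card := by
    refine le_of_mul_le_mul_left (a := 2 ^ N) ?_ (Nat.two_pow_pos N)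
    rw [← pow_add]
    exact h1.trans (Nat.mul_le_mul_right _ hG)
  have h3 : ((Finset.univ.filter fun a => φ a = φ w₀).erase 0).card ≤ (Finset.univ.filter
      fun w : {w : Fin (N + t) → ZMod 2 // w ≠ 0} => φ w = φ w₀).card := by
    refine (Finset.card_le_card (t := (Finset.univ.filter
      fun w : {w : Fin (N + t) → ZMod 2 // w ≠ 0} => φ w = φ w₀).image (·.1)) fun a ha => ?_).trans
      Finset.card_image_le
    simp only [Finset.mem_erase, Finset.mem_filter, Finset.mem_univ, true_and] at ha
    exact Finset.mem_image.2 ⟨⟨a, ha.1⟩, by simpa using ha.2, rfl⟩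
  have h4 := Finset.pred_card_le_card_erase (s := Finset.univ.filter fun a => φ a = φ w₀) (a := 0)
  omega

theorem card_zmod_two_le {N : ℕ} (hN : 14 < N) : Fintype.card (ZMod 2) ≤ 2 ^ N := by
  rw [ZMod.card]
  exact Nat.le_self_pow (by omega) 2

theorem val_natCast_add_sub {N : ℕ} (p : ZMod N) {d : ℕ} (hd : d < N) : (p + d - p).val = d := by
  rw [add_sub_cancel_left, ZMod.val_natCast_of_lt hd]

section Codegree

variable {N t : ℕ} [NeZero N] {hN : 14 < N}

theorem le_codeg_of_fibre {u v : Vert N t} (b : ZMod N) {G : Type} [AddCommGroup G] [Fintype G]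
    [DecidableEq G] (hG : Fintype.card G ≤ 2 ^ N) (φ : (Fin (N + t) → ZMod 2) →+ G)
    (w₀ : Fin (N + t) → ZMod 2)
    (h : ∀ w : {w : Fin (N + t) → ZMod 2 // w ≠ 0}, φ w = φ w₀ →
      {u, v, (b, w)} ∈ (blockGraph t hN).edges) : 2 ^ t - 1 ≤ (blockGraph t hN).codeg u v := by
  refine (pow_le_card_nonzero_fibre hG φ w₀).trans ?_
  rw [← Finset.card_image_of_injective _ (Prod.mk_right_injective b)]
  refine card_le_codeg _ _ fun a ha => ?_
  obtain ⟨w, hw, rfl⟩ := Finset.mem_image.1 ha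
  exact h w (Finset.mem_filter.1 hw).2

/-- The linear functional given by the inner product with `u`. -/
def dotHom {k : ℕ} (u : Fin k → ZMod 2) : (Fin k → ZMod 2) →+ ZMod 2 where
  toFun w := u ⬝ᵥ w
  map_zero' := dotProduct_zero u
  map_add' := dotProduct_add u

theorem exists_dot_eq_one {k : ℕ} {u : Fin k → ZMod 2} (hu : u ≠ 0) : ∃ w, u ⬝ᵥ w = 1 := by
  obtain ⟨i, hi⟩ := Function.ne_iff.1 hu
  have key : ∀ a : ZMod 2, a ≠ 0 → a = 1 := by decide
  exact ⟨Pi.single i 1, by simpa using key _ hi⟩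

theorem le_codeg_of_dot {u v : Vert N t} (b : ZMod N) (a : Vert N t) (s : ZMod 2)
    (h : ∀ w : {w : Fin (N + t) → ZMod 2 // w ≠ 0}, a.2.1 ⬝ᵥ w.1 = s →
      {u, v, (b, w)} ∈ (blockGraph t hN).edges) : 2 ^ t - 1 ≤ (blockGraph t hN).codeg u v := by
  have key : ∀ s : ZMod 2, s = 0 ∨ s = 1 := by decide
  obtain ⟨w₀, hw₀⟩ : ∃ w₀, a.2.1 ⬝ᵥ w₀ = s := by
    rcases key s with rfl | rfl
    · exact ⟨0, dotProduct_zero _⟩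
    · exact exists_dot_eq_one a.2.2
  exact le_codeg_of_fibre b (card_zmod_two_le hN) (dotHom a.2.1) w₀ fun w hw =>
    h w (Eq.trans hw hw₀)

theorem le_codeg_of_splitsAt {u v : Vert N t} (huv : u.1 = v.1) {i : Fin (N + t)}
    (hi : SplitsAt u.2.1 v.2.1 i) : 2 ^ t - 1 ≤ (blockGraph t hN).codeg u v := by
  by_cases hq : ∃ q, Far u.1 q ∧ i = coord t q
  · obtain ⟨q, hq, rfl⟩ := hq
    exact le_codeg_of_fibre q (card_zmod_two_le hN) 0 0 fun w _ =>
      mem_blockGraph.2 ⟨u, v, (q, w), rfl, .far huv hq hi⟩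
  · push Not at hq
    refine le_codeg_of_fibre (u.1 + (3 : ℕ)) ?_ ((dotHom u.2.1).prod (dotHom v.2.1))
      (Pi.single i 1) fun w hw => mem_blockGraph.2 ⟨u, v, _, rfl, .next huv
        (val_natCast_add_sub _ (by omega)) ?_ ?_ hi hq⟩
    · rw [Fintype.card_prod, ZMod.card, ← pow_two]
      exact Nat.pow_le_pow_right (by norm_num) (by omega)
    · refine (Prod.ext_iff.1 hw).1.trans ?_
      simpa [dotHom] using hi.1
    · refine (Prod.ext_iff.1 hw).2.trans ?_
      simpa [dotHom] using hi.2.1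

theorem le_codeg_of_near {u v : Vert N t} (huv : (v.1 - u.1).val ∈ nearDiffs) :
    2 ^ t - 1 ≤ (blockGraph t hN).codeg u v := by
  have hkey : ∀ {p q r : ZMod N} {d e : ℕ}, (q - p).val = d → (r - p).val = e → d ≤ e →
      (r - q).val = e - d := fun {p q r d e} h1 h2 h3 => by
    rw [← h1, ← h2, ← ZMod.val_sub (by omega)]
    congr 1
    ring
  have hadd : ∀ (p : ZMod N) {d : ℕ}, d < 15 → (p + d - p).val = d := fun p d hd =>
    val_natCast_add_sub p (by omega)
  have hsub : ∀ (p : ZMod N) {d : ℕ}, d < 15 → (p - (p - d)).val = d := fun p d hd => by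
    rw [sub_sub_cancel, ZMod.val_natCast_of_lt (by omega)]
  have hrot : ∀ a : Vert N t, ({u, v, a} : Finset (Vert N t)) = {a, u, v} := fun a => by
    ext; simp; tauto
  have hswap : ∀ a : Vert N t, ({u, v, a} : Finset (Vert N t)) = {u, a, v} := fun a => by
    ext; simp; tauto
  have htwo : ∀ s : ZMod 2, s = 0 ∨ s = 1 := by decide
  simp only [nearDiffs, Finset.mem_insert, Finset.mem_singleton] at huv
  rcases huv with h | h | h | h | h
  · exact le_codeg_of_dot (u.1 + (3 : ℕ)) u 0 fun w hw => mem_blockGraph.2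
      ⟨_, _, _, rfl, .orthogonal h (hkey h (hadd _ (by norm_num)) (by norm_num)) hw⟩
  · exact le_codeg_of_dot (u.1 - (1 : ℕ)) v 0 fun w hw => mem_blockGraph.2
      ⟨_, _, _, hrot _, .orthogonal (hsub _ (by norm_num)) h ((dotProduct_comm _ _).trans hw)⟩
  · rcases htwo (u.2.1 ⬝ᵥ v.2.1) with h0 | h1
    · exact le_codeg_of_fibre (u.1 + (1 : ℕ)) (card_zmod_two_le hN) 0 0 fun w _ =>
        mem_blockGraph.2 ⟨_, _, _, hswap _, .orthogonal (hadd _ (by norm_num))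
          (hkey (hadd _ (by norm_num)) h (by norm_num)) h0⟩
    · exact le_codeg_of_fibre (u.1 - (4 : ℕ)) (card_zmod_two_le hN) 0 0 fun w _ =>
        mem_blockGraph.2 ⟨_, _, _, hrot _, .nonorthogonal (hsub _ (by norm_num)) h h1⟩
  · exact le_codeg_of_dot (v.1 + (3 : ℕ)) v 1 fun w hw => mem_blockGraph.2
      ⟨_, _, _, rfl, .nonorthogonal h (hadd _ (by norm_num)) hw⟩
  · exact le_codeg_of_dot (u.1 + (4 : ℕ)) v 1 fun w hw => mem_blockGraph.2
      ⟨_, _, _, hswap _, .nonorthogonal (hadd _ (by norm_num))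
        (hkey (hadd _ (by norm_num)) h (by norm_num)) ((dotProduct_comm _ _).trans hw)⟩

theorem le_codeg_of_far {u v : Vert N t} (huv : Far u.1 v.1) :
    2 ^ t - 1 ≤ (blockGraph t hN).codeg u v := by
  have htwo : ∀ s : ZMod 2, s = 0 ∨ s = 1 := by decide
  let φ : (Fin (N + t) → ZMod 2) →+ (Fin N → ZMod 2) :=
    { toFun := fun w i => w (Fin.castAdd t i), map_zero' := rfl, map_add' := fun _ _ => rfl }
  refine le_codeg_of_fibre u.1 (by simp [ZMod.card]) φ (u.2.1 + Pi.single (coord t v.1) 1)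
    fun w hw => ?_
  have hw' : ∀ i : Fin N, w.1 (Fin.castAdd t i) =
      (u.2.1 + Pi.single (coord t v.1) 1 : Fin (N + t) → ZMod 2) (Fin.castAdd t i) := congrFun hw
  have hlt : ∀ j < coord t v.1, w.1 j = u.2.1 j := fun j hj => by
    have hjN : (j : ℕ) < N := lt_trans (Fin.lt_def.1 hj) v.1.val_lt
    have := hw' ⟨j, hjN⟩
    change w.1 j = u.2.1 j + (Pi.single (coord t v.1) 1 : Fin (N + t) → ZMod 2) j at this
    rwa [Pi.single_eq_of_ne hj.ne, add_zero] at this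
  have hflip : w.1 (coord t v.1) = u.2.1 (coord t v.1) + 1 := by
    refine (hw' _).trans ?_
    change u.2.1 (coord t v.1) +
      (Pi.single (coord t v.1) 1 : Fin (N + t) → ZMod 2) (coord t v.1) = _
    rw [Pi.single_eq_same]
  rw [mem_blockGraph]
  rcases htwo (u.2.1 (coord t v.1)) with h | h
  · exact ⟨u, (u.1, w), v, by ext; simp; tauto, .far rfl huv
      ⟨h, by rw [hflip, h, zero_add], fun j hj => (hlt j hj).symm⟩⟩
  · exact ⟨(u.1, w), u, v, by ext; simp; tauto, .far rfl huv
      ⟨by rw [hflip, h]; rfl, h, hlt⟩⟩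

theorem le_codeg_blockGraph {u v : Vert N t} (huv : u ≠ v) :
    2 ^ t - 1 ≤ (blockGraph t hN).codeg u v := by
  by_cases h0 : u.1 = v.1
  · obtain ⟨i, hi | hi⟩ := exists_splitsAt (u := u.2.1) (v := v.2.1) fun h =>
      huv (Prod.ext h0 (Subtype.ext h))
    · exact le_codeg_of_splitsAt h0 hi
    · rw [codeg_comm]
      exact le_codeg_of_splitsAt h0.symm hi
  by_cases h1 : (v.1 - u.1).val ∈ nearDiffs
  · exact le_codeg_of_near h1
  by_cases h2 : (u.1 - v.1).val ∈ nearDiffs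
  · rw [codeg_comm]
    exact le_codeg_of_near h2
  rcases lt_or_gt_of_ne fun h => h0 (ZMod.val_injective N h) with h | h
  · exact le_codeg_of_far ⟨h, h1, h2⟩
  · rw [codeg_comm]
    exact le_codeg_of_far ⟨h, h2, h1⟩

end Codegree

section Colouring

variable {N t : ℕ}

/-- Vertices are ordered by block, and lexicographically inside a block. -/
def blockRank (pos : ZMod N → ℕ) (x : Vert N t) : ℕ ×ₗ Lex (Fin (N + t) → ℕ) :=
  toLex (pos x.1, toLex fun i => (x.2.1 i).val)

theorem blockRank_injective {pos : ZMod N → ℕ} (hpos : Function.Injective pos) :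
    Function.Injective (blockRank (t := t) pos) := fun x y h => by
  have h := Prod.ext_iff.1 (toLex.injective h)
  refine Prod.ext (hpos h.1) (Subtype.ext (funext fun i => ?_))
  exact ZMod.val_injective 2 (congrFun (toLex.injective h.2) i)

theorem blockRank_lt_of_pos {pos : ZMod N → ℕ} {x y : Vert N t} (h : pos x.1 < pos y.1) :
    blockRank pos x < blockRank pos y :=
  Prod.Lex.toLex_lt_toLex.2 (Or.inl h)

theorem blockRank_lt_of_splitsAt {pos : ZMod N → ℕ} {x y : Vert N t} (hxy : x.1 = y.1)
    {i : Fin (N + t)} (h : SplitsAt x.2.1 y.2.1 i) : blockRank pos x < blockRank pos y := by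
  refine Prod.Lex.toLex_lt_toLex.2 (Or.inr ⟨by simp [hxy], i, fun j hj => ?_, ?_⟩)
  · change (x.2.1 j).val = (y.2.1 j).val
    rw [h.2.2 j hj]
  · change (x.2.1 i).val < (y.2.1 i).val
    rw [h.1, h.2.1]
    decide

theorem ne_of_val_sub_pos {p q : ZMod N} (h : 0 < (q - p).val) : p ≠ q := by
  rintro rfl
  simp at h

variable [NeZero N]

/-- Cutting the cycle of blocks inside a gap of a small set `B` makes short forward steps inside
`B` increasing. -/
theorem exists_position (B : Finset (ZMod N)) (hB : B.card * 7 < N) :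
    ∃ pos : ZMod N → ℕ, Function.Injective pos ∧
      ∀ p ∈ B, ∀ q ∈ B, 0 < (q - p).val → (q - p).val ≤ 7 → pos p < pos q := by
  obtain ⟨r, hr⟩ : ∃ r, ∀ q ∈ B, 7 ≤ (q - r).val := by
    by_contra! hcon
    have hsub : (Finset.univ : Finset (ZMod N)) ⊆
        (B ×ˢ Finset.range 7).image fun s => s.1 - (s.2 : ZMod N) := fun r _ => by
      obtain ⟨q, hq, hlt⟩ := hcon r
      refine Finset.mem_image.2 ⟨(q, (q - r).val), by simp [hq, hlt], ?_⟩
      simp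
    have := (Finset.card_le_card hsub).trans Finset.card_image_le
    rw [Finset.card_univ, ZMod.card, Finset.card_product, Finset.card_range] at this
    omega
  refine ⟨fun p => (p - r).val, fun p q h => sub_left_injective (ZMod.val_injective N h),
    fun p hp q hq h0 h7 => ?_⟩
  have hq7 := hr q hq
  have hpN := (p - r).val_lt
  have hsum : (q - r).val = ((p - r).val + (q - p).val) % N := by
    rw [← ZMod.val_add]
    congr 1
    ring
  by_cases hlt : (p - r).val + (q - p).val < N
  · rw [Nat.mod_eq_of_lt hlt] at hsum
    simp only
    omega
  · have := (q - p).val_lt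
    rw [Nat.mod_eq_sub_mod (not_lt.1 hlt), Nat.mod_eq_of_lt (by omega)] at hsum
    omega

open Classical in
/-- The colour of a pair of vertices of the block construction, for a given block ordering. -/
noncomputable def blockColour (pos : ZMod N → ℕ) (x y : Vert N t) : Fin 3 :=
  if x.1 = y.1 then
    if ∃ q, SplitsAt x.2.1 y.2.1 (coord t q) ∧ Far x.1 q ∧ pos q < pos x.1 then 2 else 0
  else if (y.1 - x.1).val = 1 then 0
  else if (y.1 - x.1).val = 2 then 2
  else if (y.1 - x.1).val = 3 then if x.2.1 ⬝ᵥ y.2.1 = 0 then 1 else 2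
  else if (y.1 - x.1).val = 4 then 0
  else if (y.1 - x.1).val = 7 then 1
  else if Far x.1 y.1 then if x.2.1 (coord t y.1) = 0 then 1 else 2
  else if y.2.1 (coord t x.1) = 0 then 0 else 1

theorem blockColour_of_far {pos : ZMod N → ℕ} {x y : Vert N t} (h : Far x.1 y.1) :
    blockColour pos x y = if x.2.1 (coord t y.1) = 0 then 1 else 2 := by
  have h1 := h.2.1
  simp only [nearDiffs, Finset.mem_insert, Finset.mem_singleton, not_or] at h1
  simp [blockColour, h, h.ne, h1]

theorem blockColour_of_far_symm {pos : ZMod N → ℕ} {x y : Vert N t} (h : Far y.1 x.1) :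
    blockColour pos x y = if y.2.1 (coord t x.1) = 0 then 0 else 1 := by
  have h1 := h.2.2
  simp only [nearDiffs, Finset.mem_insert, Finset.mem_singleton, not_or] at h1
  have h2 : ¬ Far x.1 y.1 := fun h' => lt_asymm h.1 h'.1
  simp [blockColour, h2, h.ne.symm, h1]

theorem hasVanishingColoring_of_contains {W : Type} [DecidableEq W] [Fintype W] {F : H3 W}
    {hN : 14 < N} (hW : Fintype.card W * 7 < N) (h : (blockGraph t hN).contains F) :
    HasVanishingColoring F := by
  obtain ⟨f, hf, hfE⟩ := h
  obtain ⟨pos, hpos, hstep⟩ := exists_position (Finset.univ.image fun i => (f i).1)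
    ((Nat.mul_le_mul_right 7 (Finset.card_image_le.trans_eq Finset.card_univ)).trans_lt hW)
  have hstep : ∀ {i j : W} {d : ℕ}, ((f j).1 - (f i).1).val = d → 0 < d → d ≤ 7 →
      blockRank pos (f i) < blockRank pos (f j) := fun {i j d} hd h0 h7 =>
    blockRank_lt_of_pos (hstep _ (Finset.mem_image_of_mem _ (Finset.mem_univ i)) _
      (Finset.mem_image_of_mem _ (Finset.mem_univ j)) (by omega) (by omega))
  have hcol : ∀ {x y : Vert N t} {d : ℕ}, (y.1 - x.1).val = d → 0 < d → x.1 ≠ y.1 := fun hd h0 =>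
    ne_of_val_sub_pos (by omega)
  refine ⟨_, inferInstance, fun i => blockRank pos (f i), fun i j => blockColour pos (f i) (f j),
    (blockRank_injective hpos).comp hf, fun e he => ?_⟩
  obtain ⟨x, y, z, hxyz, htri⟩ := mem_blockGraph.1 (hfE e he)
  have hmem : ∀ v ∈ ({x, y, z} : Finset (Vert N t)), ∃ i ∈ e, f i = v := fun v hv =>
    Finset.mem_image.1 (hxyz ▸ hv)
  obtain ⟨i, hi, rfl⟩ := hmem x (by simp)
  obtain ⟨j, hj, rfl⟩ := hmem y (by simp)
  obtain ⟨k, hk, rfl⟩ := hmem z (by simp)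
  have he : e = {i, j, k} := Finset.image_injective hf (by rw [hxyz]; simp [Finset.image_insert])
  cases htri with
  | next hxy hxz h0 h1 hi hq =>
    have hyz : ((f k).1 - (f j).1).val = 3 := hxy ▸ hxz
    refine ⟨i, j, k, he, blockRank_lt_of_splitsAt hxy hi, hstep hyz (by norm_num) (by norm_num),
      ?_, ?_, ?_⟩
    · simp only [blockColour, if_pos hxy]
      exact if_neg fun ⟨q, hs, hfar, _⟩ => hq q hfar (hi.unique hs)
    · simp [blockColour, hcol hxz, hxz, h0]
    · simp [blockColour, hcol hyz, hyz, h1]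
  | orthogonal hxy hyz h0 =>
    have hxz : ((f k).1 - (f i).1).val = 3 := by
      rw [val_sub_add_val_sub (by rw [hxy, hyz]; omega), hxy, hyz]
    exact ⟨i, j, k, he, hstep hxy (by norm_num) (by norm_num), hstep hyz (by norm_num)
      (by norm_num), by simp [blockColour, hcol hxy, hxy], by simp [blockColour, hcol hxz, hxz, h0],
      by simp [blockColour, hcol hyz, hyz]⟩
  | nonorthogonal hxy hyz h1 =>
    have hxz : ((f k).1 - (f i).1).val = 7 := by
      rw [val_sub_add_val_sub (by rw [hxy, hyz]; omega), hxy, hyz]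
    exact ⟨i, j, k, he, hstep hxy (by norm_num) (by norm_num), hstep hyz (by norm_num)
      (by norm_num), by simp [blockColour, hcol hxy, hxy], by simp [blockColour, hcol hxz, hxz],
      by simp [blockColour, hcol hyz, hyz, h1]⟩
  | far hxy hxz hi =>
    have hyz : Far (f j).1 (f k).1 := hxy ▸ hxz
    rcases lt_or_gt_of_ne (hpos.ne hxz.ne) with hlt | hlt
    · refine ⟨i, j, k, he, blockRank_lt_of_splitsAt hxy hi, blockRank_lt_of_pos (hxy ▸ hlt),
        ?_, ?_, ?_⟩
      · simp only [blockColour, if_pos hxy]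
        refine if_neg fun ⟨q, hs, _, hq⟩ => ?_
        rw [coord_injective (hs.unique hi)] at hq
        exact lt_asymm hlt hq
      · simp [blockColour_of_far hxz, hi.1]
      · simp [blockColour_of_far hyz, hi.2.1]
    · refine ⟨k, i, j, by rw [he]; ext; simp; tauto, blockRank_lt_of_pos hlt,
        blockRank_lt_of_splitsAt hxy hi, ?_, ?_, ?_⟩
      · simp [blockColour_of_far_symm hxz, hi.1]
      · simp [blockColour_of_far_symm hyz, hi.2.1]
      · simp only [blockColour, if_pos hxy]
        exact if_pos ⟨_, hi, hxz, hlt⟩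

end Colouring

section Transport

variable {V V' : Type} [DecidableEq V] [DecidableEq V']

/-- The image of a 3-graph under a bijection of vertices. -/
def mapEquiv (H : H3 V) (e : V ≃ V') : H3 V' where
  edges := H.edges.map (Finset.mapEmbedding e.toEmbedding).toEmbedding
  card3 := by
    intro s hs
    obtain ⟨s', hs', rfl⟩ := Finset.mem_map.1 hs
    exact (Finset.card_map _).trans (H.card3 s' hs')

theorem contains_of_mapEquiv {W : Type} [DecidableEq W] {H : H3 V} {e : V ≃ V'} {F : H3 W}
    (h : (mapEquiv H e).contains F) : H.contains F := by
  obtain ⟨f, hf, hfE⟩ := h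
  refine ⟨e.symm ∘ f, e.symm.injective.comp hf, fun s hs => ?_⟩
  obtain ⟨s', hs', heq⟩ := Finset.mem_map.1 (hfE s hs)
  have heq : s'.map e.toEmbedding = s.image f := heq
  convert hs'
  rw [← Finset.image_image, ← heq, Finset.map_eq_image, Finset.image_image]
  simp

theorem codeg_mapEquiv (H : H3 V) (e : V ≃ V') (u v : V') :
    (mapEquiv H e).codeg u v = H.codeg (e.symm u) (e.symm v) := by
  simp only [H3.codeg, mapEquiv, Finset.filter_map, Finset.card_map]
  congr 1
  refine Finset.filter_congr fun s _ => ?_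
  simp [Finset.mem_map_equiv]

end Transport

theorem codeg_le_card {V : Type} [DecidableEq V] [Fintype V] (H : H3 V) {u v : V} (huv : u ≠ v) :
    H.codeg u v ≤ Fintype.card V := by
  refine (Finset.card_le_card (t := Finset.univ.image fun w => {u, v, w}) fun e he => ?_).trans
    Finset.card_image_le
  obtain ⟨he, hu, hv⟩ := Finset.mem_filter.1 he
  have hsub : ({u, v} : Finset V) ⊆ e := by simp [Finset.insert_subset_iff, hu, hv]
  have hcard : (e \ {u, v}).card = 1 := by
    rw [Finset.card_sdiff_of_subset hsub, H.card3 e he, Finset.card_pair huv]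
  obtain ⟨w, hw⟩ := Finset.card_eq_one.1 hcard
  refine Finset.mem_image.2 ⟨w, Finset.mem_univ w, ?_⟩
  rw [← Finset.sdiff_union_of_subset hsub, hw]
  ext; simp; tauto

theorem minCodeg_le_card {V : Type} [DecidableEq V] [Fintype V] (H : H3 V) :
    H.minCodeg ≤ Fintype.card V := by
  rcases Set.eq_empty_or_nonempty {d | ∃ u v : V, u ≠ v ∧ H.codeg u v = d} with h | h
  · simp [H3.minCodeg, h]
  · obtain ⟨d, hd⟩ := h
    refine (Nat.sInf_le hd).trans ?_
    obtain ⟨u, v, huv, rfl⟩ := hd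
    exact codeg_le_card H huv

section Extremal

variable {W : Type} [DecidableEq W]

theorem exCodeg_le (n : ℕ) (F : H3 W) : exCodeg n F ≤ n := by
  refine csSup_le' ?_
  rintro d ⟨H, _, rfl⟩
  simpa using minCodeg_le_card H

theorem le_exCodeg {V : Type} [DecidableEq V] [Fintype V] {F : H3 W} {H : H3 V} {d : ℕ}
    (hV : 1 < Fintype.card V) (hfree : H.free F) (hd : ∀ u v, u ≠ v → d ≤ H.codeg u v) :
    d ≤ exCodeg (Fintype.card V) F := by
  let e := Fintype.equivFin V
  have hbdd : BddAbove {d | ∃ H : H3 (Fin (Fintype.card V)), H.free F ∧ H.minCodeg = d} := by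
    refine ⟨Fintype.card V, ?_⟩
    rintro d ⟨H, _, rfl⟩
    simpa using minCodeg_le_card H
  refine le_trans ?_ (le_csSup hbdd ⟨mapEquiv H e, fun h => hfree (contains_of_mapEquiv h), rfl⟩)
  obtain ⟨u, v, huv⟩ := Fintype.exists_pair_of_one_lt_card hV
  refine le_csInf ⟨_, e u, e v, e.injective.ne huv, rfl⟩ ?_
  rintro _ ⟨u, v, huv, rfl⟩
  rw [codeg_mapEquiv]
  exact hd _ _ (e.symm.injective.ne huv)

theorem eventually_exCodeg_lt {F : H3 W} (h : codegTuranDensity F = 0) {ε : ℝ} (hε : 0 < ε) :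
    ∀ᶠ n : ℕ in atTop, (exCodeg n F : ℝ) / n < ε := by
  refine eventually_lt_of_limsup_lt (h.trans_lt hε) (isBoundedUnder_of ⟨1, fun n => ?_⟩)
  exact div_le_one_of_le₀ (by exact_mod_cast exCodeg_le n F) (Nat.cast_nonneg n)

theorem hasVanishingColoring_of_codegTuranDensity_eq_zero [Fintype W] {F : H3 W}
    (h : codegTuranDensity F = 0) : HasVanishingColoring F := by
  let N := Fintype.card W * 7 + 15
  have hN : 14 < N := by omega
  have : NeZero N := ⟨by omega⟩
  obtain ⟨n₀, hn₀⟩ := eventually_atTop.1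
    (eventually_exCodeg_lt h (ε := 1 / (N * 2 ^ (N + 1))) (by positivity))
  let t := n₀ + 1
  have hcard : Fintype.card (Vert N t) = N * (2 ^ (N + t) - 1) := by
    rw [Fintype.card_prod, ZMod.card, Fintype.card_subtype_compl]
    simp [ZMod.card]
  have hlt : n₀ + 2 < 2 ^ (N + t) := by
    have : n₀ + 2 < N + t := by omega
    exact this.trans Nat.lt_two_pow_self
  have hle : 2 ^ (N + t) - 1 ≤ Fintype.card (Vert N t) := by
    rw [hcard]
    exact Nat.le_mul_of_pos_left _ (by omega)
  refine hasVanishingColoring_of_contains (N := N) (t := t) (hN := hN) (by omega) ?_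
  by_contra hfree
  have hex := le_exCodeg (V := Vert N t) (by omega) hfree fun u v huv => le_codeg_blockGraph huv
  have hsmall := hn₀ (Fintype.card (Vert N t)) (by omega)
  have hpos : (0 : ℝ) < Fintype.card (Vert N t) := by
    have : 0 < Fintype.card (Vert N t) := by omega
    exact_mod_cast this
  rw [div_lt_div_iff₀ hpos (by positivity), one_mul] at hsmall
  have hsmall : exCodeg (Fintype.card (Vert N t)) F * (N * 2 ^ (N + 1)) <
      Fintype.card (Vert N t) := by exact_mod_cast hsmall
  have hpow : 2 ^ (N + t) ≤ (2 ^ t - 1) * 2 ^ (N + 1) := by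
    rw [show N + t = n₀ + (N + 1) by omega, pow_add 2 n₀]
    refine Nat.mul_le_mul_right _ ?_
    have : 0 < 2 ^ n₀ := Nat.two_pow_pos n₀
    simp only [t, pow_succ]
    omega
  have hbound : Fintype.card (Vert N t) ≤
      exCodeg (Fintype.card (Vert N t)) F * (N * 2 ^ (N + 1)) := by
    calc Fintype.card (Vert N t) ≤ N * 2 ^ (N + t) := by
          rw [hcard]
          exact Nat.mul_le_mul_left _ (Nat.sub_le _ _)
      _ ≤ N * ((2 ^ t - 1) * 2 ^ (N + 1)) := Nat.mul_le_mul_left _ hpow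
      _ = (2 ^ t - 1) * (N * 2 ^ (N + 1)) := by ring
      _ ≤ _ := Nat.mul_le_mul_right _ hex
  omega

end Extremal

end CodegreeDensity

/-- If the codegree Turán density of a 3-graph `F` is zero, then its uniform
Turán density is zero. -/
theorem stmt0 {V : Type} [DecidableEq V] [Fintype V] (F : H3 V)
    (h : codegTuranDensity F = 0) : uniformTuranDensity F = 0 := by
  exact (CodegreeDensity.hasVanishingColoring_of_codegTuranDensity_eq_zero
    h).uniformTuranDensity_eq_zero
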